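/- arXiv:0707.3607 — 2 statements merged into one kernel-verified Lean document; each statement's English description precedes it below -/
import Mathlib

section
/- Let Γ be a finite generalized layered graph with a unique minimal vertex * with |*| = 0. Then, as formal power series over ℤ, H(A(Γ),z) · ( 1 − z + Σ (−1)^l (z^{|v_1| − |v_l| + 1} − z^{|v_1| + 1}) ) = 1 − z, where the sum runs over all chains v_1 > v_2 > ⋯ > v_l (l ≥ 1) of vertices with v_l ≠ * (here v > w means there is a directed path from v to w). -/
open scoped BigOperators

namespace GLG

variable {V E : Type}

def len (tl hd : E → V) (rk : V → ℕ) (e : E) : ℕ := rk (tl e) - rk (hd e)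
def IsRank (tl hd : E → V) (rk : V → ℕ) : Prop := ∀ e : E, rk (hd e) < rk (tl e)
def IsPathC (tl hd : E → V) (e : E) (es : List E) : Prop :=
  List.Chain (fun a b => hd a = tl b) e es
def pathDst (hd : E → V) (e : E) (es : List E) : V :=
  hd ((e :: es).getLast (List.cons_ne_nil e es))
def Reaches (tl hd : E → V) (v w : V) : Prop :=
  ∃ (e : E) (es : List E), IsPathC tl hd e es ∧ tl e = v ∧ pathDst hd e es = w

/-- The set `E^♯` of generators `a_i(e)`, `1 ≤ i ≤ l(e)`. -/
abbrev ESharp (tl hd : E → V) (rk : V → ℕ) : Type :=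
  Σ e : E, {i : ℕ // 1 ≤ i ∧ i ≤ len tl hd rk e}

/-- `P_e(t) = 1 + Σ_{j=1}^{l(e)} (-1)^j a_j(e) t^j`. -/
noncomputable def Pe (F : Type) [Field F] (tl hd : E → V) (rk : V → ℕ) (e : E) :
    Polynomial (FreeAlgebra F (ESharp tl hd rk)) :=
  1 + ∑ j ∈ (Finset.Icc 1 (len tl hd rk e)).attach,
      Polynomial.C ((-1 : FreeAlgebra F (ESharp tl hd rk)) ^ (j : ℕ) *
        FreeAlgebra.ι F (⟨e, ⟨(j : ℕ), (Finset.mem_Icc.mp j.2).1, (Finset.mem_Icc.mp j.2).2⟩⟩ :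
          ESharp tl hd rk)) *
      Polynomial.X ^ (j : ℕ)

/-- `e(π, j)`, the coefficient of `(-t)^j` in `P_π(t) = P_{e₁}(t) ⋯ P_{e_r}(t)`,
for `π` the path given by the list of edges `es`. -/
noncomputable def eP (F : Type) [Field F] (tl hd : E → V) (rk : V → ℕ)
    (es : List E) (j : ℕ) : FreeAlgebra F (ESharp tl hd rk) :=
  (-1 : FreeAlgebra F (ESharp tl hd rk)) ^ j * ((es.map (Pe F tl hd rk)).prod).coeff j

/-- The defining relations of `A(Γ)`: `e(π₁,j) = e(π₂,j)` for paths `π₁, π₂` with the same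
tail and the same head, and `1 ≤ j ≤ l(π₁)`. -/
def rel (F : Type) [Field F] (tl hd : E → V) (rk : V → ℕ) :
    FreeAlgebra F (ESharp tl hd rk) → FreeAlgebra F (ESharp tl hd rk) → Prop :=
  fun x y => ∃ (e1 : E) (es1 : List E) (e2 : E) (es2 : List E) (j : ℕ),
    IsPathC tl hd e1 es1 ∧ IsPathC tl hd e2 es2 ∧
    tl e1 = tl e2 ∧ pathDst hd e1 es1 = pathDst hd e2 es2 ∧
    1 ≤ j ∧ j ≤ rk (tl e1) - rk (pathDst hd e1 es1) ∧
    x = eP F tl hd rk (e1 :: es1) j ∧ y = eP F tl hd rk (e2 :: es2) j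

/-- The algebra `A(Γ) = T(E^♯)/R`. -/
noncomputable abbrev AGamma (F : Type) [Field F] (tl hd : E → V) (rk : V → ℕ) : Type :=
  RingQuot (rel F tl hd rk)

/-- The canonical projection `T(E^♯) → A(Γ)`. -/
noncomputable def mkA (F : Type) [Field F] (tl hd : E → V) (rk : V → ℕ) :
    FreeAlgebra F (ESharp tl hd rk) →ₐ[F] AGamma F tl hd rk :=
  RingQuot.mkAlgHom F (rel F tl hd rk)

/-- `f(a,j) = ja - j(j-1)/2`. -/
def fN (a j : ℕ) : ℕ := j * a - j * (j - 1) / 2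

/-- The filtration weight `|a_i(e)| = f(|t(e)|, i)` of a generator. -/
def wt (tl hd : E → V) (rk : V → ℕ) (s : ESharp tl hd rk) : ℕ := fN (rk (tl s.1)) s.2.1

/-- The filtration subspace `A(Γ)_n`: the span of the images of the products of generators
of total weight at most `n`. -/
noncomputable def filt (F : Type) [Field F] (tl hd : E → V) (rk : V → ℕ) (n : ℕ) :
    Submodule F (AGamma F tl hd rk) :=
  Submodule.span F {x : AGamma F tl hd rk | ∃ w : List (ESharp tl hd rk),
    (w.map (wt tl hd rk)).sum ≤ n ∧ x = mkA F tl hd rk ((w.map (FreeAlgebra.ι F)).prod)}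

/-- The degree-`n` homogeneous component `A(Γ)_{[n]}` (for the grading with `deg a_i(e) = i`):
the image in `A(Γ)` of the span of the words of total degree `n`. -/
noncomputable def gpiece (F : Type) [Field F] (tl hd : E → V) (rk : V → ℕ) (n : ℕ) :
    Submodule F (AGamma F tl hd rk) :=
  Submodule.span F {x : AGamma F tl hd rk | ∃ w : List (ESharp tl hd rk),
    (w.map (fun s => s.2.1)).sum = n ∧ x = mkA F tl hd rk ((w.map (FreeAlgebra.ι F)).prod)}

/-- The Hilbert series `H(A(Γ), z) = Σ_n dim_F A(Γ)_{[n]} · z^n ∈ ℤ[[z]]`. -/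
noncomputable def hilb (F : Type) [Field F] (tl hd : E → V) (rk : V → ℕ) : PowerSeries ℤ :=
  PowerSeries.mk fun n => (Module.finrank F (gpiece F tl hd rk n) : ℤ)


/-- `v ≥ w` in the poset of the graph. -/
def GE (tl hd : E → V) (v w : V) : Prop := v = w ∨ Reaches tl hd v w

/-- The Möbius function of the poset of the graph: the sum of `(-1)^(l+1)` over all
chains `v = v₁ > v₂ > ⋯ > v_l = w`. -/
noncomputable def mob (tl hd : E → V) (v w : V) : ℤ :=
  ∑ᶠ c ∈ {c : List V | c.Chain' (Reaches tl hd) ∧ c.head? = some v ∧ c.getLast? = some w},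
    (-1 : ℤ) ^ (c.length + 1)

/-- `M(Γ)(z) = Σ_{v ≥ w} μ(v,w) z^{|v|-|w|}`, as a formal power series over `ℤ`. -/
noncomputable def MGamma (tl hd : E → V) (rk : V → ℕ) : PowerSeries ℤ :=
  ∑ᶠ p ∈ {p : V × V | GE tl hd p.1 p.2},
    mob tl hd p.1 p.2 • (PowerSeries.X : PowerSeries ℤ) ^ (rk p.1 - rk p.2)

/-- `M_∘(Γ)(z) = Σ_{x ∈ V} μ(x, v_min) z^{|x|-|v_min|}`. -/
noncomputable def MLow (tl hd : E → V) (rk : V → ℕ) (vmin : V) : PowerSeries ℤ :=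
  ∑ᶠ x : V, mob tl hd x vmin • (PowerSeries.X : PowerSeries ℤ) ^ (rk x - rk vmin)

noncomputable def MUp (tl hd : E → V) (rk : V → ℕ) (vmax : V) : PowerSeries ℤ :=
  ∑ᶠ x : V, mob tl hd vmax x • (PowerSeries.X : PowerSeries ℤ) ^ (rk vmax - rk x)

end GLG

namespace HS
open Finset
section ps
variable {R : Type} [Ring R]

noncomputable def pinv (p : PowerSeries R) : PowerSeries R := PowerSeries.invOfUnit p 1

theorem mul_pinv {p : PowerSeries R} (h : PowerSeries.coeff 0 p = 1) : p * pinv p = 1 :=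
  PowerSeries.mul_invOfUnit p 1 (by simpa using h)
theorem pinv_mul {p : PowerSeries R} (h : PowerSeries.coeff 0 p = 1) : pinv p * p = 1 :=
  PowerSeries.invOfUnit_mul p 1 (by simpa using h)
theorem coeff_zero_pinv (p : PowerSeries R) : PowerSeries.coeff 0 (pinv p) = 1 := by
  simp [pinv]

noncomputable def Sop (p : PowerSeries R) (j l : ℕ) : R :=
  ∑ d ∈ range (j + 1), PowerSeries.coeff d (pinv p) * PowerSeries.coeff (j + l - d) p

theorem Sop_zero (p : PowerSeries R) (l : ℕ) : Sop p 0 l = PowerSeries.coeff l p := by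
  simp [Sop, coeff_zero_pinv, -PowerSeries.coeff_zero_eq_constantCoeff]

noncomputable def lo (k : ℕ) (g : PowerSeries R) : PowerSeries R :=
  PowerSeries.mk fun n => if n ≤ k then PowerSeries.coeff n g else 0

noncomputable def rs (f p : PowerSeries R) (k : ℕ) : PowerSeries R := f - lo k (f * pinv p) * p

def DegLe (f : PowerSeries R) (k : ℕ) : Prop := ∀ n, k < n → PowerSeries.coeff n f = 0

theorem lo_degLe (g : PowerSeries R) (k : ℕ) : DegLe (lo k g) k := by
  intro n hn
  simp [lo, Nat.not_le.mpr hn]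

theorem lo_eq {g : PowerSeries R} {k : ℕ} (h : DegLe g k) : lo k g = g := by
  ext n
  by_cases hn : n ≤ k
  · simp [lo, hn]
  · simp [lo, hn, h n (by omega)]

theorem DegLe.mul {f g : PowerSeries R} {a b : ℕ} (hf : DegLe f a) (hg : DegLe g b) :
    DegLe (f * g) (a + b) := by
  intro n hn
  rw [PowerSeries.coeff_mul]
  apply Finset.sum_eq_zero
  intro x hx
  rw [HasAntidiagonal.mem_antidiagonal] at hx
  by_cases h : a < x.1
  · rw [hf _ h, zero_mul]
  · rw [hg _ (by omega), mul_zero]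

theorem coeff_rs (f p : PowerSeries R) (k l : ℕ) :
    PowerSeries.coeff (k + l) (rs f p k) =
      PowerSeries.coeff (k + l) f -
        ∑ i ∈ range (k + 1), PowerSeries.coeff i f * Sop p (k - i) l := by
  have h1 : PowerSeries.coeff (k + l) (lo k (f * pinv p) * p) =
      ∑ a ∈ range (k + 1), PowerSeries.coeff a (f * pinv p) * PowerSeries.coeff (k + l - a) p := by
    rw [PowerSeries.coeff_mul, Finset.Nat.sum_antidiagonal_eq_sum_range_succ_mk]
    rw [← Finset.sum_subset (s₁ := range (k + 1))]
    · apply Finset.sum_congr rfl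
      intro a ha
      rw [mem_range] at ha
      simp [lo, Nat.lt_succ_iff.mp ha]
    · intro a ha; rw [mem_range] at *; omega
    · intro a _ ha
      rw [mem_range] at ha
      rw [lo_degLe _ _ _ (by omega), zero_mul]
  have h2 : ∀ a ∈ range (k + 1),
      PowerSeries.coeff a (f * pinv p) * PowerSeries.coeff (k + l - a) p =
      ∑ i ∈ range (a + 1), (fun i d => PowerSeries.coeff i f * (PowerSeries.coeff d (pinv p) *
        PowerSeries.coeff (k + l - i - d) p)) i (a - i) := by
    intro a _
    rw [PowerSeries.coeff_mul, Finset.Nat.sum_antidiagonal_eq_sum_range_succ_mk, Finset.sum_mul]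
    apply Finset.sum_congr rfl
    intro i hi
    rw [mem_range] at hi
    simp only
    rw [mul_assoc]
    congr 4
    omega
  rw [rs, map_sub, h1, Finset.sum_congr rfl h2,
    Finset.sum_range_diag_flip (k + 1) (fun i d => PowerSeries.coeff i f *
      (PowerSeries.coeff d (pinv p) * PowerSeries.coeff (k + l - i - d) p))]
  congr 1
  apply Finset.sum_congr rfl
  intro i hi
  rw [mem_range] at hi
  rw [Sop, Finset.mul_sum]
  have : k + 1 - i = k - i + 1 := by omega
  rw [this]
  apply Finset.sum_congr rfl
  intro d _
  congr 4
  omega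

theorem rs_eq {f p : PowerSeries R} (hp : PowerSeries.coeff 0 p = 1) (k : ℕ) :
    rs f p k = (f * pinv p - lo k (f * pinv p)) * p := by
  rw [sub_mul, mul_assoc f, pinv_mul hp, mul_one, rs]

theorem coeff_rs_low {f p : PowerSeries R} (hp : PowerSeries.coeff 0 p = 1) {k n : ℕ}
    (hn : n ≤ k) : PowerSeries.coeff n (rs f p k) = 0 := by
  rw [rs_eq hp, PowerSeries.coeff_mul]
  apply Finset.sum_eq_zero
  intro x hx
  rw [HasAntidiagonal.mem_antidiagonal] at hx
  have : x.1 ≤ k := by omega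
  simp [lo, this]

theorem rs_zero_of {f p : PowerSeries R} (hp : PowerSeries.coeff 0 p = 1) {k : ℕ}
    (h : DegLe (f * pinv p) k) : rs f p k = 0 := by
  rw [rs_eq hp, lo_eq h, sub_self, zero_mul]

theorem degLe_of_rs {f p : PowerSeries R} (hp : PowerSeries.coeff 0 p = 1) {k : ℕ}
    (h : rs f p k = 0) : DegLe (f * pinv p) k := by
  have h1 : f = lo k (f * pinv p) * p := by rwa [rs, sub_eq_zero] at h
  have h2 : f * pinv p = lo k (f * pinv p) := by
    conv_lhs => rw [h1]
    rw [mul_assoc, mul_pinv hp, mul_one]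
  rw [h2]
  exact lo_degLe _ _

theorem lo_sub (k : ℕ) (f g : PowerSeries R) : lo k (f - g) = lo k f - lo k g := by
  ext n
  simp only [lo, PowerSeries.coeff_mk, map_sub]
  split_ifs <;> simp

theorem rs_sub (f g p : PowerSeries R) (k : ℕ) : rs (f - g) p k = rs f p k - rs g p k := by
  simp only [rs, sub_mul, lo_sub]; abel

theorem rs_rs {f p u : PowerSeries R} (hu : PowerSeries.coeff 0 u = 1) {k l : ℕ}
    (h : DegLe (p * pinv u) l) : rs (rs f p k) u (k + l) = rs f u (k + l) := by
  conv_lhs => rw [rs.eq_1 f p k]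
  rw [rs_sub, rs_zero_of (f := lo k (f * pinv p) * p) hu, sub_zero]
  rw [mul_assoc]
  exact (lo_degLe _ _).mul h

/-- the overlap identity -/
theorem overlap {f p u : PowerSeries R} (hp : PowerSeries.coeff 0 p = 1)
    (hu : PowerSeries.coeff 0 u = 1) {k l : ℕ}
    (h : DegLe (p * pinv u) l) (m : ℕ) :
    PowerSeries.coeff (k + l) (rs f p k) * PowerSeries.coeff m u =
      PowerSeries.coeff (k + (l + m)) (rs f p k) - PowerSeries.coeff (k + l + m) (rs f u (k + l)) -
      ∑ i ∈ range l, PowerSeries.coeff (k + i) (rs f p k) * Sop u (l - i) m := by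
  rw [← rs_rs hu h, coeff_rs (rs f p k) u (k + l) m, Finset.sum_range_succ]
  have h1 : ∑ i ∈ range (k + l), PowerSeries.coeff i (rs f p k) * Sop u (k + l - i) m =
      ∑ i ∈ range l, PowerSeries.coeff (k + i) (rs f p k) * Sop u (l - i) m := by
    rw [Finset.sum_range_add, Finset.sum_eq_zero, zero_add]
    · apply Finset.sum_congr rfl
      intro i _
      congr 2; omega
    · intro i hi
      rw [mem_range] at hi
      rw [coeff_rs_low hp (by omega), zero_mul]
  rw [h1, Nat.sub_self, Sop_zero, ← add_assoc]
  abel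

theorem rs_zero_iff {f p : PowerSeries R} (hp : PowerSeries.coeff 0 p = 1) {k b : ℕ}
    (hf : DegLe f (k + b)) (hpb : DegLe p b)
    (h : ∀ l, 1 ≤ l → l ≤ b → PowerSeries.coeff (k + l) (rs f p k) = 0) : rs f p k = 0 := by
  ext n
  by_cases hn : n ≤ k
  · rw [coeff_rs_low hp hn]; simp
  · obtain ⟨l, rfl⟩ : ∃ l, n = k + l := ⟨n - k, by omega⟩
    by_cases hl : l ≤ b
    · rw [h l (by omega) hl]; simp
    · rw [coeff_rs, hf _ (by omega), Finset.sum_eq_zero]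
      · simp
      · intro i hi
        rw [Sop, Finset.sum_eq_zero, mul_zero]
        intro d hd
        rw [mem_range] at hi hd
        rw [hpb _ (by omega), mul_zero]

theorem inv_rel {R₂ : Type} [Ring R₂] (C : ℕ → R → R₂ → Prop) (h1 : C 0 1 1)
    (h0 : ∀ n, C n 0 0)
    (hadd : ∀ n a b a' b', C n a a' → C n b b' → C n (a + b) (a' + b'))
    (hneg : ∀ n a a', C n a a' → C n (-a) (-a'))
    (hmul : ∀ m n a b a' b', C m a a' → C n b b' → C (m + n) (a * b) (a' * b'))
    (f : PowerSeries R) (g : PowerSeries R₂)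
    (h : ∀ n, C n (PowerSeries.coeff n f) (PowerSeries.coeff n g)) (n : ℕ) :
    C n (PowerSeries.coeff n (pinv f)) (PowerSeries.coeff n (pinv g)) := by
  have hsum : ∀ (n : ℕ) (s : Finset (ℕ × ℕ)) (a : ℕ × ℕ → R) (b : ℕ × ℕ → R₂),
      (∀ i ∈ s, C n (a i) (b i)) → C n (∑ i ∈ s, a i) (∑ i ∈ s, b i) := by
    intro n s a b
    induction s using Finset.induction_on with
    | empty => intro _; simpa using h0 n
    | insert i s hi ih =>
      intro hh
      rw [Finset.sum_insert hi, Finset.sum_insert hi]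
      exact hadd _ _ _ _ _ (hh i (by simp)) (ih fun j hj => hh j (by simp [hj]))
  induction n using Nat.strong_induction_on with
  | _ n ih =>
    rw [pinv, pinv, PowerSeries.coeff_invOfUnit, PowerSeries.coeff_invOfUnit]
    split_ifs with hn
    · subst hn; simpa using h1
    · simp only [inv_one, Units.val_one, neg_mul, one_mul]
      apply hneg
      apply hsum
      intro x hx
      rw [HasAntidiagonal.mem_antidiagonal] at hx
      split_ifs with hlt
      · have := hmul _ _ _ _ _ _ (h x.1) (ih x.2 hlt)
        rw [hx] at this
        exact this
      · exact h0 n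

end ps
end HS

namespace HS
open Finset
section core
variable {V : Type} (rk : V → ℕ) (gt : V → V → Prop) (F : Type) [Field F]

def Bad (a b : V × ℕ) : Prop := gt a.1 b.1 ∧ a.2 + rk b.1 = rk a.1
def Normal (x : List (V × ℕ)) : Prop :=
  (∀ a ∈ x, 1 ≤ a.2 ∧ a.2 ≤ rk a.1) ∧ x.IsChain (fun a b => ¬ Bad rk gt a b)
abbrev NW : Type := {x : List (V × ℕ) // Normal rk gt x}
def W (a j : ℕ) : ℕ := j * (2 * a + 1 - j) + 1
def wgt (x : List (V × ℕ)) : ℕ := (x.map fun a => W (rk a.1) a.2).sum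
def ldeg (x : List (V × ℕ)) : ℕ := (x.map Prod.snd).sum
abbrev BB : Type := NW rk gt →₀ F

def GG (n N : ℕ) : Submodule F (BB rk gt F) :=
  Finsupp.supported F F {x : NW rk gt | ldeg x.1 = n ∧ wgt rk x.1 ≤ N}

theorem W_ineq1 {a b k l i d : ℕ} (ha : a = b + k) (hl : l ≤ b) (hik : i < k) (hd : d ≤ k - i)
    (hb : k - i + l - d ≤ b) :
    W a i + ((2 * b + 1) * d + W b (k - i + l - d)) < W a k + W b l := by
  subst ha
  obtain ⟨e, rfl⟩ : ∃ e, k = i + d + e := ⟨k - i - d, by omega⟩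
  have e1 : i + d + e - i + l - d = e + l := by omega
  rw [e1] at hb ⊢
  have hpos : 0 < d + e := by omega
  unfold W
  zify [show i ≤ 2 * (b + (i + d + e)) + 1 by omega, show e + l ≤ 2 * b + 1 by omega,
    show i + d + e ≤ 2 * (b + (i + d + e)) + 1 by omega, show l ≤ 2 * b + 1 by omega]
  zify at hpos
  nlinarith [mul_pos hpos hpos, mul_nonneg (Int.natCast_nonneg e) (Int.natCast_nonneg e),
    mul_nonneg (Int.natCast_nonneg l) (Int.natCast_nonneg e)]

theorem W_ineq2 {a b k l : ℕ} (ha : a = b + k) (hl : l ≤ b) :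
    W a (k + l) < W a k + W b l := by
  subst ha
  unfold W
  zify [show k + l ≤ 2 * (b + k) + 1 by omega,
    show k ≤ 2 * (b + k) + 1 by omega, show l ≤ 2 * b + 1 by omega]
  nlinarith

theorem W_ineq3 {b s : ℕ} (hs : 1 ≤ s) : W b s ≤ (2 * b + 1) * s := by
  unfold W
  by_cases h : s ≤ 2 * b + 1
  · zify [h]
    zify at hs
    nlinarith
  · rw [Nat.sub_eq_zero_of_le (by omega)]
    nlinarith

variable {rk gt F}

theorem Normal.tail {a : V × ℕ} {x : List (V × ℕ)} (h : Normal rk gt (a :: x)) :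
    Normal rk gt x :=
  ⟨fun b hb => h.1 b (List.mem_cons_of_mem _ hb), h.2.tail⟩

theorem normal_nil : Normal rk gt [] := ⟨by simp, List.isChain_nil⟩

theorem normal_cons {a : V × ℕ} {x : List (V × ℕ)} : Normal rk gt (a :: x) ↔
    (1 ≤ a.2 ∧ a.2 ≤ rk a.1) ∧ (∀ b ∈ x.head?, ¬ Bad rk gt a b) ∧ Normal rk gt x := by
  unfold Normal
  rw [List.isChain_cons]
  simp only [List.mem_cons, forall_eq_or_imp]
  tauto

theorem single_mem_GG (x : NW rk gt) {n N : ℕ} (h1 : ldeg x.1 = n) (h2 : wgt rk x.1 ≤ N) :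
    Finsupp.single x (1 : F) ∈ GG rk gt F n N :=
  Finsupp.single_mem_supported F 1 (show x ∈ {x : NW rk gt | ldeg x.1 = n ∧ wgt rk x.1 ≤ N} from
    ⟨h1, h2⟩)

theorem GG_mono {n N M : ℕ} (h : N ≤ M) : GG rk gt F n N ≤ GG rk gt F n M :=
  Finsupp.supported_mono fun _ hx => ⟨hx.1, hx.2.trans h⟩

theorem map_GG {M : Type} [AddCommGroup M] [Module F M] (f : BB rk gt F →ₗ[F] M)
    (S : Submodule F M) {n N : ℕ}
    (h : ∀ x : NW rk gt, ldeg x.1 = n → wgt rk x.1 ≤ N → f (Finsupp.single x 1) ∈ S)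
    {y : BB rk gt F} (hy : y ∈ GG rk gt F n N) : f y ∈ S := by
  have : y = y.sum fun x c => c • Finsupp.single x 1 := by
    conv_lhs => rw [← Finsupp.sum_single y]
    simp
  rw [this, map_finsuppSum]
  apply Submodule.sum_mem
  intro x hx
  dsimp only
  rw [map_smul]
  have := hy (Finset.mem_coe.mpr hx)
  exact S.smul_mem _ (h x this.1 this.2)

def Raise (d D : ℕ) (f : Module.End F (BB rk gt F)) : Prop :=
  ∀ n N x, x ∈ GG rk gt F n N → f x ∈ GG rk gt F (n + d) (N + D)

variable {A : Type} [Ring A] [Algebra F A]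

noncomputable def theta (P : V → PowerSeries A) : BB rk gt F →ₗ[F] A :=
  Finsupp.linearCombination F (fun x : NW rk gt =>
    (x.1.map fun a => PowerSeries.coeff a.2 (P a.1)).prod)

structure Good (P : V → PowerSeries A) (v : V) (p : PowerSeries (Module.End F (BB rk gt F))) :
    Prop where
  c0 : PowerSeries.coeff 0 p = 1
  dg : DegLe p (rk v)
  raise : ∀ i, Raise i (W (rk v) i) (PowerSeries.coeff i p)
  norm : ∀ i (x : NW rk gt) (h : Normal rk gt ((v, i) :: x.1)),
    PowerSeries.coeff i p (Finsupp.single x 1) = Finsupp.single ⟨_, h⟩ 1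
  eqv : ∀ i x, theta P (PowerSeries.coeff i p x) = PowerSeries.coeff i (P v) * theta P x

theorem Raise.mono {d D D' : ℕ} {f : Module.End F (BB rk gt F)} (h : Raise d D f) (hD : D ≤ D') :
    Raise d D' f := fun n N x hx => GG_mono (by omega) (h n N x hx)

theorem Raise.mul {d D d' D' : ℕ} {f g : Module.End F (BB rk gt F)} (hf : Raise d D f)
    (hg : Raise d' D' g) : Raise (d + d') (D + D') (f * g) := by
  intro n N x hx
  have := hf _ _ _ (hg n N x hx)
  rw [show n + (d + d') = n + d' + d by omega, show N + (D + D') = N + D' + D by omega]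
  exact this

theorem Good.pinv_prop {P : V → PowerSeries A} {w : V}
    {p : PowerSeries (Module.End F (BB rk gt F))} (hp : Good P w p)
    (hP : PowerSeries.coeff 0 (P w) = 1) (n : ℕ) :
    Raise n ((2 * rk w + 1) * n) (PowerSeries.coeff n (pinv p)) ∧
    ∀ x, theta P (PowerSeries.coeff n (pinv p) x) = PowerSeries.coeff n (pinv (P w)) * theta P x := by
  apply inv_rel (fun n (f : Module.End F (BB rk gt F)) (a : A) => Raise n ((2 * rk w + 1) * n) f ∧
    ∀ x, theta P (f x) = a * theta P x)
  · exact ⟨fun n N x hx => by simpa using hx, fun x => by simp⟩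
  · exact fun n => ⟨fun n N x hx => by simp, fun x => by simp⟩
  · intro n a b a' b' h1 h2
    refine ⟨fun m N x hx => ?_, fun x => ?_⟩
    · exact Submodule.add_mem _ (h1.1 m N x hx) (h2.1 m N x hx)
    · rw [LinearMap.add_apply, map_add, h1.2, h2.2, add_mul]
  · intro n a a' h1
    refine ⟨fun m N x hx => ?_, fun x => ?_⟩
    · exact Submodule.neg_mem _ (h1.1 m N x hx)
    · rw [LinearMap.neg_apply, map_neg, h1.2, neg_mul]
  · intro m n a b a' b' h1 h2
    refine ⟨?_, fun x => ?_⟩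
    · rw [mul_add]
      exact h1.1.mul h2.1
    · rw [Module.End.mul_apply, h1.2, h2.2, mul_assoc]
  · intro n
    refine ⟨?_, hp.eqv n⟩
    by_cases hn : n = 0
    · subst hn
      rw [hp.c0]
      exact fun n N x hx => by simpa using hx
    · exact (hp.raise n).mono (W_ineq3 (by omega))

theorem Good.Sop_raise {P : V → PowerSeries A} {w : V}
    {p : PowerSeries (Module.End F (BB rk gt F))} (hp : Good P w p)
    (hP : PowerSeries.coeff 0 (P w) = 1) {j l D : ℕ}
    (h : ∀ d, d ≤ j → j + l - d ≤ rk w → (2 * rk w + 1) * d + W (rk w) (j + l - d) ≤ D) :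
    Raise (j + l) D (Sop p j l) := by
  intro n N x hx
  rw [Sop, LinearMap.sum_apply]
  apply Submodule.sum_mem
  intro d hd
  rw [mem_range] at hd
  by_cases hdw : j + l - d ≤ rk w
  · have h1 := ((hp.pinv_prop hP d).1.mul (hp.raise (j + l - d))).mono (h d (by omega) hdw)
    rw [show d + (j + l - d) = j + l by omega] at h1
    exact h1 n N x hx
  · rw [hp.dg _ (by omega)]
    simp

theorem Good.Sop_eqv {P : V → PowerSeries A} {w : V}
    {p : PowerSeries (Module.End F (BB rk gt F))} (hp : Good P w p)
    (hP : PowerSeries.coeff 0 (P w) = 1) (j l : ℕ) (x : BB rk gt F) :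
    theta P (Sop p j l x) = Sop (P w) j l * theta P x := by
  rw [Sop, Sop, LinearMap.sum_apply, map_sum, Finset.sum_mul]
  apply Finset.sum_congr rfl
  intro d _
  rw [Module.End.mul_apply, (hp.pinv_prop hP d).2, hp.eqv, mul_assoc]

theorem exists_fix {ι M : Type} [AddCommGroup M] [Module F M] (μ : ι → ℕ) (lower : ι → ι →₀ F)
    (h : ∀ i j, j ∈ (lower i).support → μ j < μ i) (t : ι → M) :
    ∃ φ : ι → M, ∀ i, φ i = t i + Finsupp.linearCombination F φ (lower i) := by
  let φ : ι → M := (measure μ).wf.fix (fun i rec => t i +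
    ∑ j ∈ (lower i).support.attach, lower i j.1 • rec j.1 (h i j.1 j.2))
  refine ⟨φ, fun i => ?_⟩
  have : φ i = t i + ∑ j ∈ (lower i).support.attach, lower i j.1 • φ j.1 :=
    WellFounded.fix_eq _ _ _
  rw [this, Finsupp.linearCombination_apply, Finsupp.sum,
    Finset.sum_attach (lower i).support (fun j => lower i j • φ j)]

noncomputable def inj (i : ℕ) : BB rk gt F →ₗ[F] (ℕ × NW rk gt →₀ F) :=
  Finsupp.lmapDomain F F (fun y => (i, y))

def tl (x : NW rk gt) : NW rk gt := ⟨x.1.tail, by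
  obtain ⟨l, hl⟩ := x
  cases l with
  | nil => exact hl
  | cons a l => exact hl.tail⟩

open Classical in
noncomputable def lower (v : V) (pw : V → PowerSeries (Module.End F (BB rk gt F)))
    (ι : ℕ × NW rk gt) : ℕ × NW rk gt →₀ F :=
  match ι.2.1 with
  | [] => 0
  | (w, l) :: _ =>
    if Bad rk gt (v, ι.1) (w, l) then
      inj (ι.1 + l) (Finsupp.single (tl ι.2) 1) -
        ∑ i ∈ range ι.1, inj i (Sop (pw w) (ι.1 - i) l (Finsupp.single (tl ι.2) 1))
    else 0

open Classical in
noncomputable def target (F : Type) [Field F] (v : V) (ι : ℕ × NW rk gt) : BB rk gt F :=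
  if ι.1 = 0 then Finsupp.single ι.2 1 else
    if h : Normal rk gt ((v, ι.1) :: ι.2.1) then Finsupp.single ⟨_, h⟩ 1 else 0

end core
end HS

namespace HS
open Finset
section step
variable {V : Type} {rk : V → ℕ} {gt : V → V → Prop} {F : Type} [Field F]
variable {A : Type} [Ring A] [Algebra F A]

theorem inj_support {i : ℕ} {y : BB rk gt F} {n N : ℕ} (hy : y ∈ GG rk gt F n N)
    {κ : ℕ × NW rk gt} (hκ : κ ∈ (inj i y).support) :
    κ.1 = i ∧ ldeg κ.2.1 = n ∧ wgt rk κ.2.1 ≤ N := by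
  classical
  have := Finsupp.mapDomain_support hκ
  rw [Finset.mem_image] at this
  obtain ⟨z, hz, rfl⟩ := this
  have := hy (Finset.mem_coe.mpr hz)
  exact ⟨rfl, this.1, this.2⟩

theorem lower_support {P : V → PowerSeries A} {v : V}
    {pw : V → PowerSeries (Module.End F (BB rk gt F))}
    (hgt : ∀ v w, gt v w → rk w < rk v)
    (hP0 : ∀ w, PowerSeries.coeff 0 (P w) = 1)
    (hpw : ∀ w, gt v w → Good P w (pw w))
    (ι κ : ℕ × NW rk gt) (h : κ ∈ (lower v pw ι).support) :
    W (rk v) κ.1 + wgt rk κ.2.1 < W (rk v) ι.1 + wgt rk ι.2.1 ∧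
      κ.1 + ldeg κ.2.1 = ι.1 + ldeg ι.2.1 := by
  classical
  obtain ⟨k, x, hx⟩ := ι
  cases x with
  | nil => simp [lower] at h
  | cons a x =>
    obtain ⟨w, l⟩ := a
    simp only [lower] at h
    split_ifs at h with hb
    · obtain ⟨hvw, hk⟩ := hb
      simp only at hvw hk
      have hl := hx.1 (w, l) (by simp)
      simp only at hl
      have hx' := hx.tail
      have ht : (tl ⟨(w, l) :: x, hx⟩ : NW rk gt) = ⟨x, hx'⟩ := rfl
      rw [ht] at h
      have hxm : Finsupp.single (⟨x, hx'⟩ : NW rk gt) (1 : F) ∈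
        GG rk gt F (ldeg x) (wgt rk x) := single_mem_GG _ rfl le_rfl
      have hdeg : ldeg ((w, l) :: x) = l + ldeg x := by simp [ldeg]
      have hwgt : wgt rk ((w, l) :: x) = W (rk w) l + wgt rk x := by simp [wgt]
      simp only [hdeg, hwgt]
      have h2 := Finsupp.support_sub h
      rw [Finset.mem_union] at h2
      rcases h2 with h2 | h2
      · obtain ⟨e1, e2, e3⟩ := inj_support hxm h2
        rw [e1, e2]
        have := W_ineq2 (a := rk v) (b := rk w) (k := k) (l := l) (by omega) hl.2
        omega
      · have h3 := Finsupp.support_finsetSum h2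
        rw [Finset.mem_biUnion] at h3
        obtain ⟨i, hi, h3⟩ := h3
        rw [mem_range] at hi
        have hS : Raise (k - i + l) (W (rk v) k + W (rk w) l - 1 - W (rk v) i)
            (Sop (pw w) (k - i) l) := by
          apply (hpw w hvw).Sop_raise (hP0 w)
          intro d hd hdb
          have := W_ineq1 (a := rk v) (b := rk w) (k := k) (l := l) (by omega) hl.2 hi hd hdb
          omega
        obtain ⟨e1, e2, e3⟩ := inj_support (hS _ _ _ hxm) h3
        have := W_ineq1 (a := rk v) (b := rk w) (k := k) (l := l) (i := i) (d := k - i)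
          (by omega) hl.2 hi le_rfl (by omega)
        rw [e1, e2]
        omega
    · simp at h

theorem lc_inj {M : Type} [AddCommGroup M] [Module F M] (φ : ℕ × NW rk gt → M) (i : ℕ)
    (y : BB rk gt F) :
    Finsupp.linearCombination F φ (inj i y) =
      Finsupp.linearCombination F (fun x => φ (i, x)) y := by
  rw [inj, Finsupp.lmapDomain_apply, Finsupp.linearCombination_mapDomain]
  rfl

theorem theta_cons (P : V → PowerSeries A) (a : V × ℕ) (x : List (V × ℕ))
    (h : Normal rk gt (a :: x)) :
    theta P (Finsupp.single (⟨a :: x, h⟩ : NW rk gt) (1 : F)) =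
      PowerSeries.coeff a.2 (P a.1) * theta P (Finsupp.single (⟨x, h.tail⟩ : NW rk gt) (1 : F)) := by
  simp [theta]

set_option maxHeartbeats 1000000 in
theorem step {P : V → PowerSeries A} {v : V}
    {pw : V → PowerSeries (Module.End F (BB rk gt F))}
    (hgt : ∀ v w, gt v w → rk w < rk v) (htr : ∀ u v w, gt u v → gt v w → gt u w)
    (hP0 : ∀ w, PowerSeries.coeff 0 (P w) = 1) (hPd : DegLe (P v) (rk v))
    (hPr : ∀ w, gt v w → DegLe (P v * pinv (P w)) (rk v - rk w))
    (hpw : ∀ w, gt v w → Good P w (pw w))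
    (hrel : ∀ w u, gt v w → gt w u → DegLe (pw w * pinv (pw u)) (rk w - rk u)) :
    ∃ p, Good P v p ∧ ∀ w, gt v w → DegLe (p * pinv (pw w)) (rk v - rk w) := by
  classical
  have hsup := lower_support (P := P) (v := v) (pw := pw) hgt hP0 hpw
  obtain ⟨φ, hφ⟩ := exists_fix (F := F) (fun ι : ℕ × NW rk gt => W (rk v) ι.1 + wgt rk ι.2.1)
    (lower v pw) (fun i j h => (hsup i j h).1) (target F v)
  let T : ℕ → Module.End F (BB rk gt F) := fun i =>
    Finsupp.linearCombination F (fun x => φ (i, x))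
  have hT : ∀ i x, T i (Finsupp.single x 1) = φ (i, x) := by
    intro i x; simp [T]
  have hlow0 : ∀ (i : ℕ) (x : NW rk gt), (∀ b ∈ x.1.head?, ¬ Bad rk gt (v, i) b) →
      lower v pw (i, x) = 0 := by
    rintro i ⟨x, hx⟩ h
    cases x with
    | nil => rfl
    | cons a x =>
      simp only [lower]
      rw [if_neg (h a (by simp))]
  have φ0 : ∀ x, φ (0, x) = Finsupp.single x 1 := by
    intro x
    rw [hφ, hlow0, map_zero, add_zero, target, if_pos rfl]
    intro b _ hb
    have h1 := hb.2
    have h2 := hgt _ _ hb.1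
    simp only at h1 h2
    omega
  have φn : ∀ i (x : NW rk gt) (h : Normal rk gt ((v, i) :: x.1)),
      φ (i, x) = Finsupp.single ⟨_, h⟩ 1 := by
    intro i x h
    have h' := normal_cons.mp h
    have h'' : i ≠ 0 := by have := h'.1.1; simp only at this; omega
    rw [hφ, hlow0 i x h'.2.1, map_zero, add_zero, target, if_neg h'', dif_pos h]
  have φz : ∀ i x, rk v < i → φ (i, x) = 0 := by
    intro i x h
    rw [hφ, hlow0, map_zero, add_zero, target, if_neg (by simp only; omega), dif_neg]
    · intro h'
      have := (normal_cons.mp h').1.2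
      simp only at this; omega
    · intro b _ hb
      have := hb.2
      simp only at this; omega
  have φb : ∀ k w l x (h : Normal rk gt ((w, l) :: x)), Bad rk gt (v, k) (w, l) →
      φ (k, ⟨_, h⟩) = T (k + l) (Finsupp.single ⟨x, h.tail⟩ 1) -
        ∑ i ∈ range k, T i (Sop (pw w) (k - i) l (Finsupp.single ⟨x, h.tail⟩ 1)) := by
    intro k w l x h hb
    have hk0 : k ≠ 0 := by
      rintro rfl
      have h1 := hb.2
      have h2 := hgt _ _ hb.1
      simp only at h1 h2
      omega
    have ht : target F v (k, (⟨_, h⟩ : NW rk gt)) = 0 := by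
      rw [target, if_neg hk0, dif_neg]
      intro h'
      exact (normal_cons.mp h').2.1 (w, l) (by simp) hb
    rw [hφ, ht, zero_add]
    simp only [lower]
    rw [if_pos hb, map_sub, map_sum, lc_inj]
    simp only [lc_inj]
    rfl
  let p : PowerSeries (Module.End F (BB rk gt F)) := PowerSeries.mk T
  have hpT : ∀ i, PowerSeries.coeff i p = T i := fun i => PowerSeries.coeff_mk _ _
  have hc0 : PowerSeries.coeff 0 p = 1 := by
    rw [hpT]
    apply Finsupp.lhom_ext'
    intro x
    ext1
    simp only [LinearMap.comp_apply, Finsupp.lsingle_apply]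
    rw [hT, φ0]; rfl
  have hdg : DegLe p (rk v) := by
    intro n hn
    rw [hpT]
    apply Finsupp.lhom_ext'
    intro x
    ext1
    simp only [LinearMap.comp_apply, Finsupp.lsingle_apply]
    rw [hT, φz _ _ hn]; rfl
  have hmem : ∀ N (ι : ℕ × NW rk gt), W (rk v) ι.1 + wgt rk ι.2.1 = N →
      φ ι ∈ GG rk gt F (ι.1 + ldeg ι.2.1) N := by
    intro N
    induction N using Nat.strong_induction_on with
    | _ N ih =>
      intro ι hι
      rw [hφ]
      apply Submodule.add_mem
      · rw [target]
        split_ifs with h1 h2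
        · exact single_mem_GG _ (by omega) (by omega)
        · exact single_mem_GG _ (by simp [ldeg]) (by simp [wgt] at hι ⊢; omega)
        · exact Submodule.zero_mem _
      · rw [Finsupp.linearCombination_apply]
        apply Submodule.sum_mem
        intro κ hκ
        obtain ⟨h1, h2⟩ := hsup _ _ hκ
        apply Submodule.smul_mem
        have := ih _ (hι ▸ h1) κ rfl
        rw [h2] at this
        exact GG_mono (by omega) this
  have hraise : ∀ i, Raise i (W (rk v) i) (PowerSeries.coeff i p) := by
    intro i n N x hx
    rw [hpT]
    refine map_GG (T i) _ ?_ hx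
    intro y hy1 hy2
    rw [hT]
    have := hmem _ (i, y) rfl
    simp only [hy1] at this
    rw [add_comm n]
    exact GG_mono (by omega) this
  have hreq : ∀ w l x (h : Normal rk gt ((w, l) :: x)), gt v w →
      PowerSeries.coeff (rk v - rk w + l) (rs p (pw w) (rk v - rk w))
        (Finsupp.single ⟨x, h.tail⟩ 1) = 0 := by
    intro w l x h hvw
    have hlt := hgt _ _ hvw
    refine (LinearMap.congr_fun (coeff_rs p (pw w) (rk v - rk w) l) _).trans ?_
    rw [LinearMap.sub_apply, Finset.sum_range_succ, LinearMap.add_apply,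
      LinearMap.sum_apply, Nat.sub_self, Sop_zero]
    simp only [Module.End.mul_apply, hpT]
    rw [(hpw w hvw).norm l ⟨x, h.tail⟩ h, hT (rk v - rk w) ⟨_, h⟩,
      φb (rk v - rk w) w l x h ⟨hvw, by simp only; omega⟩]
    abel
  have hvan : ∀ N w l (x : NW rk gt), gt v w → 1 ≤ l → l ≤ rk w → W (rk w) l + wgt rk x.1 = N →
      PowerSeries.coeff (rk v - rk w + l) (rs p (pw w) (rk v - rk w)) (Finsupp.single x 1) = 0 := by
    intro N
    induction N using Nat.strong_induction_on with
    | _ N ih =>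
      rintro w l ⟨x, hx⟩ hvw hl1 hl2 hN
      have hlt := hgt _ _ hvw
      by_cases hn : Normal rk gt ((w, l) :: x)
      · exact hreq w l x hn hvw
      · have : ∃ u m y, x = (u, m) :: y ∧ Bad rk gt (w, l) (u, m) := by
          by_contra hcon
          apply hn
          rw [normal_cons]
          refine ⟨⟨hl1, hl2⟩, ?_, hx⟩
          intro b hb hbad
          cases x with
          | nil => simp at hb
          | cons c x =>
            simp at hb
            subst hb
            exact hcon ⟨c.1, c.2, x, rfl, hbad⟩
        obtain ⟨u, m, y, rfl, hwu, hlu⟩ := this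
        simp only at hwu hlu
        have hltu := hgt _ _ hwu
        have hvu := htr _ _ _ hvw hwu
        have hm := hx.1 (u, m) (by simp)
        simp only at hm
        have hlin : ∀ i M (z : BB rk gt F) n, 1 ≤ i → i ≤ rk w → z ∈ GG rk gt F n M →
            W (rk w) i + M < N →
            PowerSeries.coeff (rk v - rk w + i) (rs p (pw w) (rk v - rk w)) z = 0 := by
          intro i M z n hi1 hi2 hz hlt
          rw [← Submodule.mem_bot F]
          refine map_GG (PowerSeries.coeff (rk v - rk w + i) (rs p (pw w) (rk v - rk w))) ⊥ ?_ hz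
          intro q _ hq
          rw [Submodule.mem_bot]
          exact ih _ (by omega) w i q hvw hi1 hi2 rfl
        have hym : Finsupp.single (⟨y, hx.tail⟩ : NW rk gt) (1 : F) ∈
          GG rk gt F (ldeg y) (wgt rk y) := single_mem_GG _ rfl le_rfl
        have hwgt : wgt rk ((u, m) :: y) = W (rk u) m + wgt rk y := by simp [wgt]
        rw [← hN]  at hlin
        simp only [hwgt] at hlin
        have hov := overlap (f := p) (p := pw w) (u := pw u) (hpw w hvw).c0 (hpw u hvu).c0
          (k := rk v - rk w) (l := l) (by have := hrel w u hvw hwu; rwa [show l = rk w - rk u by omega])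
          m
        have hov' := LinearMap.congr_fun hov (Finsupp.single (⟨y, hx.tail⟩ : NW rk gt) (1 : F))
        rw [Module.End.mul_apply, (hpw u hvu).norm m ⟨y, hx.tail⟩ hx] at hov'
        rw [hov', LinearMap.sub_apply, LinearMap.sub_apply, LinearMap.sum_apply]
        have e1 := hlin (l + m) _ _ _ (by omega) (by omega) hym (by
          have := W_ineq2 (a := rk w) (b := rk u) (k := l) (l := m) (by omega) hm.2
          omega)
        have e2 := hreq u m y hx hvu
        rw [show rk v - rk u = rk v - rk w + l by omega] at e2
        rw [e1, e2, Finset.sum_eq_zero]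
        · simp
        · intro i hi
          rw [mem_range] at hi
          rw [Module.End.mul_apply]
          by_cases hi0 : i = 0
          · rw [hi0, coeff_rs_low (hpw w hvw).c0 (by omega)]; rfl
          · have hS : Raise (l - i + m) (W (rk w) l + W (rk u) m - 1 - W (rk w) i)
                (Sop (pw u) (l - i) m) := by
              apply (hpw u hvu).Sop_raise (hP0 u)
              intro d hd hdb
              have := W_ineq1 (a := rk w) (b := rk u) (k := l) (l := m) (by omega) hm.2 hi hd hdb
              omega
            have := W_ineq1 (a := rk w) (b := rk u) (k := l) (l := m) (i := i) (d := l - i)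
              (by omega) hm.2 hi le_rfl (by omega)
            exact hlin i _ _ _ (by omega) (by omega) (hS _ _ _ hym) (by omega)
  refine ⟨p, ⟨hc0, hdg, hraise, ?_, ?_⟩, ?_⟩
  · intro i x h
    rw [hpT, hT, φn i x h]
  · have key : ∀ N (ι : ℕ × NW rk gt), W (rk v) ι.1 + wgt rk ι.2.1 = N →
        theta P (φ ι) = PowerSeries.coeff ι.1 (P v) * theta P (Finsupp.single ι.2 (1 : F)) := by
      intro N
      induction N using Nat.strong_induction_on with
      | _ N ih =>
        rintro ⟨k, x, hx⟩ hN
        simp only at hN ⊢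
        by_cases hk0 : k = 0
        · subst hk0
          rw [φ0, hP0, one_mul]
        by_cases hkv : rk v < k
        · rw [φz _ _ hkv, hPd _ hkv, map_zero, zero_mul]
        by_cases hn : Normal rk gt ((v, k) :: x)
        · rw [φn k ⟨x, hx⟩ hn, theta_cons]
        · have : ∃ u m y, x = (u, m) :: y ∧ Bad rk gt (v, k) (u, m) := by
            by_contra hcon
            apply hn
            rw [normal_cons]
            refine ⟨⟨by simp only; omega, by simp only; omega⟩, ?_, hx⟩
            intro b hb hbad
            cases x with
            | nil => simp at hb
            | cons c x =>
              simp at hb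
              subst hb
              exact hcon ⟨c.1, c.2, x, rfl, hbad⟩
          obtain ⟨w, l, y, rfl, hbad⟩ := this
          have hlow : theta P (Finsupp.linearCombination F φ (lower v pw (k, ⟨_, hx⟩))) =
              Finsupp.linearCombination F (fun ι : ℕ × NW rk gt => PowerSeries.coeff ι.1 (P v) *
                theta P (Finsupp.single ι.2 (1 : F))) (lower v pw (k, ⟨_, hx⟩)) := by
            rw [Finsupp.linearCombination_apply, Finsupp.linearCombination_apply, Finsupp.sum,
              Finsupp.sum, map_sum]
            apply Finset.sum_congr rfl
            intro κ hκ
            rw [map_smul, ih _ (by have := (hsup _ _ hκ).1; simp only at this; omega) κ rfl]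
          have hlc : ∀ i (z : BB rk gt F), Finsupp.linearCombination F
              (fun ι : ℕ × NW rk gt => PowerSeries.coeff ι.1 (P v) *
                theta P (Finsupp.single ι.2 (1 : F))) (inj i z) =
              PowerSeries.coeff i (P v) * theta P z := by
            intro i z
            rw [lc_inj]
            induction z using Finsupp.induction_linear with
            | zero => simp
            | add f g hf hg => rw [map_add, hf, hg, map_add, mul_add]
            | single x c =>
              rw [Finsupp.linearCombination_single, ← mul_smul_comm, ← map_smul]
              simp
          have ht : target F v (k, (⟨_, hx⟩ : NW rk gt)) = 0 := by
            rw [target, if_neg hk0, dif_neg]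
            exact hn
          rw [hφ, ht, zero_add, hlow]
          simp only [lower]
          rw [if_pos hbad, map_sub, map_sum, hlc]
          simp only [hlc]
          obtain ⟨hvw, hk⟩ := hbad
          simp only at hvw hk
          have hr := rs_zero_of (hP0 w) (hPr w hvw)
          have hr2 := congrArg (PowerSeries.coeff (rk v - rk w + l)) hr
          rw [coeff_rs, map_zero, Finset.sum_range_succ, Nat.sub_self, Sop_zero,
            show rk v - rk w = k by omega, sub_eq_zero] at hr2
          simp only [(hpw w hvw).Sop_eqv (hP0 w)]
          rw [theta_cons]
          simp only [← mul_assoc]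
          rw [← Finset.sum_mul, ← sub_mul]
          rw [hr2, add_sub_cancel_left]
          rfl
    intro i x
    rw [hpT]
    induction x using Finsupp.induction_linear with
    | zero => simp
    | add f g hf hg => rw [map_add, map_add, hf, hg, map_add, mul_add]
    | single x c =>
      have : Finsupp.single x c = c • Finsupp.single x (1 : F) := by simp
      rw [this, map_smul, map_smul, map_smul, hT, key _ _ rfl, mul_smul_comm]
  · intro w hvw
    have hlt := hgt _ _ hvw
    apply degLe_of_rs (hpw w hvw).c0
    apply rs_zero_iff (hpw w hvw).c0 (b := rk w) _ (hpw w hvw).dg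
    · intro l hl1 hl2
      apply Finsupp.lhom_ext'
      intro x
      ext1
      simp only [LinearMap.comp_apply, Finsupp.lsingle_apply]
      rw [hvan _ w l x hvw hl1 hl2 rfl]; rfl
    · rwa [show rk v - rk w + rk w = rk v by omega]

theorem exists_rep (P : V → PowerSeries A)
    (hgt : ∀ v w, gt v w → rk w < rk v) (htr : ∀ u v w, gt u v → gt v w → gt u w)
    (hP0 : ∀ w, PowerSeries.coeff 0 (P w) = 1) (hPd : ∀ v, DegLe (P v) (rk v))
    (hPr : ∀ v w, gt v w → DegLe (P v * pinv (P w)) (rk v - rk w)) :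
    ∃ p : V → PowerSeries (Module.End F (BB rk gt F)),
      (∀ v, Good P v (p v)) ∧ ∀ v w, gt v w → DegLe (p v * pinv (p w)) (rk v - rk w) := by
  classical
  have hstep : ∀ (v : V) (rec : ∀ w, rk w < rk v → PowerSeries (Module.End F (BB rk gt F))),
      ∃ q : PowerSeries (Module.End F (BB rk gt F)),
        (∀ w (h : gt v w), Good P w (rec w (hgt _ _ h))) →
        (∀ w u (h : gt v w) (h' : gt w u), DegLe (rec w (hgt _ _ h) *
          pinv (rec u (hgt _ _ (htr _ _ _ h h')))) (rk w - rk u)) →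
        Good P v q ∧ ∀ w (h : gt v w), DegLe (q * pinv (rec w (hgt _ _ h))) (rk v - rk w) := by
    intro v rec
    by_cases h1 : ∀ w (h : gt v w), Good P w (rec w (hgt _ _ h))
    · by_cases h2 : ∀ w u (h : gt v w) (h' : gt w u), DegLe (rec w (hgt _ _ h) *
          pinv (rec u (hgt _ _ (htr _ _ _ h h')))) (rk w - rk u)
      · obtain ⟨q, hq1, hq2⟩ := step (P := P) (v := v)
          (pw := fun w => if h : rk w < rk v then rec w h else 1) hgt htr hP0 (hPd v) (hPr v)
          (fun w h => by rw [dif_pos (hgt _ _ h)]; exact h1 w h)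
          (fun w u h h' => by
            rw [dif_pos (hgt _ _ h), dif_pos (hgt _ _ (htr _ _ _ h h'))]; exact h2 w u h h')
        refine ⟨q, fun _ _ => ⟨hq1, fun w h => ?_⟩⟩
        have := hq2 w h
        rwa [dif_pos (hgt _ _ h)] at this
      · exact ⟨1, fun _ h => absurd h h2⟩
    · exact ⟨1, fun h => absurd h h1⟩
  choose q hq using hstep
  let p : V → PowerSeries (Module.End F (BB rk gt F)) := (measure rk).wf.fix q
  have hp : ∀ v, p v = q v (fun w _ => p w) := fun v => WellFounded.fix_eq _ _ _
  have main : ∀ n v, rk v = n → Good P v (p v) ∧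
      ∀ w, gt v w → DegLe (p v * pinv (p w)) (rk v - rk w) := by
    intro n
    induction n using Nat.strong_induction_on with
    | _ n ih =>
      intro v hv
      rw [hp v]
      exact hq v (fun w _ => p w) (fun w h => (ih _ (hv ▸ hgt _ _ h) w rfl).1)
        (fun w u h h' => (ih _ (hv ▸ hgt _ _ h) w rfl).2 u h')
  exact ⟨p, fun v => (main _ v rfl).1, fun v => (main _ v rfl).2⟩

end step
end HS

namespace HS
open Finset GLG
section alg
variable {F : Type} [Field F] {V E : Type} {tl hd : E → V} {rk : V → ℕ}

def Pth (tl hd : E → V) : List E → V → V → Prop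
  | [], v, w => v = w
  | e :: es, v, w => tl e = v ∧ Pth tl hd es (hd e) w

theorem pth_of_isPathC (e : E) (es : List E) (h : IsPathC tl hd e es) :
    Pth tl hd (e :: es) (tl e) (pathDst hd e es) := by
  induction es generalizing e with
  | nil => exact ⟨rfl, rfl⟩
  | cons e' es ih =>
    have h' : List.IsChain (fun a b => hd a = tl b) (e :: e' :: es) := h
    rw [List.isChain_cons_cons] at h'
    have := ih e' h'.2
    refine ⟨rfl, ?_⟩
    rw [h'.1]
    have e2 : pathDst hd e (e' :: es) = pathDst hd e' es := by
      simp [pathDst]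
    rw [e2]
    exact this

theorem isPathC_of_pth (e : E) (es : List E) (v w : V) (h : Pth tl hd (e :: es) v w) :
    IsPathC tl hd e es ∧ tl e = v ∧ pathDst hd e es = w := by
  induction es generalizing e v with
  | nil => exact ⟨List.isChain_singleton _, h.1, h.2⟩
  | cons e' es ih =>
    obtain ⟨h1, h2⟩ := h
    obtain ⟨i1, i2, i3⟩ := ih e' _ h2
    refine ⟨?_, h1, ?_⟩
    · show List.IsChain (fun a b => hd a = tl b) (e :: e' :: es)
      rw [List.isChain_cons_cons]
      exact ⟨i2.symm, i1⟩
    · have e2 : pathDst hd e (e' :: es) = pathDst hd e' es := by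
        simp [pathDst]
      rw [e2, i3]

theorem reaches_iff (v w : V) : Reaches tl hd v w ↔ ∃ es, es ≠ [] ∧ Pth tl hd es v w := by
  constructor
  · rintro ⟨e, es, h, rfl, rfl⟩
    exact ⟨e :: es, by simp, pth_of_isPathC e es h⟩
  · rintro ⟨es, hne, h⟩
    cases es with
    | nil => exact absurd rfl hne
    | cons e es => exact ⟨e, es, isPathC_of_pth e es v w h⟩

theorem Pth.append {es es' : List E} {u v w : V} (h : Pth tl hd es u v) (h' : Pth tl hd es' v w) :
    Pth tl hd (es ++ es') u w := by
  induction es generalizing u with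
  | nil => have : u = v := h
           subst this; exact h'
  | cons e es ih => exact ⟨h.1, ih h.2⟩

theorem reaches_trans (u v w : V) (h : Reaches tl hd u v) (h' : Reaches tl hd v w) :
    Reaches tl hd u w := by
  rw [reaches_iff] at *
  obtain ⟨a, ha, ha'⟩ := h
  obtain ⟨b, hb, hb'⟩ := h'
  exact ⟨a ++ b, by simp [ha], ha'.append hb'⟩

theorem Pth.rk_le (hr : IsRank tl hd rk) {es : List E} {v w : V} (h : Pth tl hd es v w) :
    rk w ≤ rk v := by
  induction es generalizing v with
  | nil => have : v = w := h
           subst this; exact le_rfl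
  | cons e es ih =>
    have := ih h.2
    have h2 := hr e
    have h3 := h.1
    subst h3
    omega

theorem reaches_rk (hr : IsRank tl hd rk) (v w : V) (h : Reaches tl hd v w) : rk w < rk v := by
  rw [reaches_iff] at h
  obtain ⟨a, ha, ha'⟩ := h
  cases a with
  | nil => exact absurd rfl ha
  | cons e es =>
    have := Pth.rk_le hr ha'.2
    have h2 := hr e
    have h3 := ha'.1
    subst h3
    omega

theorem Pth.degLe {R : Type} [Ring R] (hr : IsRank tl hd rk) {Q : E → PowerSeries R}
    (hQ : ∀ e, DegLe (Q e) (len tl hd rk e)) {es : List E} {v w : V} (h : Pth tl hd es v w) :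
    DegLe (es.map Q).prod (rk v - rk w) := by
  induction es generalizing v with
  | nil =>
    intro n hn
    simp only [List.map_nil, List.prod_nil, PowerSeries.coeff_one]
    rw [if_neg (by omega)]
  | cons e es ih =>
    have h1 := (hQ e).mul (ih h.2)
    have h2 := hr e
    have h3 := h.1
    have h4 := Pth.rk_le hr h.2
    subst h3
    rw [len] at h1
    rw [show rk (tl e) - rk (hd e) + (rk (hd e) - rk w) = rk (tl e) - rk w by omega] at h1
    simpa using h1

theorem Pth.prod_mul {R : Type} [Ring R] {Q : E → PowerSeries R} {g : V → PowerSeries R}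
    (hQ : ∀ e, Q e * g (hd e) = g (tl e)) {es : List E} {v w : V} (h : Pth tl hd es v w) :
    (es.map Q).prod * g w = g v := by
  induction es generalizing v with
  | nil => have : v = w := h
           subst this; simp
  | cons e es ih =>
    have h3 := h.1
    subst h3
    rw [List.map_cons, List.prod_cons, mul_assoc, ih h.2, hQ]

variable (F tl hd rk)

theorem coeff_Pe (e : E) (j : ℕ) : (Pe F tl hd rk e).coeff j =
    if j = 0 then 1 else if h : 1 ≤ j ∧ j ≤ len tl hd rk e then
      (-1) ^ j * FreeAlgebra.ι F (⟨e, ⟨j, h⟩⟩ : ESharp tl hd rk) else 0 := by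
  rw [Pe, Polynomial.coeff_add, Polynomial.finsetSum_coeff]
  simp only [Polynomial.coeff_C_mul_X_pow]
  by_cases hj : j = 0
  · subst hj
    rw [if_pos rfl, Finset.sum_eq_zero, Polynomial.coeff_one_zero, add_zero]
    intro x _
    have := (Finset.mem_Icc.mp x.2).1
    rw [if_neg (by omega)]
  · rw [if_neg hj, Polynomial.coeff_one, if_neg hj, zero_add]
    split_ifs with h
    · rw [Finset.sum_eq_single ⟨j, Finset.mem_Icc.mpr h⟩]
      · simp
      · intro b _ hb
        rw [if_neg]
        rintro rfl
        exact hb rfl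
      · simp
    · rw [Finset.sum_eq_zero]
      intro x _
      have := (Finset.mem_Icc.mp x.2)
      rw [if_neg]
      rintro rfl
      exact h this

theorem map_coeff_prod {R : Type} [Ring R] (g : FreeAlgebra F (ESharp tl hd rk) →+* R)
    (Q : E → PowerSeries R) (hQ : ∀ e j, g ((Pe F tl hd rk e).coeff j) = PowerSeries.coeff j (Q e))
    (es : List E) (j : ℕ) :
    g ((es.map (Pe F tl hd rk)).prod.coeff j) = PowerSeries.coeff j (es.map Q).prod := by
  induction es generalizing j with
  | nil =>
    simp only [List.map_nil, List.prod_nil, PowerSeries.coeff_one, Polynomial.coeff_one]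
    split_ifs <;> simp
  | cons e es ih =>
    rw [List.map_cons, List.prod_cons, List.map_cons, List.prod_cons, Polynomial.coeff_mul,
      PowerSeries.coeff_mul, map_sum]
    apply Finset.sum_congr rfl
    intro x _
    rw [map_mul, hQ, ih]

noncomputable def PE (e : E) : PowerSeries (AGamma F tl hd rk) :=
  PowerSeries.mk fun j => mkA F tl hd rk ((Pe F tl hd rk e).coeff j)

theorem PE_degLe (e : E) : DegLe (PE F tl hd rk e) (len tl hd rk e) := by
  intro n hn
  rw [PE, PowerSeries.coeff_mk, coeff_Pe, if_neg (by omega), dif_neg (by omega), map_zero]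

theorem coeff_PP (es : List E) (j : ℕ) :
    mkA F tl hd rk ((es.map (Pe F tl hd rk)).prod.coeff j) =
      PowerSeries.coeff j (es.map (PE F tl hd rk)).prod :=
  map_coeff_prod F tl hd rk (mkA F tl hd rk).toRingHom _
    (fun e j => by rw [PE, PowerSeries.coeff_mk]; rfl) es j

theorem prod_c0 {R : Type} [Ring R] (Q : E → PowerSeries R)
    (hQ : ∀ e, PowerSeries.coeff 0 (Q e) = 1) (es : List E) :
    PowerSeries.coeff 0 (es.map Q).prod = 1 := by
  induction es with
  | nil => simp
  | cons e es ih => simp [PowerSeries.coeff_mul, hQ, ih]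


theorem PE_c0 (e : E) : PowerSeries.coeff 0 (PE F tl hd rk e) = 1 := by
  rw [PE, PowerSeries.coeff_mk, coeff_Pe, if_pos rfl, map_one]

theorem PP_eq (hr : IsRank tl hd rk) {es es' : List E} {v w : V} (h0 : es ≠ []) (h0' : es' ≠ [])
    (h : Pth tl hd es v w) (h' : Pth tl hd es' v w) :
    (es.map (PE F tl hd rk)).prod = (es'.map (PE F tl hd rk)).prod := by
  ext j
  by_cases hj : j = 0
  · subst hj
    rw [prod_c0 _ (PE_c0 F tl hd rk), prod_c0 _ (PE_c0 F tl hd rk)]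
  by_cases hj2 : rk v - rk w < j
  · rw [h.degLe hr (PE_degLe F tl hd rk) _ hj2, h'.degLe hr (PE_degLe F tl hd rk) _ hj2]
  cases es with
  | nil => exact absurd rfl h0
  | cons e es =>
  cases es' with
  | nil => exact absurd rfl h0'
  | cons e' es' =>
    obtain ⟨a1, a2, a3⟩ := isPathC_of_pth e es v w h
    obtain ⟨b1, b2, b3⟩ := isPathC_of_pth e' es' v w h'
    have hrel : rel F tl hd rk (eP F tl hd rk (e :: es) j) (eP F tl hd rk (e' :: es') j) :=
      ⟨e, es, e', es', j, a1, b1, by rw [a2, b2], by rw [a3, b3], by omega,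
        by rw [a2, a3]; omega, rfl, rfl⟩
    have := RingQuot.mkAlgHom_rel F hrel
    change mkA F tl hd rk _ = mkA F tl hd rk _ at this
    rw [eP, eP, map_mul, map_mul, coeff_PP, coeff_PP, map_pow, map_neg, map_one] at this
    rcases neg_one_pow_eq_or (AGamma F tl hd rk) j with h1 | h1
    · rwa [h1, one_mul, one_mul] at this
    · rwa [h1, neg_one_mul, neg_one_mul, neg_inj] at this

variable {F tl hd rk}

theorem reaches_star (hr : IsRank tl hd rk) {star : V} (hmin : ∀ v : V, (∀ e : E, tl e ≠ v) ↔ v = star)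
    (v : V) (hv : v ≠ star) : Reaches tl hd v star := by
  induction hn : rk v using Nat.strong_induction_on generalizing v with
  | _ n ih =>
    have := mt (hmin v).mp hv
    push Not at this
    obtain ⟨e, he⟩ := this
    rw [reaches_iff]
    by_cases hs : hd e = star
    · exact ⟨[e], by simp, he, hs⟩
    · have hlt := hr e
      have := ih (rk (hd e)) (by rw [← hn, ← he]; exact hlt) (hd e) hs rfl
      rw [reaches_iff] at this
      obtain ⟨es, _, hes⟩ := this
      exact ⟨e :: es, by simp, he, hes⟩

theorem exists_Pv (F : Type) [Field F] (hr : IsRank tl hd rk) {star : V}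
    (hmin : ∀ v : V, (∀ e : E, tl e ≠ v) ↔ v = star) :
    ∃ (P : V → PowerSeries (AGamma F tl hd rk)) (π : V → List E),
      (∀ v, Pth tl hd (π v) v star) ∧ (∀ v, P v = ((π v).map (PE F tl hd rk)).prod) ∧
      (∀ e, PE F tl hd rk e * P (hd e) = P (tl e)) := by
  classical
  have h : ∀ v, ∃ es, Pth tl hd es v star ∧ (es = [] ↔ v = star) := by
    intro v
    by_cases hv : v = star
    · exact ⟨[], hv, by simp [hv]⟩
    · obtain ⟨es, h1, h2⟩ := (reaches_iff _ _).mp (reaches_star hr hmin v hv)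
      exact ⟨es, h2, by simp [hv, h1]⟩
  choose π hπ hπ2 using h
  refine ⟨_, π, hπ, fun v => rfl, fun e => ?_⟩
  rw [← List.prod_cons, ← List.map_cons]
  refine PP_eq F tl hd rk hr (v := tl e) (w := star) (by simp) ?_ ⟨rfl, hπ _⟩ (hπ _)
  rw [Ne, hπ2]
  intro h
  exact (hmin _).mpr h e rfl

theorem gpiece_mul {m n : ℕ} {x y : AGamma F tl hd rk} (hx : x ∈ gpiece F tl hd rk m)
    (hy : y ∈ gpiece F tl hd rk n) : x * y ∈ gpiece F tl hd rk (m + n) := by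
  have := Submodule.mul_mem_mul hx hy
  rw [gpiece, gpiece, Submodule.span_mul_span] at this
  refine Submodule.span_mono ?_ this
  rintro _ ⟨a, ⟨w, hw, rfl⟩, b, ⟨w', hw', rfl⟩, rfl⟩
  exact ⟨w ++ w', by simp [hw, hw'], by simp⟩

theorem gpiece_one : (1 : AGamma F tl hd rk) ∈ gpiece F tl hd rk 0 :=
  Submodule.subset_span ⟨[], by simp, by simp⟩

theorem gpiece_PE (e : E) (j : ℕ) :
    PowerSeries.coeff j (PE F tl hd rk e) ∈ gpiece F tl hd rk j := by
  rw [PE, PowerSeries.coeff_mk, coeff_Pe]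
  split_ifs with h1 h2
  · subst h1; rw [map_one]; exact gpiece_one
  · rw [map_mul, map_pow, map_neg, map_one]
    have : mkA F tl hd rk (FreeAlgebra.ι F ⟨e, ⟨j, h2⟩⟩) ∈ gpiece F tl hd rk j :=
      Submodule.subset_span ⟨[⟨e, ⟨j, h2⟩⟩], by simp, by simp⟩
    rcases neg_one_pow_eq_or (AGamma F tl hd rk) j with h1 | h1
    · rwa [h1, one_mul]
    · rw [h1, neg_one_mul]; exact Submodule.neg_mem _ this
  · rw [map_zero]; exact Submodule.zero_mem _

theorem gpiece_PP (es : List E) (j : ℕ) :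
    PowerSeries.coeff j (es.map (PE F tl hd rk)).prod ∈ gpiece F tl hd rk j := by
  induction es generalizing j with
  | nil =>
    simp only [List.map_nil, List.prod_nil, PowerSeries.coeff_one]
    split_ifs with h
    · subst h; exact gpiece_one
    · exact Submodule.zero_mem _
  | cons e es ih =>
    rw [List.map_cons, List.prod_cons, PowerSeries.coeff_mul]
    apply Submodule.sum_mem
    intro x hx
    rw [HasAntidiagonal.mem_antidiagonal] at hx
    rw [← hx]
    exact gpiece_mul (gpiece_PE e _) (ih _)

end alg
end HS

namespace HS
open Finset GLG
section rep
variable {F : Type} [Field F] {V E : Type} {tl hd : E → V} {rk : V → ℕ}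

theorem pinv_one_of {R : Type} [Ring R] {p : PowerSeries R} (h0 : PowerSeries.coeff 0 p = 1)
    (hd : DegLe p 0) : pinv p = 1 := by
  have h1 : p = 1 := by
    ext1 j
    by_cases hj : j = 0
    · subst hj; rw [h0]; simp
    · rw [hd j (by omega), PowerSeries.coeff_one, if_neg hj]
  have h2 := mul_pinv h0
  rw [h1] at h2 ⊢
  rwa [one_mul] at h2

theorem exists_hom {R : Type} [Ring R] [Algebra F R] (p : V → PowerSeries R)
    (hp0 : ∀ v, PowerSeries.coeff 0 (p v) = 1)
    (hd2 : ∀ e, DegLe (p (tl e) * pinv (p (hd e))) (len tl hd rk e)) :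
    ∃ ρ : AGamma F tl hd rk →ₐ[F] R,
      (∀ s : ESharp tl hd rk, ρ (mkA F tl hd rk (FreeAlgebra.ι F s)) =
        (-1 : F) ^ s.2.1 • PowerSeries.coeff s.2.1 (p (tl s.1) * pinv (p (hd s.1)))) ∧
      (∀ (es : List E) v w, Pth tl hd es v w → ∀ j,
        ρ (PowerSeries.coeff j (es.map (PE F tl hd rk)).prod) =
          PowerSeries.coeff j (p v * pinv (p w))) := by
  let q : E → PowerSeries R := fun e => p (tl e) * pinv (p (hd e))
  let f : FreeAlgebra F (ESharp tl hd rk) →ₐ[F] R :=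
    FreeAlgebra.lift F (fun s => (-1 : F) ^ s.2.1 • PowerSeries.coeff s.2.1 (q s.1))
  have hf : ∀ s, f (FreeAlgebra.ι F s) = (-1 : F) ^ s.2.1 • PowerSeries.coeff s.2.1 (q s.1) :=
    fun s => FreeAlgebra.lift_ι_apply _ _
  have hq : ∀ e j, f.toRingHom ((Pe F tl hd rk e).coeff j) = PowerSeries.coeff j (q e) := by
    intro e j
    show f ((Pe F tl hd rk e).coeff j) = _
    rw [coeff_Pe]
    split_ifs with h1 h2
    · subst h1
      simp only [q, PowerSeries.coeff_mul]
      simp [hp0, coeff_zero_pinv]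
    · rw [map_mul, map_pow, map_neg, map_one, hf]
      rcases Nat.even_or_odd j with h | h
      · simp only [h.neg_one_pow, one_mul, one_smul]
      · simp only [h.neg_one_pow, neg_one_mul, neg_smul, one_smul, neg_neg]
    · rw [map_zero]
      exact (hd2 e j (by omega)).symm
  have hpath : ∀ (es : List E) v w, Pth tl hd es v w → ∀ j,
      f ((es.map (Pe F tl hd rk)).prod.coeff j) = PowerSeries.coeff j (p v * pinv (p w)) := by
    intro es v w h j
    have h1 := map_coeff_prod F tl hd rk f.toRingHom q hq es j
    refine Eq.trans h1 ?_
    have h2 := Pth.prod_mul (Q := q) (g := p) (fun e => by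
      simp only [q]; rw [mul_assoc, pinv_mul (hp0 _), mul_one]) h
    rw [← h2, mul_assoc, mul_pinv (hp0 _), mul_one]
  have hrel : ∀ ⦃x y⦄, rel F tl hd rk x y → f x = f y := by
    rintro x y ⟨e1, es1, e2, es2, j, h1, h2, h3, h4, -, -, rfl, rfl⟩
    rw [eP, eP, map_mul, map_mul, hpath _ _ _ (pth_of_isPathC e1 es1 h1),
      hpath _ _ _ (pth_of_isPathC e2 es2 h2), h3, h4]
  refine ⟨RingQuot.liftAlgHom F ⟨f, hrel⟩, fun s => ?_, fun es v w h j => ?_⟩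
  · rw [mkA, RingQuot.liftAlgHom_mkAlgHom_apply, hf]
  · rw [← coeff_PP, mkA, RingQuot.liftAlgHom_mkAlgHom_apply, hpath _ _ _ h]

theorem GG_of_mem {gt : V → V → Prop} (x : BB rk gt F) (n : ℕ)
    (hx : x ∈ Finsupp.supported F F {y : NW rk gt | ldeg y.1 = n}) : ∃ N, x ∈ GG rk gt F n N := by
  refine ⟨x.support.sup (fun y => wgt rk y.1), fun y hy => ⟨hx hy, ?_⟩⟩
  exact Finset.le_sup (f := fun y : NW rk gt => wgt rk y.1) hy

theorem Raise.sum {gt : V → V → Prop} {ι : Type} {d D : ℕ} (s : Finset ι)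
    (f : ι → Module.End F (BB rk gt F)) (h : ∀ i ∈ s, Raise d D (f i)) :
    Raise d D (∑ i ∈ s, f i) := by
  intro n N x hx
  rw [LinearMap.sum_apply]
  exact Submodule.sum_mem _ fun i hi => h i hi n N x hx

theorem exists_basis (hr : IsRank tl hd rk) {star : V} (hstar0 : rk star = 0)
    (hmin : ∀ v : V, (∀ e : E, tl e ≠ v) ↔ v = star) :
    ∃ θ : BB rk (Reaches tl hd) F →ₗ[F] AGamma F tl hd rk, Function.Injective θ ∧
      ∀ n, gpiece F tl hd rk n =
        (Finsupp.supported F F {x : NW rk (Reaches tl hd) | ldeg x.1 = n}).map θ := by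
  obtain ⟨P, π, hπ, hPπ, hPe⟩ := exists_Pv F hr hmin
  have hP0 : ∀ w, PowerSeries.coeff 0 (P w) = 1 := fun w => by
    rw [hPπ, prod_c0 _ (PE_c0 F tl hd rk)]
  have hPd : ∀ v, DegLe (P v) (rk v) := fun v => by
    have := (hπ v).degLe hr (PE_degLe F tl hd rk)
    rwa [hstar0, ← hPπ] at this
  have hPr : ∀ v w, Reaches tl hd v w → DegLe (P v * pinv (P w)) (rk v - rk w) := by
    intro v w h
    obtain ⟨es, _, hes⟩ := (reaches_iff _ _).mp h
    have h2 := Pth.prod_mul hPe hes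
    rw [← h2, mul_assoc, mul_pinv (hP0 _), mul_one]
    exact hes.degLe hr (PE_degLe F tl hd rk)
  obtain ⟨p, hp, hpd⟩ := exists_rep (F := F) (gt := Reaches tl hd) P (reaches_rk hr) reaches_trans
    hP0 hPd hPr
  have hreach : ∀ e, Reaches tl hd (tl e) (hd e) := fun e =>
    (reaches_iff _ _).mpr ⟨[e], by simp, rfl, rfl⟩
  obtain ⟨ρ, hρ1, hρ2⟩ := exists_hom (F := F) p (fun v => (hp v).c0)
    (fun e => hpd _ _ (hreach e))
  have hpinv1 : pinv (p star) = 1 := pinv_one_of (hp star).c0 (hstar0 ▸ (hp star).dg)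
  have hρ3 : ∀ v j, ρ (PowerSeries.coeff j (P v)) = PowerSeries.coeff j (p v) := by
    intro v j
    rw [hPπ, hρ2 _ _ _ (hπ v), hpinv1, mul_one]
  let θ : BB rk (Reaches tl hd) F →ₗ[F] AGamma F tl hd rk := theta P
  let em : BB rk (Reaches tl hd) F := Finsupp.single ⟨[], normal_nil⟩ 1
  have hem : θ em = 1 := by simp [θ, em, theta]
  have hword : ∀ (l : List (V × ℕ)) (hl : Normal rk (Reaches tl hd) l),
      ρ ((l.map fun a => PowerSeries.coeff a.2 (P a.1)).prod) em = Finsupp.single ⟨l, hl⟩ 1 := by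
    intro l
    induction l with
    | nil => intro hl; simp [em]
    | cons a l ih =>
      intro hl
      rw [List.map_cons, List.prod_cons, map_mul, Module.End.mul_apply, ih hl.tail, hρ3]
      exact (hp a.1).norm a.2 ⟨l, hl.tail⟩ hl
  have hleft : ∀ x, ρ (θ x) em = x := by
    intro x
    induction x using Finsupp.induction_linear with
    | zero => simp
    | add x y hx hy => rw [map_add, map_add, LinearMap.add_apply, hx, hy]
    | single x c =>
      have : Finsupp.single x c = c • Finsupp.single x (1 : F) := by simp
      rw [this, map_smul, map_smul, LinearMap.smul_apply]
      congr 1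
      have h2 : θ (Finsupp.single x 1) = (x.1.map fun a => PowerSeries.coeff a.2 (P a.1)).prod := by
        simp [θ, theta]
      rw [h2]
      exact hword _ x.2
  have hgen : ∀ (e : E) j x, θ (PowerSeries.coeff j (p (tl e) * pinv (p (hd e))) x) =
      PowerSeries.coeff j (PE F tl hd rk e) * θ x := by
    intro e j x
    have h1 : PE F tl hd rk e = P (tl e) * pinv (P (hd e)) := by
      rw [← hPe, mul_assoc, mul_pinv (hP0 _), mul_one]
    rw [h1, PowerSeries.coeff_mul, PowerSeries.coeff_mul, LinearMap.sum_apply, map_sum, sum_mul]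
    apply Finset.sum_congr rfl
    intro y _
    rw [Module.End.mul_apply, mul_assoc]
    refine ((hp (tl e)).eqv _ _).trans ?_
    congr 1
    exact ((hp (hd e)).pinv_prop (hP0 _) _).2 _
  have hPEs : ∀ s : ESharp tl hd rk, mkA F tl hd rk (FreeAlgebra.ι F s) =
      (-1 : F) ^ s.2.1 • PowerSeries.coeff s.2.1 (PE F tl hd rk s.1) := by
    rintro ⟨e, j, hj⟩
    show _ = (-1 : F) ^ j • PowerSeries.coeff j (PE F tl hd rk e)
    rw [PE, PowerSeries.coeff_mk, coeff_Pe, if_neg (by omega), dif_pos hj]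
    rcases Nat.even_or_odd j with h | h
    · rw [h.neg_one_pow, h.neg_one_pow, one_mul, one_smul]
    · rw [h.neg_one_pow, h.neg_one_pow, ← map_smul]
      congr 1
      rw [Algebra.smul_def, map_neg, map_one]
      exact (by rw [← mul_assoc, neg_one_mul, neg_neg, one_mul])
  have hgen2 : ∀ (s : ESharp tl hd rk) x, θ (ρ (mkA F tl hd rk (FreeAlgebra.ι F s)) x) =
      mkA F tl hd rk (FreeAlgebra.ι F s) * θ x := by
    intro s x
    rw [hρ1, hPEs, smul_mul_assoc, ← hgen, LinearMap.smul_apply, map_smul]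
  have hwgen : ∀ (w : List (ESharp tl hd rk)) x,
      θ (ρ (mkA F tl hd rk ((w.map (FreeAlgebra.ι F)).prod)) x) =
      mkA F tl hd rk ((w.map (FreeAlgebra.ι F)).prod) * θ x := by
    intro w
    induction w with
    | nil => intro x; simp
    | cons s w ih =>
      intro x
      rw [List.map_cons, List.prod_cons, map_mul, map_mul, Module.End.mul_apply, hgen2, ih,
        mul_assoc]
  have hraise1 : ∀ s : ESharp tl hd rk, ∃ D, Raise s.2.1 D (ρ (mkA F tl hd rk (FreeAlgebra.ι F s))) := by
    intro s
    have h1 : ∃ D, Raise s.2.1 D (PowerSeries.coeff s.2.1 (p (tl s.1) * pinv (p (hd s.1)))) := by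
      have h0 : ∀ y : ℕ × ℕ, y ∈ antidiagonal s.2.1 → Raise s.2.1
          (W (rk (tl s.1)) y.1 + (2 * rk (hd s.1) + 1) * y.2)
          (PowerSeries.coeff y.1 (p (tl s.1)) * PowerSeries.coeff y.2 (pinv (p (hd s.1)))) := by
        intro y hy
        rw [HasAntidiagonal.mem_antidiagonal] at hy
        have := ((hp (tl s.1)).raise y.1).mul ((hp (hd s.1)).pinv_prop (hP0 _) y.2).1
        rwa [hy] at this
      refine ⟨(antidiagonal s.2.1).sup
        fun y => W (rk (tl s.1)) y.1 + (2 * rk (hd s.1) + 1) * y.2, ?_⟩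
      rw [PowerSeries.coeff_mul]
      apply Raise.sum
      intro y hy
      exact (h0 y hy).mono (Finset.le_sup (f := fun y : ℕ × ℕ =>
        W (rk (tl s.1)) y.1 + (2 * rk (hd s.1) + 1) * y.2) hy)
    obtain ⟨D, hD⟩ := h1
    refine ⟨D, ?_⟩
    rw [hρ1]
    intro n N x hx
    rw [LinearMap.smul_apply]
    exact Submodule.smul_mem _ _ (hD n N x hx)
  have hraise : ∀ w : List (ESharp tl hd rk), ∃ D, Raise (w.map fun s => s.2.1).sum D
      (ρ (mkA F tl hd rk ((w.map (FreeAlgebra.ι F)).prod))) := by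
    intro w
    induction w with
    | nil =>
      refine ⟨0, fun n N x hx => ?_⟩
      simpa using hx
    | cons s w ih =>
      obtain ⟨D, hD⟩ := ih
      obtain ⟨D', hD'⟩ := hraise1 s
      refine ⟨D' + D, ?_⟩
      rw [List.map_cons, List.sum_cons, List.map_cons, List.prod_cons, map_mul, map_mul]
      exact hD'.mul hD
  refine ⟨θ, Function.LeftInverse.injective (g := fun a => ρ a em) hleft, fun n => ?_⟩
  apply le_antisymm
  · rw [gpiece, Submodule.span_le]
    rintro _ ⟨w, hw, rfl⟩
    obtain ⟨D, hD⟩ := hraise w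
    refine ⟨ρ (mkA F tl hd rk ((w.map (FreeAlgebra.ι F)).prod)) em, ?_, ?_⟩
    · have h1 := hD 0 (wgt rk (V := V) []) em (single_mem_GG _ rfl le_rfl)
      intro y hy
      have := (h1 hy).1
      rw [zero_add] at this
      exact this.trans hw
    · rw [hwgen, hem, mul_one]
  · rw [Submodule.map_le_iff_le_comap]
    intro x hx
    obtain ⟨N, hN⟩ := GG_of_mem x n hx
    rw [Submodule.mem_comap]
    refine map_GG θ _ ?_ hN
    intro y hy _
    have h2 : θ (Finsupp.single y 1) = (y.1.map fun a => PowerSeries.coeff a.2 (P a.1)).prod := by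
      simp [θ, theta]
    rw [h2, ← hy]
    have : ∀ l : List (V × ℕ), (l.map fun a => PowerSeries.coeff a.2 (P a.1)).prod ∈
        gpiece F tl hd rk (ldeg l) := by
      intro l
      induction l with
      | nil => exact gpiece_one
      | cons a l ih =>
        rw [List.map_cons, List.prod_cons]
        refine gpiece_mul ?_ ih
        rw [hPπ]
        exact gpiece_PP _ _
    exact this _

theorem finrank_gpiece (hr : IsRank tl hd rk) {star : V} (hstar0 : rk star = 0)
    (hmin : ∀ v : V, (∀ e : E, tl e ≠ v) ↔ v = star) (n : ℕ) :
    Module.finrank F (gpiece F tl hd rk n) =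
      Nat.card {x : NW rk (Reaches tl hd) | ldeg x.1 = n} := by
  obtain ⟨θ, hθ, h⟩ := exists_basis (F := F) hr hstar0 hmin
  rw [h, ← (Submodule.equivMapOfInjective θ hθ _).finrank_eq,
    (Finsupp.supportedEquivFinsupp (M := F) (R := F) _).finrank_eq]
  exact Module.finrank_eq_nat_card_basis Finsupp.basisSingleOne

end rep
end HS

namespace HS
open Finset
section comb
variable {V : Type} [Fintype V] {rk : V → ℕ} {gt : V → V → Prop}

theorem fib {α ι M : Type} [AddCommMonoid M] (f : α → M) (I : Finset ι) (t : ι → Set α) (s : Set α)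
    (hs : s.Finite) (hmem : ∀ x, x ∈ s ↔ ∃ i ∈ I, x ∈ t i)
    (hdis : ∀ i ∈ I, ∀ j ∈ I, ∀ x, x ∈ t i → x ∈ t j → i = j) :
    ∑ᶠ x ∈ s, f x = ∑ i ∈ I, ∑ᶠ x ∈ t i, f x := by
  have h1 : s = ⋃ i ∈ (I : Set ι), t i := by
    ext x
    rw [hmem]
    simp
  rw [h1, finsum_mem_biUnion, finsum_mem_coe_finset]
  · intro i hi j hj hij
    rw [Function.onFun, Set.disjoint_left]
    intro x hx hx'
    exact hij (hdis i hi j hj x hx hx')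
  · exact I.finite_toSet
  · intro i hi
    exact hs.subset fun x hx => (hmem x).mpr ⟨i, hi, hx⟩

noncomputable def gen (S : Set (List (V × ℕ))) : PowerSeries ℤ :=
  PowerSeries.mk fun n => ∑ᶠ x ∈ {x | x ∈ S ∧ ldeg x = n}, (1 : ℤ)

theorem ldeg_cons (a : V × ℕ) (x : List (V × ℕ)) : ldeg (a :: x) = a.2 + ldeg x := by
  simp [ldeg]

theorem fin_pos (n : ℕ) : {x : List (V × ℕ) | (∀ a ∈ x, 1 ≤ a.2) ∧ ldeg x = n}.Finite := by
  induction n using Nat.strong_induction_on with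
  | _ n ih =>
    have h : (⋃ v : V, ⋃ l : Fin (n + 1), ⋃ _ : 1 ≤ l.1, (fun y => (v, l.1) :: y) ''
        {x : List (V × ℕ) | (∀ a ∈ x, 1 ≤ a.2) ∧ ldeg x = n - l.1}).Finite := by
      refine Set.finite_iUnion fun v => Set.finite_iUnion fun l => Set.finite_iUnion fun hl => ?_
      exact (ih _ (by omega)).image _
    refine (h.union (Set.finite_singleton [])).subset ?_
    rintro x ⟨h1, h2⟩
    cases x with
    | nil => right; rfl
    | cons a x =>
      left
      rw [ldeg_cons] at h2
      have ha := h1 a (by simp)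
      simp only [Set.mem_iUnion]
      exact ⟨a.1, ⟨a.2, by omega⟩, ha, x, ⟨fun b hb => h1 b (by simp [hb]), by simp; omega⟩, rfl⟩

theorem gen_fib {ι : Type} (I : Finset ι) (t : ι → Set (List (V × ℕ))) (S : Set (List (V × ℕ)))
    (hS : ∀ x ∈ S, ∀ a ∈ x, 1 ≤ a.2) (hmem : ∀ x, x ∈ S ↔ ∃ i ∈ I, x ∈ t i)
    (hdis : ∀ i ∈ I, ∀ j ∈ I, ∀ x, x ∈ t i → x ∈ t j → i = j) :
    gen S = ∑ i ∈ I, gen (t i) := by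
  ext n
  rw [gen, PowerSeries.coeff_mk, map_sum]
  simp only [gen, PowerSeries.coeff_mk]
  apply fib
  · exact (fin_pos n).subset fun x hx => ⟨hS x hx.1, hx.2⟩
  · intro x
    simp only [Set.mem_ofPred_eq]
    rw [hmem]
    tauto
  · intro i hi j hj x hx hx'
    exact hdis i hi j hj x hx.1 hx'.1

theorem gen_cons (a : V × ℕ) (S : Set (List (V × ℕ))) :
    gen ((fun y => a :: y) '' S) = PowerSeries.X ^ a.2 * gen S := by
  ext n
  rw [PowerSeries.coeff_X_pow_mul']
  simp only [gen, PowerSeries.coeff_mk]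
  split_ifs with h
  · have : {x | x ∈ (fun y => a :: y) '' S ∧ ldeg x = n} =
        (fun y => a :: y) '' {x | x ∈ S ∧ ldeg x = n - a.2} := by
      ext x
      constructor
      · rintro ⟨⟨y, hy, rfl⟩, h2⟩
        simp only [ldeg_cons] at h2
        exact ⟨y, ⟨hy, by omega⟩, rfl⟩
      · rintro ⟨y, ⟨hy, h2⟩, rfl⟩
        refine ⟨⟨y, hy, rfl⟩, ?_⟩
        simp only [ldeg_cons]
        omega
    rw [this, finsum_mem_image]
    intro x _ y _ hxy
    exact List.cons_injective hxy
  · have : {x | x ∈ (fun y => a :: y) '' S ∧ ldeg x = n} = ∅ := by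
      ext x
      simp only [Set.mem_empty_iff_false, iff_false]
      rintro ⟨⟨y, hy, rfl⟩, h2⟩
      simp only [ldeg_cons] at h2
      omega
    rw [this, finsum_mem_empty]

variable (rk gt)

def Nall : Set (List (V × ℕ)) := {x | Normal rk gt x}
def Nst (u : V) : Set (List (V × ℕ)) := {x | Normal rk gt x ∧ ∃ i y, x = (u, i) :: y}

variable {rk gt}

theorem Nall_eq : gen (Nall rk gt) = 1 + ∑ u, gen (Nst rk gt u) := by
  have h := gen_fib (univ : Finset (Option V)) (fun o => match o with
    | none => {[]}
    | some u => Nst rk gt u) (Nall rk gt) (fun x hx a ha => (hx.1 a ha).1) ?_ ?_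
  · rw [h, Fintype.sum_option]
    congr 1
    ext n
    simp only [gen, PowerSeries.coeff_mk, PowerSeries.coeff_one]
    split_ifs with hn
    · have : {x : List (V × ℕ) | x ∈ ({[]} : Set (List (V × ℕ))) ∧ ldeg x = n} = {[]} := by
        ext x
        constructor
        · exact fun h => h.1
        · intro h
          refine ⟨h, ?_⟩
          rw [Set.mem_singleton_iff.mp h, hn]; rfl
      rw [this, finsum_mem_singleton]
    · have : {x : List (V × ℕ) | x ∈ ({[]} : Set (List (V × ℕ))) ∧ ldeg x = n} = ∅ := by
        ext x
        simp only [Set.mem_empty_iff_false, iff_false]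
        rintro ⟨h1, h2⟩
        rw [Set.mem_singleton_iff.mp h1] at h2
        exact hn h2.symm
      rw [this, finsum_mem_empty]
  · intro x
    constructor
    · intro hx
      cases x with
      | nil => exact ⟨none, mem_univ _, rfl⟩
      | cons a x => exact ⟨some a.1, mem_univ _, hx, a.2, x, rfl⟩
    · rintro ⟨o, -, ho⟩
      cases o with
      | none => rw [Set.mem_singleton_iff.mp ho]; exact normal_nil
      | some u => exact ho.1
  · intro i _ j _ x hi hj
    cases i with
    | none =>
      have hx : x = [] := hi
      cases j with
      | none => rfl
      | some u => obtain ⟨_, i, y, h⟩ := hj; rw [hx] at h; cases h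
    | some v =>
      obtain ⟨_, i, y, h⟩ := hi
      cases j with
      | none => have hx : x = [] := hj
                rw [hx] at h; cases h
      | some u => obtain ⟨_, i', y', h'⟩ := hj; rw [h] at h'; cases h'; rfl

open Classical in
theorem Nst_eq (hgt : ∀ v w, gt v w → rk w < rk v) (w : V) :
    gen (Nst rk gt w) = gen (Nall rk gt) * (∑ l ∈ Icc 1 (rk w), PowerSeries.X ^ l) -
      ∑ u with gt w u, PowerSeries.X ^ (rk w - rk u) * gen (Nst rk gt u) := by
  let T : ℕ → Set (List (V × ℕ)) := fun l => {x | Normal rk gt x ∧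
    ∀ b ∈ x.head?, ¬ Bad rk gt (w, l) b}
  have h1 : gen (Nst rk gt w) = ∑ l ∈ Icc 1 (rk w), PowerSeries.X ^ l * gen (T l) := by
    rw [gen_fib (Icc 1 (rk w)) (fun l => (fun y => (w, l) :: y) '' T l) (Nst rk gt w)
      (fun x hx a ha => (hx.1.1 a ha).1)]
    · exact Finset.sum_congr rfl fun l _ => gen_cons _ _
    · intro x
      constructor
      · rintro ⟨hx, i, y, rfl⟩
        rw [normal_cons] at hx
        exact ⟨i, Finset.mem_Icc.mpr hx.1, y, ⟨hx.2.2, hx.2.1⟩, rfl⟩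
      · rintro ⟨l, hl, y, hy, rfl⟩
        refine ⟨?_, l, y, rfl⟩
        exact normal_cons.mpr ⟨Finset.mem_Icc.mp hl, hy.2, hy.1⟩
    · rintro i _ j _ x ⟨y, _, rfl⟩ ⟨y', _, h⟩
      have := (List.cons.inj h).1
      exact (Prod.mk.inj this).2.symm
  have h2 : ∀ l, gen (Nall rk gt) = gen (T l) +
      ∑ u with gt w u ∧ l + rk u = rk w, gen (Nst rk gt u) := by
    intro l
    have := gen_fib (insertNone (univ.filter fun u => gt w u ∧ l + rk u = rk w)) (fun o => match o with
      | none => T l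
      | some u => Nst rk gt u) (Nall rk gt) (fun x hx a ha => (hx.1 a ha).1) ?_ ?_
    · rw [this, Finset.sum_insertNone]
    · intro x
      constructor
      · intro hx
        by_cases hT : x ∈ T l
        · exact ⟨none, by simp, hT⟩
        · cases x with
          | nil => exact absurd ⟨hx, by simp⟩ hT
          | cons a x =>
            have hb : Bad rk gt (w, l) a := by
              by_contra hb
              exact hT ⟨hx, by simpa using hb⟩
            refine ⟨some a.1, ?_, hx, a.2, x, rfl⟩
            simp only [some_mem_insertNone, mem_filter, mem_univ, true_and]
            exact hb
      · rintro ⟨o, -, ho⟩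
        cases o with
        | none => exact ho.1
        | some u => exact ho.1
    · intro i hi j hj x hxi hxj
      have key : ∀ u, some u ∈ (insertNone (univ.filter fun u => gt w u ∧ l + rk u = rk w)) →
          x ∈ T l → x ∈ Nst rk gt u → False := by
        intro u hu h1 ⟨_, i, y, h2⟩
        simp only [some_mem_insertNone, mem_filter, mem_univ, true_and] at hu
        subst h2
        exact h1.2 (u, i) (by simp) hu
      cases i with
      | none =>
        cases j with
        | none => rfl
        | some u => exact (key u hj hxi hxj).elim
      | some v =>
        cases j with
        | none => exact (key v hi hxj hxi).elim
        | some u =>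
          obtain ⟨_, i, y, h⟩ := hxi
          obtain ⟨_, i', y', h'⟩ := hxj
          rw [h] at h'; cases h'; rfl
  rw [h1, eq_sub_iff_add_eq, mul_comm, Finset.sum_mul]
  have h3 : ∑ u with gt w u, PowerSeries.X ^ (rk w - rk u) * gen (Nst rk gt u) =
      ∑ l ∈ Icc 1 (rk w), PowerSeries.X ^ l *
        ∑ u with gt w u ∧ l + rk u = rk w, gen (Nst rk gt u) := by
    simp only [Finset.mul_sum]
    rw [Finset.sum_comm' (t' := univ.filter (gt w)) (s' := fun u => {rk w - rk u})]
    · simp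
    · intro l u
      simp only [mem_Icc, mem_filter, mem_univ, true_and, mem_singleton]
      constructor
      · rintro ⟨h, h', h''⟩
        exact ⟨by omega, h'⟩
      · rintro ⟨h, h'⟩
        have := hgt _ _ h'
        exact ⟨by omega, h', by omega⟩
  rw [h3, ← Finset.sum_add_distrib]
  apply Finset.sum_congr rfl
  intro l _
  rw [← mul_add, ← h2]

variable (rk gt)
def Cset (w : V) : Set (List V) := {c | c.IsChain gt ∧ c.getLast? = some w}
noncomputable def Ch (star w : V) : PowerSeries ℤ :=
  ∑ᶠ c ∈ Cset gt w, (-1 : PowerSeries ℤ) ^ c.length * PowerSeries.X ^ (rk (c.headD star) - rk w)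
variable {rk gt}

theorem chain_fin (hgt : ∀ v w, gt v w → rk w < rk v) : {c : List V | c.IsChain gt}.Finite := by
  refine (List.finite_length_le V (Fintype.card V)).subset fun c hc => ?_
  apply List.Nodup.length_le_card
  have h : c.IsChain (fun a b => rk b < rk a) := List.IsChain.imp (fun a b h => hgt a b h) hc
  have : IsTrans V (fun a b => rk b < rk a) := ⟨fun a b c h h' => lt_trans h' h⟩
  rw [List.isChain_iff_pairwise] at h
  exact h.imp fun {a b} hab => by rintro rfl; exact lt_irrefl _ hab

theorem head_rk (hgt : ∀ v w, gt v w → rk w < rk v) (star w : V) (c : List V) (hc : c ∈ Cset gt w) :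
    rk w ≤ rk (c.headD star) := by
  obtain ⟨h1, h2⟩ := hc
  induction c with
  | nil => simp at h2
  | cons a c ih =>
    cases c with
    | nil => simp at h2; simp [h2]
    | cons b c =>
      rw [List.isChain_cons_cons] at h1
      have := ih h1.2 (by simpa using h2)
      have h3 := hgt _ _ h1.1
      simp at this ⊢
      omega

open Classical in
theorem Ch_eq (hgt : ∀ v w, gt v w → rk w < rk v) (star w : V) :
    Ch rk gt star w = -1 - ∑ v with gt v w, Ch rk gt star v * PowerSeries.X ^ (rk v - rk w) := by
  have h := fib (fun c : List V => (-1 : PowerSeries ℤ) ^ c.length *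
      PowerSeries.X ^ (rk (c.headD star) - rk w)) (insertNone (univ.filter fun v => gt v w))
      (fun o => match o with
        | none => {[w]}
        | some v => (fun c => c ++ [w]) '' Cset gt v) (Cset gt w)
      ((chain_fin hgt).subset fun c hc => hc.1) ?_ ?_
  · rw [Ch, h, Finset.sum_insertNone, sub_eq_add_neg, ← Finset.sum_neg_distrib]
    congr 1
    · rw [finsum_mem_singleton]; simp
    · apply Finset.sum_congr rfl
      intro v hv
      have hv2 := hgt _ _ (Finset.mem_filter.mp hv).2
      rw [finsum_mem_image, ← neg_one_mul (Ch rk gt star v * _), Ch, finsum_mem_mul, mul_finsum_mem]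
      · apply finsum_mem_congr rfl
        intro c hc
        have h1 := head_rk hgt star v c hc
        have h2 : (c ++ [w]).headD star = c.headD star := by
          cases c with
          | nil => simp [Cset] at hc
          | cons a c => rfl
        rw [h2, List.length_append, show rk (c.headD star) - rk w =
          (rk (c.headD star) - rk v) + (rk v - rk w) by omega, pow_add, pow_add]
        simp [mul_assoc]
      · intro x _ y _ hxy
        exact List.append_cancel_right hxy
  · intro c
    constructor
    · rintro ⟨h1, h2⟩
      rcases List.eq_nil_or_concat' c with rfl | ⟨c, b, rfl⟩
      · simp at h2
      · simp at h2
        subst h2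
        rw [List.isChain_append] at h1
        cases hl : c.getLast? with
        | none =>
          rw [List.getLast?_eq_none_iff] at hl
          subst hl
          exact ⟨none, by simp, rfl⟩
        | some v =>
          refine ⟨some v, ?_, c, ⟨h1.1, hl⟩, rfl⟩
          simp only [some_mem_insertNone, mem_filter, mem_univ, true_and]
          exact h1.2.2 v hl b (by simp)
    · rintro ⟨o, ho, hc⟩
      cases o with
      | none =>
        rw [Set.mem_singleton_iff.mp hc]
        exact ⟨List.isChain_singleton _, by simp⟩
      | some v =>
        obtain ⟨c, hc, rfl⟩ := hc
        simp only [some_mem_insertNone, mem_filter, mem_univ, true_and] at ho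
        refine ⟨?_, by simp⟩
        show List.IsChain gt (c ++ [w])
        rw [List.isChain_append]
        refine ⟨hc.1, List.isChain_singleton _, ?_⟩
        intro x hx y hy
        have hx' := hc.2
        rw [Option.mem_def, hx'] at hx
        simp at hx hy
        subst hx; subst hy; exact ho
  · have key : ∀ v (c : List V), c ∈ (fun c => c ++ [w]) '' Cset gt v → c ∈ ({[w]} : Set (List V)) → False := by
      rintro v _ ⟨c, hc, rfl⟩ h
      have : c = [] := by simpa using h
      subst this
      simp [Cset] at hc
    intro i _ j _ x hi hj
    cases i with
    | none =>
      cases j with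
      | none => rfl
      | some u => exact (key u x hj hi).elim
    | some v =>
      cases j with
      | none => exact (key v x hi hj).elim
      | some u =>
        obtain ⟨c, hc, rfl⟩ := hi
        obtain ⟨c', hc', h⟩ := hj
        have := List.append_cancel_right h
        subst this
        have := hc.2.symm.trans hc'.2
        exact this

theorem main_id (hgt : ∀ v w, gt v w → rk w < rk v) (star : V) :
    gen (Nall rk gt) * (1 + ∑ w, Ch rk gt star w * ∑ l ∈ Icc 1 (rk w), PowerSeries.X ^ l) = 1 := by
  classical
  set H := gen (Nall rk gt) with hH
  have e1 : ∑ w, Ch rk gt star w * gen (Nst rk gt w) =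
      H * (∑ w, Ch rk gt star w * ∑ l ∈ Icc 1 (rk w), PowerSeries.X ^ l) -
      ∑ w, ∑ u with gt w u, Ch rk gt star w * (PowerSeries.X ^ (rk w - rk u) * gen (Nst rk gt u)) := by
    rw [Finset.mul_sum, ← Finset.sum_sub_distrib]
    apply Finset.sum_congr rfl
    intro w _
    rw [Nst_eq hgt, mul_sub]
    congr 1
    · ring
    · rw [Finset.mul_sum]
  have e2 : ∑ w, ∑ u with gt w u,
      Ch rk gt star w * (PowerSeries.X ^ (rk w - rk u) * gen (Nst rk gt u)) =
      ∑ u, (-1 - Ch rk gt star u) * gen (Nst rk gt u) := by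
    rw [Finset.sum_comm' (t' := univ) (s' := fun u => univ.filter (fun w => gt w u)) (by simp)]
    apply Finset.sum_congr rfl
    intro u _
    have := Ch_eq hgt star u
    have h2 : -1 - Ch rk gt star u = ∑ v with gt v u, Ch rk gt star v * PowerSeries.X ^ (rk v - rk u) := by
      conv_lhs => rw [this]
      ring
    rw [h2, Finset.sum_mul]
    exact Finset.sum_congr rfl fun v _ => by ring
  have e3 : ∑ u, (-1 - Ch rk gt star u) * gen (Nst rk gt u) =
      - (∑ u, gen (Nst rk gt u)) - ∑ u, Ch rk gt star u * gen (Nst rk gt u) := by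
    rw [← Finset.sum_neg_distrib, ← Finset.sum_sub_distrib]
    exact Finset.sum_congr rfl fun v _ => by ring
  have e4 : H = 1 + ∑ u, gen (Nst rk gt u) := Nall_eq
  rw [e2, e3] at e1
  linear_combination e4 - e1

theorem sum_chains (hgt : ∀ v w, gt v w → rk w < rk v) (star : V) (h0 : rk star = 0) :
    ∑ᶠ c ∈ {c : List V | c ≠ [] ∧ c.IsChain gt ∧ c.getLastD star ≠ star},
      (-1 : PowerSeries ℤ) ^ c.length *
        ((PowerSeries.X : PowerSeries ℤ) ^ (rk (c.headD star) - rk (c.getLastD star) + 1) -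
          (PowerSeries.X : PowerSeries ℤ) ^ (rk (c.headD star) + 1)) =
    (1 - PowerSeries.X) * ∑ w, Ch rk gt star w * ∑ l ∈ Icc 1 (rk w), PowerSeries.X ^ l := by
  classical
  rw [fib _ (univ.erase star) (fun w => Cset gt w) _
    ((chain_fin hgt).subset fun c hc => hc.2.1), ← Finset.sum_erase_add _ _ (mem_univ star), h0]
  · have : ∀ n, (1 - PowerSeries.X : PowerSeries ℤ) * ∑ l ∈ Icc 1 n, PowerSeries.X ^ l =
        PowerSeries.X - PowerSeries.X ^ (n + 1) := by
      intro n
      induction n with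
      | zero => simp
      | succ n ih => rw [Finset.sum_Icc_succ_top (by omega), mul_add, ih]; ring
    simp only [Icc_eq_empty (show ¬ 1 ≤ 0 by omega), sum_empty, mul_zero, add_zero]
    rw [Finset.mul_sum]
    apply Finset.sum_congr rfl
    intro w _
    rw [mul_left_comm, this, Ch, finsum_mem_mul]
    apply finsum_mem_congr rfl
    intro c hc
    have h1 := head_rk hgt star w c hc
    have h2 : c.getLastD star = w := by rw [List.getLastD_eq_getLast?, hc.2]; rfl
    rw [h2, mul_assoc]
    congr 1
    rw [mul_sub, ← pow_add, ← pow_succ]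
    congr 2
    omega
  · intro c
    constructor
    · rintro ⟨h1, h2, h3⟩
      refine ⟨c.getLastD star, by simpa using h3, h2, ?_⟩
      cases hl : c.getLast? with
      | none => exact absurd (List.getLast?_eq_none_iff.mp hl) h1
      | some v => rw [List.getLastD_eq_getLast?, hl]; rfl
    · rintro ⟨w, hw, hc⟩
      refine ⟨?_, hc.1, ?_⟩
      · rintro rfl; simp [Cset] at hc
      · rw [List.getLastD_eq_getLast?, hc.2]; simpa using hw
  · intro i _ j _ x hi hj
    exact Option.some.inj (hi.2.symm.trans hj.2)

theorem coeff_gen_Nall (n : ℕ) :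
    PowerSeries.coeff n (gen (Nall rk gt)) = Nat.card {x : NW rk gt | ldeg x.1 = n} := by
  rw [gen, PowerSeries.coeff_mk]
  have h1 : {x | x ∈ Nall rk gt ∧ ldeg x = n} = (fun x : NW rk gt => x.1) '' {x | ldeg x.1 = n} := by
    ext x
    constructor
    · rintro ⟨h, h'⟩; exact ⟨⟨x, h⟩, h', rfl⟩
    · rintro ⟨y, h, rfl⟩; exact ⟨y.2, h⟩
  have hf : {x : NW rk gt | ldeg x.1 = n}.Finite := by
    refine Set.Finite.of_finite_image (f := fun x : NW rk gt => x.1) ?_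
      (Subtype.val_injective.injOn)
    rw [← h1]
    exact (fin_pos n).subset fun x hx => ⟨fun a ha => (hx.1.1 a ha).1, hx.2⟩
  rw [h1, finsum_mem_image (Subtype.val_injective.injOn), Nat.card_coe_set_eq,
    finsum_mem_eq_finite_toFinset_sum _ hf, Set.ncard_eq_toFinset_card _ hf]
  simp

end comb
end HS


/-- **Theorem 4.1.** Let `Γ` be a finite generalized layered graph with a
unique minimal vertex `*` with `|*| = 0`.  Then, as formal power series over `ℤ`,
`H(A(Γ),z) · (1 - z + Σ (-1)^l (z^{|v₁|-|v_l|+1} - z^{|v₁|+1})) = 1 - z`,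
the sum being over all chains `v₁ > v₂ > ⋯ > v_l` (`l ≥ 1`) of vertices with `v_l ≠ *`. -/
theorem hilbert_series_formula (F : Type) [Field F] {V E : Type} [Fintype V] [Fintype E]
    (tl hd : E → V) (rk : V → ℕ) (hrank : GLG.IsRank tl hd rk)
    (star : V) (hstar0 : rk star = 0)
    (hmin : ∀ v : V, (∀ e : E, tl e ≠ v) ↔ v = star) :
    GLG.hilb F tl hd rk *
        (1 - PowerSeries.X +
          ∑ᶠ c ∈ {c : List V | c ≠ [] ∧ c.Chain' (GLG.Reaches tl hd) ∧
              c.getLastD star ≠ star},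
            (-1 : PowerSeries ℤ) ^ c.length *
              ((PowerSeries.X : PowerSeries ℤ) ^ (rk (c.headD star) - rk (c.getLastD star) + 1) -
                (PowerSeries.X : PowerSeries ℤ) ^ (rk (c.headD star) + 1))) =
      1 - PowerSeries.X := by
  have hgt := HS.reaches_rk hrank
  have h1 : GLG.hilb F tl hd rk = HS.gen (HS.Nall rk (GLG.Reaches tl hd)) := by
    ext n
    rw [HS.coeff_gen_Nall, GLG.hilb, PowerSeries.coeff_mk, HS.finrank_gpiece hrank hstar0 hmin]
  have h2 := HS.sum_chains (gt := GLG.Reaches tl hd) hgt star hstar0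
  have h3 := HS.main_id (gt := GLG.Reaches tl hd) hgt star
  rw [h1]
  refine (congrArg (fun s => HS.gen (HS.Nall rk (GLG.Reaches tl hd)) * (1 - PowerSeries.X + s))
    h2).trans ?_
  linear_combination (1 - PowerSeries.X) * h3
end

section
/- Let Γ be a finite generalized layered graph with a unique minimal vertex * with |*| = 0. Then, as formal power series over ℤ, H(A(Γ),z) · (1 − z·M(Γ)(z)) = 1 − z. -/
open scoped BigOperators

namespace GLGP

open PowerSeries Finset

section PS

variable {R : Type*} [Ring R]

/-- inverse of a series with constant term one -/
noncomputable def PI (W : PowerSeries R) : PowerSeries R := PowerSeries.invOfUnit W 1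

/-- truncation to degree at most `p` -/
noncomputable def Tr (p : ℕ) (W : PowerSeries R) : PowerSeries R :=
  PowerSeries.mk fun i => if i ≤ p then coeff i W else 0

noncomputable def BB (W : PowerSeries R) (p : ℕ) : PowerSeries R := Tr p (PI W) * W

noncomputable def GG (W : PowerSeries R) (p l : ℕ) : R := coeff (p + l) (BB W p)

lemma PI_mul {W : PowerSeries R} (h : coeff 0 W = 1) : PI W * W = 1 :=
  PowerSeries.invOfUnit_mul W 1 (by simpa using h)

lemma mul_PI {W : PowerSeries R} (h : coeff 0 W = 1) : W * PI W = 1 :=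
  PowerSeries.mul_invOfUnit W 1 (by simpa using h)

lemma PI_zero (W : PowerSeries R) : coeff 0 (PI W) = 1 := by
  simp [PI, PowerSeries.coeff_invOfUnit]

lemma PI_unique {W Y : PowerSeries R} (h : coeff 0 W = 1) (hy : Y * W = 1) : Y = PI W := by
  calc Y = Y * (W * PI W) := by rw [mul_PI h, mul_one]
    _ = PI W := by rw [← mul_assoc, hy, one_mul]

lemma PI_one : PI (1 : PowerSeries R) = 1 := (PI_unique (by simp) (by simp)).symm

lemma coeff_Tr (p i : ℕ) (W : PowerSeries R) :
    coeff i (Tr p W) = if i ≤ p then coeff i W else 0 := by simp [Tr]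

lemma coeff_Tr_mul_of_le {p n : ℕ} (hn : n ≤ p) (Y W : PowerSeries R) :
    coeff n (Tr p Y * W) = coeff n (Y * W) := by
  rw [coeff_mul, coeff_mul]
  refine Finset.sum_congr rfl fun x hx => ?_
  rw [HasAntidiagonal.mem_antidiagonal] at hx
  rw [coeff_Tr, if_pos (by omega)]

lemma BB_zero {W : PowerSeries R} (h : coeff 0 W = 1) (p : ℕ) : coeff 0 (BB W p) = 1 := by
  rw [BB, coeff_Tr_mul_of_le (Nat.zero_le _), PI_mul h]; simp

lemma BB_mid {W : PowerSeries R} (h : coeff 0 W = 1) {p m : ℕ} (h1 : 1 ≤ m) (h2 : m ≤ p) :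
    coeff m (BB W p) = 0 := by
  rw [BB, coeff_Tr_mul_of_le h2, PI_mul h, coeff_one, if_neg (by omega)]

lemma GG_zero (W : PowerSeries R) (l : ℕ) : GG W 0 l = coeff l W := by
  have : Tr 0 (PI W) = 1 := by
    ext i
    rw [coeff_Tr, coeff_one]
    by_cases hi : i = 0
    · subst hi; simp [PI_zero W]
    · rw [if_neg (by omega), if_neg hi]
  rw [GG, BB, this, one_mul, zero_add]

lemma coeff_mul_zero_of_deg {X Y : PowerSeries R} {a b : ℕ} (hX : ∀ k, a < k → coeff k X = 0)
    (hY : ∀ k, b < k → coeff k Y = 0) {n : ℕ} (hn : a + b < n) : coeff n (X * Y) = 0 := by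
  rw [coeff_mul]
  refine Finset.sum_eq_zero fun x hx => ?_
  rw [HasAntidiagonal.mem_antidiagonal] at hx
  by_cases h : a < x.1
  · rw [hX _ h, zero_mul]
  · rw [hY _ (by omega), mul_zero]

lemma Tr_deg (p : ℕ) (W : PowerSeries R) : ∀ k, p < k → coeff k (Tr p W) = 0 := by
  intro k hk; rw [coeff_Tr, if_neg (by omega)]

lemma GG_deg {W : PowerSeries R} {m : ℕ} (hW : ∀ k, m < k → coeff k W = 0) (p : ℕ) {l : ℕ}
    (hl : m < l) : GG W p l = 0 :=
  coeff_mul_zero_of_deg (Tr_deg p _) hW (by omega)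

lemma key (V W : PowerSeries R) (d n : ℕ) (hn : d ≤ n) :
    coeff n (Tr d (V * PI W) * W) =
      ∑ j ∈ range (d + 1), coeff j V * coeff (n - j) (BB W (d - j)) := by
  have h : Tr d (V * PI W) = ∑ j ∈ range (d + 1), C (coeff j V) * (X ^ j * Tr (d - j) (PI W)) := by
    ext m
    rw [coeff_Tr, map_sum]
    simp only [coeff_C_mul, coeff_X_pow_mul', coeff_Tr]
    split_ifs with hm
    · rw [coeff_mul, Finset.Nat.sum_antidiagonal_eq_sum_range_succ_mk]
      rw [← Finset.sum_subset (range_mono (show m + 1 ≤ d + 1 by omega))]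
      · refine Finset.sum_congr rfl fun j hj => ?_
        rw [mem_range] at hj
        rw [if_pos (by omega), if_pos (by omega)]
      · intro j _ hj
        rw [mem_range] at hj
        rw [if_neg (by omega), mul_zero]
    · symm
      refine Finset.sum_eq_zero fun j hj => ?_
      rw [mem_range] at hj
      split_ifs with h1 h2
      · omega
      · simp
      · simp
  rw [h, Finset.sum_mul, map_sum]
  refine Finset.sum_congr rfl fun j hj => ?_
  rw [mem_range] at hj
  rw [mul_assoc, coeff_C_mul, mul_assoc, coeff_X_pow_mul', if_pos (by omega), BB]

lemma fwd {V W : PowerSeries R} (h : coeff 0 W = 1) {d n : ℕ} (hn : d ≤ n)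
    (hd : ∀ k, d < k → coeff k (V * PI W) = 0) :
    coeff n V = ∑ j ∈ range (d + 1), coeff j V * coeff (n - j) (BB W (d - j)) := by
  rw [← key V W d n hn]
  have : Tr d (V * PI W) = V * PI W := by
    ext k; rw [coeff_Tr]; split_ifs with hk
    · rfl
    · rw [hd k (by omega)]
  rw [this, mul_assoc, PI_mul h, mul_one]

lemma bwd {V W : PowerSeries R} (h : coeff 0 W = 1) {d : ℕ}
    (hd : ∀ n, d < n → coeff n V =
      ∑ j ∈ range (d + 1), coeff j V * coeff (n - j) (BB W (d - j))) :
    ∀ k, d < k → coeff k (V * PI W) = 0 := by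
  have e : V = Tr d (V * PI W) * W := by
    ext n
    by_cases hn : n ≤ d
    · rw [coeff_Tr_mul_of_le hn, mul_assoc, PI_mul h, mul_one]
    · rw [key V W d n (by omega), ← hd n (by omega)]
  intro k hk
  have e2 : V * PI W = Tr d (V * PI W) := by
    conv_lhs => rw [e]
    rw [mul_assoc, mul_PI h, mul_one]
  rw [e2, Tr_deg d _ k hk]

lemma L3 {W U : PowerSeries R} (hW : coeff 0 W = 1) (hU : coeff 0 U = 1) {l : ℕ}
    (hd : ∀ k, l + 1 < k → coeff k (W * PI U) = 0) (p r : ℕ) :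
    GG W p (l + 1 + r) = GG U (p + (l + 1)) r +
      ∑ i ∈ range l, GG W p (i + 1) * GG U (l - i) r + GG W p (l + 1) * GG U 0 r := by
  have h1 : ∀ k, p + (l + 1) < k → coeff k (BB W p * PI U) = 0 := by
    intro k hk
    rw [BB, mul_assoc]
    exact coeff_mul_zero_of_deg (Tr_deg p _) hd hk
  have h2 := fwd hU (n := p + (l + 1 + r)) (by omega) h1
  rw [GG, h2]
  rw [show p + (l + 1) + 1 = (p + 1) + (l + 1) by omega, Finset.sum_range_add,
    Finset.sum_range_succ', Finset.sum_eq_zero, zero_add, Finset.sum_range_succ _ l, ← add_assoc]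
  · congr 1
    · congr 1
      · rw [BB_zero hW, one_mul, GG]; congr 2; omega
      · refine Finset.sum_congr rfl fun i hi => ?_
        rw [mem_range] at hi
        rw [GG, GG]
        congr 3 <;> omega
    · rw [GG, GG]
      congr 3 <;> omega
  · intro i hi
    rw [mem_range] at hi
    rw [BB_mid hW (by omega) (by omega), zero_mul]

section K
variable (K : ℕ → AddSubgroup R)

lemma K_mul (hm : ∀ i j x y, x ∈ K i → y ∈ K j → x * y ∈ K (i + j)) {X Y : PowerSeries R}
    (hX : ∀ k, coeff k X ∈ K k) (hY : ∀ k, coeff k Y ∈ K k) :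
    ∀ k, coeff k (X * Y) ∈ K k := by
  intro k
  rw [coeff_mul]
  refine AddSubgroup.sum_mem _ fun x hx => ?_
  rw [HasAntidiagonal.mem_antidiagonal] at hx
  exact hx ▸ hm _ _ _ _ (hX _) (hY _)

lemma PI_succ {X : PowerSeries R} (n : ℕ) : coeff (n + 1) (PI X) =
    - ∑ i ∈ range (n + 1), coeff (n + 1 - i) X * coeff i (PI X) := by
  rw [PI, coeff_invOfUnit, if_neg (by omega)]
  rw [← Finset.Nat.sum_antidiagonal_swap, Finset.Nat.sum_antidiagonal_eq_sum_range_succ_mk]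
  rw [Finset.sum_range_succ]
  simp only [Prod.fst_swap, Prod.snd_swap, lt_irrefl, if_false, add_zero, inv_one, Units.val_one,
    neg_mul, one_mul]
  congr 1
  refine Finset.sum_congr rfl fun i hi => ?_
  rw [if_pos (by simpa using hi)]

lemma K_PI (h1 : (1 : R) ∈ K 0)
    (hm : ∀ i j x y, x ∈ K i → y ∈ K j → x * y ∈ K (i + j)) {X : PowerSeries R} (hX : ∀ k, coeff k X ∈ K k) : ∀ k, coeff k (PI X) ∈ K k := by
  intro k
  induction k using Nat.strong_induction_on with
  | _ k ih =>
    cases k with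
    | zero => rw [PI_zero]; exact h1
    | succ n =>
      rw [PI_succ]
      refine AddSubgroup.neg_mem _ (AddSubgroup.sum_mem _ fun i hi => ?_)
      rw [mem_range] at hi
      have := hm _ _ _ _ (hX (n + 1 - i)) (ih i hi)
      rwa [show n + 1 - i + i = n + 1 by omega] at this

lemma K_BB (h1 : (1 : R) ∈ K 0)
    (hm : ∀ i j x y, x ∈ K i → y ∈ K j → x * y ∈ K (i + j)) {X : PowerSeries R} (hX : ∀ k, coeff k X ∈ K k) (p : ℕ) :
    ∀ k, coeff k (BB X p) ∈ K k := by
  refine K_mul K hm (fun k => ?_) hX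
  rw [coeff_Tr]
  split_ifs
  · exact K_PI K h1 hm hX k
  · exact AddSubgroup.zero_mem _

end K
end PS
end GLGP

namespace GLGP

open PowerSeries Finset

section Ops

variable {V : Type} (F : Type) [Field F] (rk : V → ℕ) (R : V → V → Prop)

/-- normal words -/
def Good : List (V × ℕ) → Prop
  | [] => True
  | x :: y => 1 ≤ x.2 ∧ x.2 ≤ rk x.1 ∧ Good y ∧
      ∀ u r y', y = (u, r) :: y' → ¬ (R x.1 u ∧ x.2 + rk u = rk x.1)

lemma Good.tail {x : V × ℕ} {y : List (V × ℕ)} (h : Good rk R (x :: y)) : Good rk R y := h.2.2.1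

abbrev TM (V : Type) (F : Type) [Field F] : Type := List (V × ℕ) →₀ F

open Classical in
noncomputable def cop (v : V) (k : ℕ) : Module.End F (TM V F) :=
  if k = 0 then 1 else Finsupp.linearCombination F (fun y =>
    if Good rk R ((v, k) :: y) then Finsupp.single ((v, k) :: y) 1 else 0)

lemma cop_zero (v : V) : cop F rk R v 0 = 1 := by simp [cop]

lemma cop_good {v : V} {k : ℕ} {y : List (V × ℕ)} (h : Good rk R ((v, k) :: y)) :
    cop F rk R v k (Finsupp.single y 1) = Finsupp.single ((v, k) :: y) 1 := by
  have : k ≠ 0 := by have := h.1; simp at this; omega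
  simp [cop, this, h]

lemma cop_bad {v : V} {k : ℕ} {y : List (V × ℕ)} (hk : k ≠ 0) (h : ¬ Good rk R ((v, k) :: y)) :
    cop F rk R v k (Finsupp.single y 1) = 0 := by
  simp [cop, hk, h]

open Classical in
noncomputable def act (v : V) (P : V → PowerSeries (Module.End F (TM V F))) :
    List (V × ℕ) → ℕ → TM V F
  | [], k => cop F rk R v k (Finsupp.single [] 1)
  | x :: m, k =>
    if k ≠ 0 ∧ R v x.1 ∧ k + rk x.1 = rk v ∧ Good rk R (x :: m) then
      act v P m (k + x.2) -
        ∑ j ∈ range k, cop F rk R v j (GG (P x.1) (k - j) x.2 (Finsupp.single m 1))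
    else cop F rk R v k (Finsupp.single (x :: m) 1)

open Classical in
noncomputable def Op (v : V) : PowerSeries (Module.End F (TM V F)) :=
  PowerSeries.mk fun k => Finsupp.linearCombination F (fun y =>
    act F rk R v (fun w => if h : rk w < rk v then Op w else 1) y k)
termination_by rk v

open Classical in
lemma Op_single (v : V) (k : ℕ) (y : List (V × ℕ)) :
    coeff k (Op F rk R v) (Finsupp.single y 1) =
    act F rk R v (fun w => if rk w < rk v then Op F rk R w else 1) y k := by
  rw [Op]; simp

lemma Op_nil (v : V) (k : ℕ) :
    coeff k (Op F rk R v) (Finsupp.single [] 1) = cop F rk R v k (Finsupp.single [] 1) := by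
  rw [Op_single, act]

lemma Op_cons {v w : V} (hR : R v w) (h : rk w < rk v) {k l : ℕ} {m : List (V × ℕ)}
    (hk : k + rk w = rk v) (hg : Good rk R ((w, l) :: m)) :
    coeff k (Op F rk R v) (Finsupp.single ((w, l) :: m) 1) =
      coeff (k + l) (Op F rk R v) (Finsupp.single m 1) -
      ∑ j ∈ range k, cop F rk R v j (GG (Op F rk R w) (k - j) l (Finsupp.single m 1)) := by
  rw [Op_single, Op_single, act, if_pos ⟨by omega, hR, hk, hg⟩]
  simp [h]

lemma Op_cop {v : V} {k : ℕ} {y : List (V × ℕ)}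
    (h : ∀ u r y', y = (u, r) :: y' → ¬ (R v u ∧ k + rk u = rk v)) :
    coeff k (Op F rk R v) (Finsupp.single y 1) = cop F rk R v k (Finsupp.single y 1) := by
  cases y with
  | nil => exact Op_nil ..
  | cons x m =>
    rw [Op_single, act, if_neg]
    rintro ⟨-, h1, h2, -⟩
    exact h x.1 x.2 m rfl ⟨h1, h2⟩

lemma Op_bad {v : V} {k : ℕ} {y : List (V × ℕ)} (hk : k ≠ 0) (hg : ¬ Good rk R y) :
    coeff k (Op F rk R v) (Finsupp.single y 1) = 0 := by
  cases y with
  | nil => exact absurd trivial hg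
  | cons x m =>
    rw [Op_single, act, if_neg (fun h => hg h.2.2.2), cop_bad F rk R hk (fun h => hg h.tail)]

lemma Op_zero (v : V) : coeff 0 (Op F rk R v) = 1 := by
  refine Finsupp.lhom_ext' fun y => LinearMap.ext_ring ?_
  change coeff 0 (Op F rk R v) (Finsupp.single y 1) = Finsupp.single y 1
  cases y with
  | nil => rw [Op_nil, cop_zero]; rfl
  | cons x m => rw [Op_single, act, if_neg (by simp), cop_zero]; rfl

lemma End_ext {f g : Module.End F (TM V F)}
    (h : ∀ y, f (Finsupp.single y 1) = g (Finsupp.single y 1)) : f = g :=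
  Finsupp.lhom_ext' fun y => LinearMap.ext_ring (h y)

lemma Op_good {v : V} {k : ℕ} {y : List (V × ℕ)} (h : Good rk R ((v, k) :: y)) :
    coeff k (Op F rk R v) (Finsupp.single y 1) = Finsupp.single ((v, k) :: y) 1 := by
  rw [Op_cop F rk R h.2.2.2, cop_good F rk R h]

lemma Op_deg (v : V) (k : ℕ) (hk : rk v < k) :
    coeff k (Op F rk R v) = 0 := by
  refine End_ext F fun y => ?_
  rw [Op_cop F rk R (fun u r y' _ h => by omega), cop_bad F rk R (by omega)]
  · rfl
  · intro h; have := h.2.1; simp at this; omega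

/-- words starting at or below `w` -/
def Sle (w : V) : Submodule F (TM V F) :=
  Finsupp.supported F F {y | ∃ u r y', y = (u, r) :: y' ∧ (u = w ∨ R w u)}

lemma single_mem_Sle {w u : V} (h : u = w ∨ R w u) (r : ℕ) (y : List (V × ℕ)) (a : F) :
    Finsupp.single ((u, r) :: y) a ∈ Sle F R w :=
  Finsupp.single_mem_supported F a ⟨u, r, y, rfl, h⟩

lemma Sle_induct {w : V} {f g : Module.End F (TM V F)}
    (h : ∀ u r y, (u = w ∨ R w u) →
      f (Finsupp.single ((u, r) :: y) 1) = g (Finsupp.single ((u, r) :: y) 1))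
    {z : TM V F} (hz : z ∈ Sle F R w) : f z = g z := by
  rw [Sle, Finsupp.supported_eq_span_single] at hz
  refine LinearMap.eqOn_span (s := _) ?_ hz
  rintro _ ⟨y, ⟨u, r, y', rfl, hu⟩, rfl⟩
  exact h u r y' hu

def KS (S : Submodule F (TM V F)) (k : ℕ) : AddSubgroup (Module.End F (TM V F)) where
  carrier := {f | ∀ z, (k = 0 → z ∈ S) → f z ∈ S}
  zero_mem' := fun z _ => S.zero_mem
  add_mem' := fun ha hb z hz => S.add_mem (ha z hz) (hb z hz)
  neg_mem' := fun ha z hz => S.neg_mem (ha z hz)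

lemma KS_one (S : Submodule F (TM V F)) : 1 ∈ KS F S 0 := fun _ hz => hz rfl

lemma KS_mul (S : Submodule F (TM V F)) (i j : ℕ) (x y : Module.End F (TM V F))
    (hx : x ∈ KS F S i) (hy : y ∈ KS F S j) : x * y ∈ KS F S (i + j) := by
  intro z hz
  by_cases hj : i = 0
  · exact hx _ fun _ => hy _ fun h => hz (by omega)
  · exact hx _ fun h => absurd h hj

lemma cop_mem_Sle {v : V} {k : ℕ} (hk : k ≠ 0) (z : TM V F) : cop F rk R v k z ∈ Sle F R v := by
  rw [cop, if_neg hk, Finsupp.linearCombination_apply]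
  refine Submodule.sum_mem _ fun y _ => Submodule.smul_mem _ _ ?_
  split_ifs
  · exact single_mem_Sle F R (Or.inl rfl) _ _ _
  · exact Submodule.zero_mem _

lemma mem_of_single {k : ℕ} {S : Submodule F (TM V F)} {f : Module.End F (TM V F)}
    (h : ∀ y, f (Finsupp.single y 1) ∈ S) : f ∈ KS F S k := by
  intro z hz
  clear hz
  induction z using Finsupp.induction_linear with
  | zero => rw [map_zero]; exact S.zero_mem
  | add a b ha hb => rw [map_add]; exact S.add_mem ha hb
  | single y a => 
    have : Finsupp.single y a = a • Finsupp.single y (1 : F) := by simp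
    rw [this, map_smul]; exact S.smul_mem _ (h y)

lemma Sle_mono (htr : ∀ u v w, R u v → R v w → R u w) {v w : V} (h : R v w) :
    Sle F R w ≤ Sle F R v := by
  refine Finsupp.supported_mono ?_
  rintro y ⟨u, r, y', rfl, hu⟩
  refine ⟨u, r, y', rfl, Or.inr ?_⟩
  rcases hu with rfl | hu
  · exact h
  · exact htr _ _ _ h hu

lemma Op_KS (hrk : ∀ v w, R v w → rk w < rk v) (htr : ∀ u v w, R u v → R v w → R u w) :
    ∀ n v, rk v = n → ∀ k, coeff k (Op F rk R v) ∈ KS F (Sle F R v) k := by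
  intro n
  induction n using Nat.strong_induction_on with
  | _ n ih =>
    intro v hv k
    by_cases hk : k = 0
    · subst hk; rw [Op_zero]; exact KS_one F _
    refine mem_of_single F fun y => ?_
    induction y generalizing k with
    | nil => rw [Op_nil]; exact cop_mem_Sle F rk R hk _
    | cons x m ihm =>
      obtain ⟨w, l⟩ := x
      by_cases hc : (R v w ∧ k + rk w = rk v) ∧ Good rk R ((w, l) :: m)
      · obtain ⟨⟨hR, hkk⟩, hg⟩ := hc
        rw [Op_cons F rk R hR (hrk _ _ hR) hkk hg]
        refine Submodule.sub_mem _ (ihm _ (by omega)) (Submodule.sum_mem _ fun j hj => ?_)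
        by_cases hj0 : j = 0
        · subst hj0
          rw [cop_zero]
          apply Sle_mono F R htr hR
          have hl := hg.1
          simp only at hl
          exact K_BB _ (KS_one F _) (KS_mul F _) (ih _ (hv ▸ hrk _ _ hR) w rfl) _ _ _
            (fun h => absurd h (by omega))
        · exact cop_mem_Sle F rk R hj0 _
      · by_cases hg : Good rk R ((w, l) :: m)
        · rw [Op_cop F rk R]
          · exact cop_mem_Sle F rk R hk _
          · rintro u r y' h; cases h
            exact fun h => hc ⟨h, hg⟩
        · rw [Op_bad F rk R hk hg]; exact Submodule.zero_mem _

lemma GG_mem (hrk : ∀ v w, R v w → rk w < rk v) (htr : ∀ u v w, R u v → R v w → R u w)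
    (w : V) (p : ℕ) {l : ℕ} (hl : 1 ≤ l) (z : TM V F) :
    GG (Op F rk R w) p l z ∈ Sle F R w :=
  K_BB _ (KS_one F _) (KS_mul F _) (Op_KS F rk R hrk htr _ w rfl) _ _ _
            (fun h => absurd h (by omega))

def KB (y : TM V F) (k : ℕ) : AddSubgroup (Module.End F (TM V F)) where
  carrier := {f | ∃ c : F, (k ≠ 0 → c = 0) ∧ f y = c • y}
  zero_mem' := ⟨0, by simp⟩
  add_mem' := by
    rintro a b ⟨c, hc, h⟩ ⟨d, hd, h'⟩
    exact ⟨c + d, fun hk => by rw [hc hk, hd hk, add_zero], by simp [h, h', add_smul]⟩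
  neg_mem' := by
    rintro a ⟨c, hc, h⟩
    exact ⟨-c, fun hk => by rw [hc hk, neg_zero], by simp [h]⟩

lemma KB_one (y : TM V F) : 1 ∈ KB F y 0 := ⟨1, by simp, by simp⟩

lemma KB_mul (z : TM V F) (i j : ℕ) (x y : Module.End F (TM V F))
    (hx : x ∈ KB F z i) (hy : y ∈ KB F z j) : x * y ∈ KB F z (i + j) := by
  obtain ⟨c, hc, h⟩ := hx
  obtain ⟨d, hd, h'⟩ := hy
  refine ⟨c * d, fun hk => ?_, by simp [h, h', smul_smul, mul_comm]⟩
  by_cases hi : i = 0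
  · rw [hd (by omega), mul_zero]
  · rw [hc hi, zero_mul]

lemma Op_KB {y : List (V × ℕ)} (hg : ¬ Good rk R y) (v : V) (k : ℕ) :
    coeff k (Op F rk R v) ∈ KB F (Finsupp.single y 1) k := by
  by_cases hk : k = 0
  · subst hk; rw [Op_zero]; exact KB_one F _
  · exact ⟨0, by simp, by rw [Op_bad F rk R hk hg, zero_smul]⟩

lemma GG_bad {y : List (V × ℕ)} (hg : ¬ Good rk R y) (w : V) (p : ℕ) {l : ℕ} (hl : 1 ≤ l) :
    GG (Op F rk R w) p l (Finsupp.single y 1) = 0 := by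
  obtain ⟨c, hc, h⟩ := K_BB _ (KB_one F (Finsupp.single y 1)) (KB_mul F _) (Op_KB F rk R hg w) p
    (p + l)
  rw [GG, h, hc (by omega), zero_smul]

/-- grading -/
def Tdeg (n : ℕ) : Submodule F (TM V F) :=
  Finsupp.supported F F {y | (y.map Prod.snd).sum = n}

def KD (k : ℕ) : AddSubgroup (Module.End F (TM V F)) where
  carrier := {f | ∀ n, ∀ z ∈ Tdeg F n, f z ∈ Tdeg F (n + k)}
  zero_mem' := fun _ _ _ => Submodule.zero_mem _
  add_mem' := fun ha hb n z hz => Submodule.add_mem _ (ha n z hz) (hb n z hz)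
  neg_mem' := fun ha n z hz => Submodule.neg_mem _ (ha n z hz)

lemma KD_one : 1 ∈ KD (V := V) F 0 := fun _ _ hz => hz

lemma KD_mul (i j : ℕ) (x y : Module.End F (TM V F))
    (hx : x ∈ KD F i) (hy : y ∈ KD F j) : x * y ∈ KD F (i + j) := by
  intro n z hz
  have := hx _ _ (hy n z hz)
  rwa [add_assoc, add_comm j i] at this

lemma single_mem_Tdeg (y : List (V × ℕ)) (a : F) :
    Finsupp.single y a ∈ Tdeg F (y.map Prod.snd).sum :=
  Finsupp.single_mem_supported F a rfl

lemma mem_KD_of_single {k : ℕ} {f : Module.End F (TM V F)}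
    (h : ∀ y, f (Finsupp.single y 1) ∈ Tdeg F ((y.map Prod.snd).sum + k)) : f ∈ KD F k := by
  intro n z hz
  rw [Tdeg, Finsupp.supported_eq_span_single] at hz
  have : Submodule.span F ((fun i => Finsupp.single i (1 : F)) ''
      {y : List (V × ℕ) | (y.map Prod.snd).sum = n}) ≤ (Tdeg F (n + k)).comap f := by
    rw [Submodule.span_le]
    rintro _ ⟨y, rfl, rfl⟩
    exact h y
  exact this hz

lemma cop_KD (v : V) (k : ℕ) : cop F rk R v k ∈ KD F k := by
  by_cases hk : k = 0
  · subst hk; rw [cop_zero]; exact KD_one F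
  refine mem_KD_of_single F fun y => ?_
  by_cases hg : Good rk R ((v, k) :: y)
  · rw [cop_good F rk R hg]
    have := single_mem_Tdeg F ((v, k) :: y) 1
    rwa [List.map_cons, List.sum_cons, add_comm] at this
  · rw [cop_bad F rk R hk hg]; exact Submodule.zero_mem _

lemma Op_KD (hrk : ∀ v w, R v w → rk w < rk v) :
    ∀ n v, rk v = n → ∀ k, coeff k (Op F rk R v) ∈ KD F k := by
  intro n
  induction n using Nat.strong_induction_on with
  | _ n ih =>
    intro v hv k
    refine mem_KD_of_single F fun y => ?_
    induction y generalizing k with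
    | nil => rw [Op_nil]; exact cop_KD F rk R v k _ _ (single_mem_Tdeg F _ _)
    | cons x m ihm =>
      obtain ⟨w, l⟩ := x
      by_cases hc : (R v w ∧ k + rk w = rk v) ∧ Good rk R ((w, l) :: m)
      · obtain ⟨⟨hR, hkk⟩, hg⟩ := hc
        rw [Op_cons F rk R hR (hrk _ _ hR) hkk hg]
        simp only [List.map_cons, List.sum_cons]
        refine Submodule.sub_mem _ ?_ (Submodule.sum_mem _ fun j hj => ?_)
        · have := ihm (k + l)
          rwa [show (m.map Prod.snd).sum + (k + l) = l + (m.map Prod.snd).sum + k by ring] at this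
        · rw [mem_range] at hj
          have h1 : GG (Op F rk R w) (k - j) l ∈ KD F (k - j + l) :=
            K_BB _ (KD_one F) (KD_mul F) (ih _ (hv ▸ hrk _ _ hR) w rfl) _ _
          have := cop_KD F rk R v j _ _ (h1 _ _ (single_mem_Tdeg F m 1))
          rwa [show (m.map Prod.snd).sum + (k - j + l) + j
            = l + (m.map Prod.snd).sum + k by omega] at this
      · by_cases hk : k = 0
        · subst hk; rw [Op_zero]; exact single_mem_Tdeg F _ _
        by_cases hg : Good rk R ((w, l) :: m)
        · rw [Op_cop F rk R]
          · exact cop_KD F rk R v k _ _ (single_mem_Tdeg F _ _)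
          · rintro u r y' h; cases h
            exact fun h => hc ⟨h, hg⟩
        · rw [Op_bad F rk R hk hg]; exact Submodule.zero_mem _

/-- the main relation, one step form -/
def Star (v w : V) (d l : ℕ) (z : TM V F) : Prop :=
  coeff d (Op F rk R v) (coeff l (Op F rk R w) z) =
    coeff (d + l) (Op F rk R v) z -
      ∑ j ∈ range d, cop F rk R v j (GG (Op F rk R w) (d - j) l z)

lemma Star_base {v w : V} {d l : ℕ} (hrk : ∀ v w, R v w → rk w < rk v)
    (hR : R v w) (hd : d + rk w = rk v) (hl : 1 ≤ l) (y : List (V × ℕ))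
    (h : ∀ u r y', y = (u, r) :: y' → ¬ (R w u ∧ l + rk u = rk w)) :
    Star F rk R v w d l (Finsupp.single y 1) := by
  have hlt := hrk _ _ hR
  unfold Star
  by_cases hg : Good rk R y
  · by_cases hlw : l ≤ rk w
    · have hg' : Good rk R ((w, l) :: y) := ⟨hl, hlw, hg, h⟩
      rw [Op_good F rk R hg', Op_cons F rk R hR hlt hd hg']
    · rw [Op_deg F rk R w l (by omega), Op_deg F rk R v (d + l) (by omega),
        Finset.sum_eq_zero]
      · simp
      · intro j _
        rw [GG_deg (Op_deg F rk R w) _ (by omega)]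
        simp
  · rw [Op_bad F rk R (by omega) hg, Op_bad F rk R (by omega) hg, Finset.sum_eq_zero]
    · simp
    · intro j _
      rw [GG_bad F rk R hg w _ hl]
      simp

lemma Star_Sle {v w u : V} {d i : ℕ} (hrk : ∀ v w, R v w → rk w < rk v)
    (hR : R v w) (hd : d + rk w = rk v) (hi : 1 ≤ i) (hiu : i + rk u < rk w) {z : TM V F}
    (hz : z ∈ Sle F R u) : Star F rk R v w d i z := by
  have := Sle_induct F R (w := u)
    (f := coeff d (Op F rk R v) * coeff i (Op F rk R w))
    (g := coeff (d + i) (Op F rk R v) -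
      ∑ j ∈ range d, cop F rk R v j * (GG (Op F rk R w) (d - j) i)) ?_ hz
  · simpa [Star] using this
  · intro t r y ht
    have ht' : rk t ≤ rk u := by
      rcases ht with rfl | ht
      · exact le_rfl
      · exact (hrk _ _ ht).le
    have := Star_base F rk R hrk hR hd hi ((t, r) :: y) ?_
    · simpa [Star] using this
    · rintro t' r' y' h ⟨-, h2⟩
      cases h
      omega

lemma Op_Sle {v u : V} {k : ℕ} (hrk : ∀ v w, R v w → rk w < rk v)
    (hk : k + rk u < rk v) {z : TM V F}
    (hz : z ∈ Sle F R u) : coeff k (Op F rk R v) z = cop F rk R v k z := by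
  refine Sle_induct F R (fun t r y ht => Op_cop F rk R ?_) hz
  have ht' : rk t ≤ rk u := by
    rcases ht with rfl | ht
    · exact le_rfl
    · exact (hrk _ _ ht).le
  rintro t' r' y' h ⟨-, h2⟩
  cases h
  omega

lemma arith1 {M : Type*} [AddCommGroup M] (a b c e f g : M) :
    a - (b + c + e) - (f - c + g) = a - (b + (f + g)) - e := by abel

lemma Star_all (hrk : ∀ v w, R v w → rk w < rk v) (htr : ∀ u v w, R u v → R v w → R u w)
    {v : V} (ih : ∀ w u, R v w → R w u → ∀ k, rk w - rk u < k →
      coeff k (Op F rk R w * PI (Op F rk R u)) = 0)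
    (y : List (V × ℕ)) : ∀ {w : V} {d l : ℕ}, R v w → d + rk w = rk v → 1 ≤ l →
      Star F rk R v w d l (Finsupp.single y 1) := by
  induction y with
  | nil =>
    intro w d l hR hd hl
    exact Star_base F rk R hrk hR hd hl _ (by simp)
  | cons x y' ihy =>
    obtain ⟨u, r⟩ := x
    intro w d l hR hd hl
    by_cases hc : (R w u ∧ l + rk u = rk w) ∧ Good rk R ((u, r) :: y')
    swap
    · by_cases hg : Good rk R ((u, r) :: y')
      · refine Star_base F rk R hrk hR hd hl _ ?_
        rintro u' r' y'' h; cases h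
        exact fun h => hc ⟨h, hg⟩
      · unfold Star
        have hlt := hrk _ _ hR
        rw [Op_bad F rk R (by omega) hg, Op_bad F rk R (by omega) hg, Finset.sum_eq_zero]
        · simp
        · intro j _
          rw [GG_bad F rk R hg w _ hl]
          simp
    obtain ⟨⟨hwu, hlu⟩, hg⟩ := hc
    obtain ⟨l, rfl⟩ : ∃ l', l = l' + 1 := ⟨l - 1, by omega⟩
    have hr : 1 ≤ r := hg.1
    have hvu := htr _ _ _ hR hwu
    have hvw := hrk _ _ hR
    have e1 := Op_cons F rk R hwu (hrk _ _ hwu) hlu hg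
    have e2 := Op_cons F rk R (k := d + (l + 1)) hvu (hrk _ _ hvu) (by omega) hg
    set s := (Finsupp.single y' 1 : TM V F) with hs
    have e3 : (Finsupp.single ((u, r) :: y') 1 : TM V F) = GG (Op F rk R u) 0 r s := by
      rw [GG_zero, Op_good F rk R hg]
    have e4 := ihy hR hd (show 1 ≤ l + 1 + r by omega)
    unfold Star at e4 ⊢
    rw [e1, map_sub, e4, e2, map_sum, Finset.sum_range_succ']
    have e5 : ∀ i ∈ range l, coeff d (Op F rk R v)
        (cop F rk R w (i + 1) (GG (Op F rk R u) (l + 1 - (i + 1)) r s)) =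
        cop F rk R v (d + (i + 1)) (GG (Op F rk R u) (l + 1 - (i + 1)) r s) -
        ∑ j ∈ range d, cop F rk R v j (GG (Op F rk R w) (d - j) (i + 1)
          (GG (Op F rk R u) (l + 1 - (i + 1)) r s)) := by
      intro i hi
      rw [mem_range] at hi
      have hm := GG_mem F rk R hrk htr u (l + 1 - (i + 1)) hr s
      rw [← Op_Sle F rk R hrk (by omega) hm, ← Op_Sle F rk R hrk (by omega) hm]
      exact Star_Sle F rk R hrk hR hd (by omega) (by omega) hm
    rw [Finset.sum_congr rfl e5, cop_zero, Module.End.one_apply,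
      Op_Sle F rk R hrk (u := u) (by omega) (GG_mem F rk R hrk htr u _ hr s)]
    rw [Finset.sum_range_add, Finset.sum_range_succ' _ l, e3, Finset.sum_sub_distrib,
      Finset.sum_comm]
    have e6 : ∀ j ∈ range d, cop F rk R v j (GG (Op F rk R w) (d - j) (l + 1 + r) s) =
        cop F rk R v j (GG (Op F rk R u) (d + (l + 1) - j) r s) +
        ∑ i ∈ range l, cop F rk R v j (GG (Op F rk R w) (d - j) (i + 1)
          (GG (Op F rk R u) (l + 1 - (i + 1)) r s)) +
        cop F rk R v j (GG (Op F rk R w) (d - j) (l + 1) (GG (Op F rk R u) 0 r s)) := by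
      intro j hj
      rw [mem_range] at hj
      rw [L3 (Op_zero F rk R w) (Op_zero F rk R u) (l := l)
        (fun k hk => ih w u hR hwu k (by omega)) (d - j) r]
      simp only [LinearMap.add_apply, LinearMap.sum_apply, Module.End.mul_apply, map_add, map_sum]
      rw [show d - j + (l + 1) = d + (l + 1) - j by omega]
      simp only [Nat.add_sub_add_right]
    rw [Finset.sum_congr rfl e6, Finset.sum_add_distrib, Finset.sum_add_distrib]
    have e7 : ∀ i, d + (l + 1) - (d + i) = l + 1 - i := by intro i; omega
    simp only [e7]
    rw [add_zero, Nat.sub_zero, ← add_assoc d (l + 1) r]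
    exact arith1 _ _ _ _ _ _

theorem main_rel (hrk : ∀ v w, R v w → rk w < rk v) (htr : ∀ u v w, R u v → R v w → R u w) :
    ∀ n v, rk v = n → ∀ w, R v w → ∀ k, rk v - rk w < k →
      coeff k (Op F rk R v * PI (Op F rk R w)) = 0 := by
  intro n
  induction n using Nat.strong_induction_on with
  | _ n ih =>
    intro v hv w hR
    have hlt := hrk _ _ hR
    refine bwd (Op_zero F rk R w) fun n hn => ?_
    obtain ⟨l, rfl⟩ : ∃ l', n = (rk v - rk w) + l' := ⟨n - (rk v - rk w), by omega⟩
    refine End_ext F fun y => ?_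
    have := Star_all F rk R hrk htr (v := v)
      (fun a b ha hb => ih _ (hv ▸ hrk _ _ ha) a rfl b hb) y hR
      (show (rk v - rk w) + rk w = rk v by omega) (show 1 ≤ l by omega)
    unfold Star at this
    rw [← add_eq_of_eq_sub this, Finset.sum_range_succ, add_comm, LinearMap.add_apply,
      LinearMap.sum_apply]
    congr 1
    · refine Finset.sum_congr rfl fun j hj => ?_
      rw [mem_range] at hj
      rw [Module.End.mul_apply, show rk v - rk w + l - j = rk v - rk w - j + l by omega,
        ← GG, Op_Sle F rk R hrk (u := w) (by omega) (GG_mem F rk R hrk htr w _ (by omega) _)]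
    · rw [Nat.sub_self, Nat.add_sub_cancel_left, Module.End.mul_apply]
      have := GG_zero (Op F rk R w) l
      rw [GG, zero_add] at this
      rw [this]

end Ops
end GLGP

namespace GLGP

open PowerSeries Finset GLG

section Paths
variable {V E : Type} {tl hd : E → V} {rk : V → ℕ}

lemma pathDst_nil (e : E) : pathDst hd e [] = hd e := rfl

lemma pathDst_cons (e e' : E) (es : List E) : pathDst hd e (e' :: es) = pathDst hd e' es := rfl

lemma isPath_nil (e : E) : IsPathC tl hd e [] := List.isChain_singleton e

lemma isPath_cons (e e' : E) (es : List E) :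
    IsPathC tl hd e (e' :: es) ↔ hd e = tl e' ∧ IsPathC tl hd e' es :=
  List.isChain_cons_cons

lemma path_rk (hrank : IsRank tl hd rk) (es : List E) : ∀ e : E, IsPathC tl hd e es →
    rk (pathDst hd e es) < rk (tl e) := by
  induction es with
  | nil => intro e _; exact hrank e
  | cons e' es ih =>
    intro e h
    rw [isPath_cons] at h
    have := ih e' h.2
    rw [← h.1] at this
    exact this.trans (hrank e)

lemma reaches_rk (hrank : IsRank tl hd rk) (v w : V) (h : Reaches tl hd v w) : rk w < rk v := by
  obtain ⟨e, es, hp, rfl, rfl⟩ := h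
  exact path_rk hrank es e hp

lemma reaches_edge (e : E) : Reaches tl hd (tl e) (hd e) := ⟨e, [], isPath_nil e, rfl, rfl⟩

lemma reaches_cons (e : E) {w : V} (h : Reaches tl hd (hd e) w) : Reaches tl hd (tl e) w := by
  obtain ⟨e', es, hp, h1, rfl⟩ := h
  exact ⟨e, e' :: es, (isPath_cons e e' es).2 ⟨h1.symm, hp⟩, rfl, rfl⟩

lemma reaches_trans (u v w : V) (h : Reaches tl hd u v) (h' : Reaches tl hd v w) :
    Reaches tl hd u w := by
  obtain ⟨e, es, hp, rfl, rfl⟩ := h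
  induction es generalizing e with
  | nil => exact reaches_cons e h'
  | cons e' es ih =>
    rw [isPath_cons] at hp
    refine reaches_cons e ?_
    rw [hp.1]
    exact ih e' hp.2 h'

lemma reaches_star (hrank : IsRank tl hd rk) {star : V}
    (hmin : ∀ v : V, (∀ e : E, tl e ≠ v) ↔ v = star) :
    ∀ n v, rk v = n → v ≠ star → Reaches tl hd v star := by
  intro n
  induction n using Nat.strong_induction_on with
  | _ n ih =>
    intro v hv hne
    have : ¬ ∀ e : E, tl e ≠ v := fun h => hne ((hmin v).1 h)
    push Not at this
    obtain ⟨e, rfl⟩ := this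
    by_cases h : hd e = star
    · exact h ▸ reaches_edge e
    · exact reaches_cons e (ih _ (hv ▸ hrank e) _ rfl h)

lemma telescope {M : Type*} [Monoid M] (Q : E → M) (P : V → M)
    (h : ∀ e, P (tl e) = Q e * P (hd e)) (es : List E) : ∀ e : E, IsPathC tl hd e es →
    P (tl e) = ((e :: es).map Q).prod * P (pathDst hd e es) := by
  induction es with
  | nil => intro e _; simpa [pathDst_nil] using h e
  | cons e' es ih =>
    intro e hp
    rw [isPath_cons] at hp
    rw [List.map_cons, List.prod_cons, mul_assoc, pathDst_cons, ← ih e' hp.2, ← hp.1, ← h]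

lemma path_deg {B : Type*} [Ring B] (hrank : IsRank tl hd rk) (Q : E → PowerSeries B)
    (hQ : ∀ e k, len tl hd rk e < k → coeff k (Q e) = 0) (es : List E) :
    ∀ e : E, IsPathC tl hd e es → ∀ k, rk (tl e) - rk (pathDst hd e es) < k →
    coeff k (((e :: es).map Q).prod) = 0 := by
  induction es with
  | nil => intro e _ k hk; simpa using hQ e k hk
  | cons e' es ih =>
    intro e hp k hk
    rw [isPath_cons] at hp
    rw [List.map_cons, List.prod_cons]
    refine coeff_mul_zero_of_deg (hQ e) (ih e' hp.2) ?_
    have h1 := path_rk hrank es e' hp.2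
    have h2 := hrank e
    rw [← hp.1] at h1 ⊢
    rw [pathDst_cons] at hk
    unfold len
    omega

lemma coeff_zero_mul_one {B : Type*} [Ring B] {X Y : PowerSeries B} (hX : coeff 0 X = 1)
    (hY : coeff 0 Y = 1) : coeff 0 (X * Y) = 1 := by
  rw [coeff_mul]
  simp [hX, hY] at *

lemma path_zero {B : Type*} [Ring B] (Q : E → PowerSeries B)
    (hQ : ∀ e, coeff 0 (Q e) = 1) (es : List E) : coeff 0 ((es.map Q).prod) = 1 := by
  induction es with
  | nil => simp
  | cons e es ih =>
    rw [List.map_cons, List.prod_cons, coeff_zero_mul_one (hQ e) ih]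

lemma tele_PI {B : Type*} [Ring B] (Q : E → PowerSeries B) (P : V → PowerSeries B)
    (h0 : ∀ v, coeff 0 (P v) = 1) (h : ∀ e, Q e = P (tl e) * PI (P (hd e)))
    (e : E) (es : List E) (hp : IsPathC tl hd e es) :
    ((e :: es).map Q).prod = P (tl e) * PI (P (pathDst hd e es)) := by
  have h' : ∀ e, P (tl e) = Q e * P (hd e) := by
    intro e
    rw [h e, mul_assoc, PI_mul (h0 _), mul_one]
  rw [telescope Q P h' es e hp, mul_assoc, mul_PI (h0 _), mul_one]

end Paths

section Alg
variable {V E : Type} (F : Type) [Field F] (tl hd : E → V) (rk : V → ℕ)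

/-- apply a ring hom to a polynomial and view it as a power series -/
noncomputable def toPS {B C : Type*} [Semiring B] [Semiring C] (g : B →+* C) :
    Polynomial B →+* PowerSeries C :=
  (PowerSeries.map g).comp Polynomial.coeToPowerSeries.ringHom

lemma coeff_toPS {B C : Type*} [Semiring B] [Semiring C] (g : B →+* C) (p : Polynomial B) (n : ℕ) :
    coeff n (toPS g p) = g (p.coeff n) := by
  simp [toPS]

lemma Pe_coeff_zero (e : E) : (Pe F tl hd rk e).coeff 0 = 1 := by
  rw [Pe, Polynomial.coeff_add, Polynomial.finsetSum_coeff, Finset.sum_eq_zero]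
  · simp
  · intro j _
    have := (Finset.mem_Icc.1 j.2).1
    rw [Polynomial.coeff_C_mul, Polynomial.coeff_X_pow, if_neg (by omega), mul_zero]

lemma Pe_coeff_mid (e : E) (n : ℕ) (h : 1 ≤ n ∧ n ≤ len tl hd rk e) :
    (Pe F tl hd rk e).coeff n = (-1) ^ n * FreeAlgebra.ι F (⟨e, ⟨n, h⟩⟩ : ESharp tl hd rk) := by
  rw [Pe, Polynomial.coeff_add, Polynomial.finsetSum_coeff, Finset.sum_eq_single ⟨n, by simpa using h⟩]
  · rw [Polynomial.coeff_C_mul, Polynomial.coeff_X_pow, if_pos rfl, mul_one,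
      Polynomial.coeff_one, if_neg (by omega), zero_add]
  · intro j _ hj
    rw [Polynomial.coeff_C_mul, Polynomial.coeff_X_pow, if_neg, mul_zero]
    intro hh; exact hj (Subtype.ext hh.symm)
  · intro h; exact absurd (Finset.mem_attach _ _) h

lemma Pe_coeff_big (e : E) (n : ℕ) (h : len tl hd rk e < n) :
    (Pe F tl hd rk e).coeff n = 0 := by
  rw [Pe, Polynomial.coeff_add, Polynomial.finsetSum_coeff, Finset.sum_eq_zero]
  · rw [Polynomial.coeff_one, if_neg (by omega), zero_add]
  · intro j _
    have := (Finset.mem_Icc.1 j.2).2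
    rw [Polynomial.coeff_C_mul, Polynomial.coeff_X_pow, if_neg (by omega), mul_zero]

noncomputable def QA (e : E) : PowerSeries (AGamma F tl hd rk) :=
  toPS (mkA F tl hd rk).toRingHom (Pe F tl hd rk e)

lemma QA_zero (e : E) : coeff 0 (QA F tl hd rk e) = 1 := by
  rw [QA, coeff_toPS, Pe_coeff_zero, map_one]

lemma QA_big (e : E) (n : ℕ) (h : len tl hd rk e < n) : coeff n (QA F tl hd rk e) = 0 := by
  rw [QA, coeff_toPS, Pe_coeff_big _ _ _ _ _ _ h, map_zero]

lemma QA_mid (e : E) (n : ℕ) (h : 1 ≤ n ∧ n ≤ len tl hd rk e) : coeff n (QA F tl hd rk e) =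
    (-1) ^ n * mkA F tl hd rk (FreeAlgebra.ι F (⟨e, ⟨n, h⟩⟩ : ESharp tl hd rk)) := by
  rw [QA, coeff_toPS, Pe_coeff_mid _ _ _ _ _ _ h]
  simp

lemma toPS_prod {B C : Type*} [Semiring B] [Semiring C] (g : B →+* C) (f : E → Polynomial B)
    (es : List E) : (es.map fun e => toPS g (f e)).prod = toPS g (es.map f).prod := by
  rw [map_list_prod, List.map_map]; rfl

lemma neg_pow_mul_self {B : Type*} [Ring B] (j : ℕ) (x : B) :
    (-1) ^ j * ((-1) ^ j * x) = x := by
  rw [← mul_assoc, ← pow_add, ← two_mul, pow_mul]; simp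

lemma toPS_Pe {B : Type*} [Ring B] [Algebra F B] (f : ESharp tl hd rk → B) (e : E)
    (X : PowerSeries B) (h0 : coeff 0 X = 1) (hbig : ∀ n, len tl hd rk e < n → coeff n X = 0)
    (hmid : ∀ n (h : 1 ≤ n ∧ n ≤ len tl hd rk e),
      f ⟨e, ⟨n, h⟩⟩ = (-1) ^ n * coeff n X) :
    toPS (FreeAlgebra.lift F f).toRingHom (Pe F tl hd rk e) = X := by
  ext1 n
  rw [coeff_toPS]
  by_cases h0 : n = 0
  · subst h0
    rw [Pe_coeff_zero, map_one, h0]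
  by_cases hn : n ≤ len tl hd rk e
  · rw [Pe_coeff_mid _ _ _ _ _ _ ⟨by omega, hn⟩]
    simp only [AlgHom.toRingHom_eq_coe, RingHom.coe_coe, map_mul, map_pow, map_neg, map_one]
    rw [FreeAlgebra.lift_ι_apply, hmid, neg_pow_mul_self]
  · rw [Pe_coeff_big _ _ _ _ _ _ (by omega), map_zero, hbig _ (by omega)]

lemma coeff_path_QA (es : List E) (j : ℕ) :
    coeff j ((es.map (QA F tl hd rk)).prod) =
      (-1) ^ j * mkA F tl hd rk (eP F tl hd rk es j) := by
  have : (es.map (QA F tl hd rk)) =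
    (es.map fun e => toPS (mkA F tl hd rk).toRingHom (Pe F tl hd rk e)) := rfl
  rw [this, toPS_prod, coeff_toPS, eP]
  simp only [AlgHom.toRingHom_eq_coe, RingHom.coe_coe, map_mul, map_pow, map_neg, map_one]
  exact (neg_pow_mul_self _ _).symm

variable {F tl hd rk}

lemma path_eq (hrank : IsRank tl hd rk) {e1 e2 : E} {es1 es2 : List E}
    (h1 : IsPathC tl hd e1 es1) (h2 : IsPathC tl hd e2 es2) (ht : tl e1 = tl e2)
    (hh : pathDst hd e1 es1 = pathDst hd e2 es2) :
    ((e1 :: es1).map (QA F tl hd rk)).prod = ((e2 :: es2).map (QA F tl hd rk)).prod := by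
  ext j
  by_cases hj0 : j = 0
  · subst hj0
    rw [path_zero _ (QA_zero F tl hd rk), path_zero _ (QA_zero F tl hd rk)]
  by_cases hj : rk (tl e1) - rk (pathDst hd e1 es1) < j
  · rw [path_deg hrank _ (QA_big F tl hd rk) _ _ h1 _ hj,
      path_deg hrank _ (QA_big F tl hd rk) _ _ h2 _ (by rwa [← ht, ← hh])]
  · rw [coeff_path_QA, coeff_path_QA]
    congr 1
    exact RingQuot.mkAlgHom_rel F ⟨e1, es1, e2, es2, j, h1, h2, ht, hh, by omega, by omega, rfl, rfl⟩

open Classical in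
noncomputable def PA (F : Type) [Field F] (tl hd : E → V) (rk : V → ℕ) (star v : V) :
    PowerSeries (AGamma F tl hd rk) :=
  if h : Reaches tl hd v star then
    ((h.choose :: h.choose_spec.choose).map (QA F tl hd rk)).prod else 1

lemma PA_star (hrank : IsRank tl hd rk) (star : V) : PA F tl hd rk star star = 1 := by
  rw [PA, dif_neg]
  intro h
  exact lt_irrefl _ (reaches_rk hrank _ _ h)

lemma PA_eq (hrank : IsRank tl hd rk) {star : V} {e : E} {es : List E}
    (h1 : IsPathC tl hd e es) (h2 : pathDst hd e es = star) :
    PA F tl hd rk star (tl e) = ((e :: es).map (QA F tl hd rk)).prod := by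
  have h : Reaches tl hd (tl e) star := ⟨e, es, h1, rfl, h2⟩
  rw [PA, dif_pos h]
  obtain ⟨a, b, c⟩ := h.choose_spec.choose_spec
  exact path_eq hrank a h1 b (c.trans h2.symm)

section S
variable {star : V}

lemma PA_edge (hrank : IsRank tl hd rk)
    (hmin : ∀ v : V, (∀ e : E, tl e ≠ v) ↔ v = star) (e : E) :
    PA F tl hd rk star (tl e) = QA F tl hd rk e * PA F tl hd rk star (hd e) := by
  by_cases h : hd e = star
  · rw [PA_eq hrank (isPath_nil e) h, h, PA_star hrank]; simp
  · obtain ⟨e', es, hp, h1, h2⟩ := reaches_star hrank hmin _ (hd e) rfl h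
    rw [PA_eq hrank ((isPath_cons e e' es).2 ⟨h1.symm, hp⟩) h2, ← h1, PA_eq hrank hp h2]
    simp

lemma PA_zero (v : V) : coeff 0 (PA F tl hd rk star v) = 1 := by
  rw [PA]
  split_ifs
  · exact path_zero _ (QA_zero F tl hd rk) _
  · simp

lemma PA_rel (hrank : IsRank tl hd rk)
    (hmin : ∀ v : V, (∀ e : E, tl e ≠ v) ↔ v = star) {v w : V} (h : Reaches tl hd v w) :
    ∀ k, rk v - rk w < k → coeff k (PA F tl hd rk star v * PI (PA F tl hd rk star w)) = 0 := by
  obtain ⟨e, es, hp, rfl, rfl⟩ := h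
  intro k hk
  rw [telescope _ _ (PA_edge hrank hmin) es e hp, mul_assoc, mul_PI (PA_zero _), mul_one]
  exact path_deg hrank _ (QA_big F tl hd rk) _ _ hp _ hk

lemma PA_deg (hrank : IsRank tl hd rk) (hstar0 : rk star = 0)
    (hmin : ∀ v : V, (∀ e : E, tl e ≠ v) ↔ v = star) (v : V) :
    ∀ k, rk v < k → coeff k (PA F tl hd rk star v) = 0 := by
  intro k hk
  by_cases h : v = star
  · subst h; rw [PA_star hrank, coeff_one, if_neg (by omega)]
  · have := PA_rel (F := F) hrank hmin (reaches_star hrank hmin _ v rfl h) k (by omega)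
    rwa [PA_star hrank, PI_one, mul_one] at this

/-- the representation -/
noncomputable def rho0 (F : Type) [Field F] (tl hd : E → V) (rk : V → ℕ) :
    FreeAlgebra F (ESharp tl hd rk) →ₐ[F] Module.End F (TM V F) :=
  FreeAlgebra.lift F fun s => (-1) ^ s.2.1 *
    coeff s.2.1 (Op F rk (Reaches tl hd) (tl s.1) * PI (Op F rk (Reaches tl hd) (hd s.1)))

lemma rho0_Pe (hrank : IsRank tl hd rk) (e : E) :
    toPS (rho0 F tl hd rk).toRingHom (Pe F tl hd rk e) =
      Op F rk (Reaches tl hd) (tl e) * PI (Op F rk (Reaches tl hd) (hd e)) := by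
  have h0 := coeff_zero_mul_one (Op_zero F rk (Reaches tl hd) (tl e))
    (PI_zero (Op F rk (Reaches tl hd) (hd e)))
  refine toPS_Pe F tl hd rk _ e _ h0 ?_ ?_
  · intro n hn
    exact main_rel F rk _ (reaches_rk hrank) reaches_trans _ _ rfl _ (reaches_edge e) n
        (by unfold len at hn; omega)
  · intro n h
    rfl

lemma rho0_path (hrank : IsRank tl hd rk) {e : E} {es : List E} (hp : IsPathC tl hd e es) :
    toPS (rho0 F tl hd rk).toRingHom (((e :: es).map (Pe F tl hd rk)).prod) =
      Op F rk (Reaches tl hd) (tl e) * PI (Op F rk (Reaches tl hd) (pathDst hd e es)) := by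
  refine (toPS_prod _ _ _).symm.trans ?_
  exact tele_PI _ _ (Op_zero F rk (Reaches tl hd)) (rho0_Pe hrank) e es hp

noncomputable def rho (F : Type) [Field F] (hrank : IsRank tl hd rk) :
    AGamma F tl hd rk →ₐ[F] Module.End F (TM V F) :=
  RingQuot.liftAlgHom F ⟨rho0 F tl hd rk, by
    rintro x y ⟨e1, es1, e2, es2, j, h1, h2, ht, hh, -, -, rfl, rfl⟩
    have := rho0_path (F := F) hrank h1
    rw [ht, hh, ← rho0_path hrank h2] at this
    have := congrArg (coeff j) this
    have := (coeff_toPS _ _ _).symm.trans (this.trans (coeff_toPS _ _ _))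
    rw [eP, eP, map_mul, map_mul]
    congr 1⟩

lemma rho_mkA (hrank : IsRank tl hd rk) (x : FreeAlgebra F (ESharp tl hd rk)) :
    rho F hrank (mkA F tl hd rk x) = rho0 F tl hd rk x :=
  RingQuot.liftAlgHom_mkAlgHom_apply ..

lemma rho_QA (hrank : IsRank tl hd rk) (e : E) :
    PowerSeries.map (rho F hrank).toRingHom (QA F tl hd rk e) =
      Op F rk (Reaches tl hd) (tl e) * PI (Op F rk (Reaches tl hd) (hd e)) := by
  rw [← rho0_Pe hrank]
  ext1 n
  rw [QA, coeff_map, coeff_toPS]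
  exact (rho_mkA hrank _).trans (coeff_toPS _ _ _).symm

lemma Op_star (hstar0 : rk star = 0) : Op F rk (Reaches tl hd) star = 1 := by
  ext1 n
  by_cases h : n = 0
  · subst h; rw [Op_zero]; simp
  · rw [Op_deg _ _ _ _ _ (by omega), coeff_one, if_neg h]

lemma rho_PA (hrank : IsRank tl hd rk) (hstar0 : rk star = 0)
    (hmin : ∀ v : V, (∀ e : E, tl e ≠ v) ↔ v = star) :
    ∀ n v, rk v = n → PowerSeries.map (rho F hrank).toRingHom (PA F tl hd rk star v) =
      Op F rk (Reaches tl hd) v := by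
  intro n
  induction n using Nat.strong_induction_on with
  | _ n ih =>
    intro v hv
    by_cases h : v = star
    · subst h; rw [PA_star hrank, map_one, Op_star hstar0]
    · have : ¬ ∀ e : E, tl e ≠ v := fun h' => h ((hmin v).1 h')
      push Not at this
      obtain ⟨e, rfl⟩ := this
      rw [PA_edge hrank hmin, map_mul, rho_QA, ih _ (hv ▸ hrank e) _ rfl, mul_assoc,
        PI_mul (Op_zero _ _ _ _), mul_one]
end S
end Alg
end GLGP

namespace GLGP

open PowerSeries Finset GLG

section Inter
variable {V : Type} {F : Type} [Field F] {rk : V → ℕ} {R : V → V → Prop}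
  {B : Type} [Ring B] [Algebra F B]

noncomputable def wordA (P : V → PowerSeries B) (y : List (V × ℕ)) : B :=
  (y.map fun x => coeff x.2 (P x.1)).prod

open Classical in
noncomputable def phi (F : Type) [Field F] [Algebra F B] (rk : V → ℕ) (R : V → V → Prop)
    (P : V → PowerSeries B) : TM V F →ₗ[F] B :=
  Finsupp.linearCombination F (fun y => if Good rk R y then wordA P y else 0)

lemma phi_good (P : V → PowerSeries B) {y : List (V × ℕ)} (h : Good rk R y) :
    phi F rk R P (Finsupp.single y 1) = wordA P y := by
  simp [phi, h]

lemma phi_bad (P : V → PowerSeries B) {y : List (V × ℕ)} (h : ¬ Good rk R y) :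
    phi F rk R P (Finsupp.single y 1) = 0 := by
  simp [phi, h]

def Itw (φ : TM V F →ₗ[F] B) (X : PowerSeries (Module.End F (TM V F))) (Y : PowerSeries B) : Prop :=
  ∀ k z, φ (coeff k X z) = coeff k Y * φ z

lemma Itw_mul {φ : TM V F →ₗ[F] B} {X X' : PowerSeries (Module.End F (TM V F))}
    {Y Y' : PowerSeries B} (h : Itw φ X Y) (h' : Itw φ X' Y') : Itw φ (X * X') (Y * Y') := by
  intro k z
  rw [coeff_mul, coeff_mul, LinearMap.sum_apply, map_sum, Finset.sum_mul]
  refine Finset.sum_congr rfl fun x _ => ?_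
  rw [Module.End.mul_apply, h, h', mul_assoc]

lemma Itw_PI {φ : TM V F →ₗ[F] B} {X : PowerSeries (Module.End F (TM V F))}
    {Y : PowerSeries B} (h : Itw φ X Y) : Itw φ (PI X) (PI Y) := by
  intro k
  induction k using Nat.strong_induction_on with
  | _ k ih =>
    intro z
    cases k with
    | zero =>
      have e : coeff 0 (PI X) = 1 := PI_zero X
      rw [e, PI_zero, one_mul]; rfl
    | succ n =>
      have e : coeff (n + 1) (PI X) =
        - ∑ i ∈ range (n + 1), coeff (n + 1 - i) X * coeff i (PI X) := PI_succ n
      rw [e, PI_succ, LinearMap.neg_apply, map_neg, LinearMap.sum_apply, map_sum, neg_mul,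
        Finset.sum_mul]
      congr 1
      refine Finset.sum_congr rfl fun i hi => ?_
      rw [Module.End.mul_apply, h, ih i (Finset.mem_range.1 hi), mul_assoc]

lemma Itw_Tr {φ : TM V F →ₗ[F] B} {X : PowerSeries (Module.End F (TM V F))}
    {Y : PowerSeries B} (h : Itw φ X Y) (p : ℕ) : Itw φ (Tr p X) (Tr p Y) := by
  intro k z
  have e : coeff k (Tr p X) = if k ≤ p then coeff k X else 0 := coeff_Tr p k X
  rw [e, coeff_Tr]
  split_ifs
  · exact h k z
  · rw [zero_mul, LinearMap.zero_apply, map_zero]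

lemma Itw_GG {φ : TM V F →ₗ[F] B} {X : PowerSeries (Module.End F (TM V F))}
    {Y : PowerSeries B} (h : Itw φ X Y) (p l : ℕ) (z : TM V F) :
    φ (GG X p l z) = GG Y p l * φ z :=
  Itw_mul (Itw_Tr (Itw_PI h) p) h _ z

lemma phi_cop (hrk : ∀ v w, R v w → rk w < rk v) (P : V → PowerSeries B)
    (hP0 : ∀ v, coeff 0 (P v) = 1) {v w : V} {j : ℕ} (hj : j + rk w < rk v)
    {z : TM V F} (hz : z ∈ Sle F R w) :
    phi F rk R P (cop F rk R v j z) = coeff j (P v) * phi F rk R P z := by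
  by_cases hj0 : j = 0
  · subst hj0; rw [cop_zero, hP0, one_mul]; rfl
  rw [Sle, Finsupp.supported_eq_span_single] at hz
  refine LinearMap.eqOn_span (f := (phi F rk R P).comp (cop F rk R v j))
    (g := (LinearMap.mulLeft F (coeff j (P v))).comp (phi F rk R P)) ?_ hz
  rintro _ ⟨y, ⟨u, r, y', rfl, hu⟩, rfl⟩
  have hu' : rk u ≤ rk w := by
    rcases hu with rfl | hu
    · exact le_rfl
    · exact (hrk _ _ hu).le
  change phi F rk R P (cop F rk R v j (Finsupp.single _ 1)) =
    coeff j (P v) * phi F rk R P (Finsupp.single _ 1)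
  by_cases hg : Good rk R ((u, r) :: y')
  · have hg' : Good rk R ((v, j) :: (u, r) :: y') := by
      refine ⟨by simp; omega, by simp; omega, hg, ?_⟩
      rintro u' r' y'' h ⟨-, h2⟩
      simp only [List.cons.injEq, Prod.mk.injEq] at h
      obtain ⟨⟨rfl, -⟩, -⟩ := h
      simp only at h2
      omega
    rw [cop_good F rk R hg', phi_good P hg', phi_good P hg]
    simp [wordA]
  · rw [cop_bad F rk R hj0 (fun h => hg h.tail), phi_bad P hg, map_zero, mul_zero]

lemma Op_Itw (hrk : ∀ v w, R v w → rk w < rk v) (htr : ∀ u v w, R u v → R v w → R u w)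
    (P : V → PowerSeries B)
    (hP0 : ∀ v, coeff 0 (P v) = 1) (hPd : ∀ v k, rk v < k → coeff k (P v) = 0)
    (hPr : ∀ v w, R v w → ∀ k, rk v - rk w < k → coeff k (P v * PI (P w)) = 0) :
    ∀ n v, rk v = n → Itw (phi F rk R P) (Op F rk R v) (P v) := by
  intro n
  induction n using Nat.strong_induction_on with
  | _ n ih =>
    intro v hv k z
    have main : ∀ (y : List (V × ℕ)) (k : ℕ),
        phi F rk R P (coeff k (Op F rk R v) (Finsupp.single y 1)) =
          coeff k (P v) * phi F rk R P (Finsupp.single y 1) := by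
      intro y
      induction y with
      | nil =>
        intro k
        by_cases hk : k = 0
        · subst hk; rw [Op_zero, hP0, one_mul]; rfl
        by_cases hk' : rk v < k
        · rw [Op_deg F rk R v k hk', hPd v k hk', zero_mul, LinearMap.zero_apply, map_zero]
        have hg : Good rk R ((v, k) :: []) := by
          refine ⟨by simp; omega, by simp; omega, trivial, ?_⟩
          intro u r y' h
          simp at h
        rw [Op_good F rk R hg, phi_good P hg, phi_good P (y := []) trivial]
        simp [wordA]
      | cons x m ihm =>
        intro k
        obtain ⟨w, l⟩ := x
        by_cases hk : k = 0
        · subst hk; rw [Op_zero, hP0, one_mul]; rfl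
        by_cases hg : Good rk R ((w, l) :: m)
        swap
        · rw [Op_bad F rk R hk hg, phi_bad P hg, map_zero, mul_zero]
        by_cases hk' : rk v < k
        · rw [Op_deg F rk R v k hk', hPd v k hk', zero_mul, LinearMap.zero_apply, map_zero]
        by_cases hc : R v w ∧ k + rk w = rk v
        swap
        · have hg' : Good rk R ((v, k) :: (w, l) :: m) := by
            refine ⟨by simp; omega, by simp; omega, hg, ?_⟩
            intro u r y' h
            simp only [List.cons.injEq, Prod.mk.injEq] at h
            obtain ⟨⟨rfl, -⟩, -⟩ := h
            exact hc
          rw [Op_good F rk R hg', phi_good P hg', phi_good P hg]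
          simp [wordA]
        · obtain ⟨hR, hkw⟩ := hc
          have hl : 1 ≤ l := hg.1
          have hw := hrk _ _ hR
          rw [Op_cons F rk R hR hw hkw hg, map_sub, ihm, map_sum]
          have hs : ∀ j ∈ range k, phi F rk R P (cop F rk R v j
              (GG (Op F rk R w) (k - j) l (Finsupp.single m 1))) =
              coeff j (P v) * coeff (k + l - j) (BB (P w) (k - j)) *
                phi F rk R P (Finsupp.single m 1) := by
            intro j hj
            rw [Finset.mem_range] at hj
            rw [phi_cop hrk P hP0 (by omega) (GG_mem F rk R hrk htr w _ hl _),
              Itw_GG (ih _ (hv ▸ hw) w rfl), GG, mul_assoc]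
            rw [show k - j + l = k + l - j by omega]
          have hf := fwd (hP0 w) (V := P v) (d := k) (n := k + l) (by omega)
            (fun i hi => hPr v w hR i (by omega))
          rw [Finset.sum_congr rfl hs, ← Finset.sum_mul, ← sub_mul, hf, Finset.sum_range_succ,
            add_sub_cancel_left, phi_good P hg, phi_good P hg.tail, Nat.sub_self,
            show k + l - k = 0 + l by omega]
          have := GG_zero (P w) l
          rw [GG] at this
          rw [this]
          simp [wordA, mul_assoc]
    induction z using Finsupp.induction_linear with
    | zero => rw [map_zero, map_zero, mul_zero]
    | add a b ha hb => rw [map_add, map_add, map_add, ha, hb, mul_add]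
    | single y a =>
      have : Finsupp.single y a = a • Finsupp.single y (1 : F) := by simp
      rw [this, map_smul, map_smul, map_smul, main, mul_smul_comm]

end Inter
end GLGP

namespace GLGP

open PowerSeries Finset GLG

section Dim
variable {V E : Type} {F : Type} [Field F] {tl hd : E → V} {rk : V → ℕ} {star : V}

lemma gpiece_one : (1 : AGamma F tl hd rk) ∈ gpiece F tl hd rk 0 :=
  Submodule.subset_span ⟨[], by simp, by simp⟩

lemma gpiece_mul (i j : ℕ) (x y : AGamma F tl hd rk) (hx : x ∈ gpiece F tl hd rk i)
    (hy : y ∈ gpiece F tl hd rk j) : x * y ∈ gpiece F tl hd rk (i + j) := by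
  have h := Submodule.mul_mem_mul hx hy
  rw [gpiece, gpiece, Submodule.span_mul_span] at h
  refine Submodule.span_le.2 ?_ h
  rintro _ ⟨_, ⟨w, hw, rfl⟩, _, ⟨w', hw', rfl⟩, rfl⟩
  refine Submodule.subset_span ⟨w ++ w', by simp [hw, hw'], ?_⟩
  simp

lemma QA_gpiece (e : E) (k : ℕ) : coeff k (QA F tl hd rk e) ∈ gpiece F tl hd rk k := by
  by_cases h0 : k = 0
  · subst h0; rw [QA_zero]; exact gpiece_one
  by_cases h : k ≤ len tl hd rk e
  · rw [QA_mid F tl hd rk e k ⟨by omega, h⟩]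
    have h1 : mkA F tl hd rk (FreeAlgebra.ι F (⟨e, ⟨k, by omega, h⟩⟩ : ESharp tl hd rk)) ∈
      gpiece F tl hd rk k := Submodule.subset_span ⟨[⟨e, ⟨k, by omega, h⟩⟩], by simp, by simp⟩
    rcases neg_one_pow_eq_or (AGamma F tl hd rk) k with h2 | h2
    · rw [h2, one_mul]; exact h1
    · rw [h2, neg_one_mul]; exact Submodule.neg_mem _ h1
  · rw [QA_big F tl hd rk e k (by omega)]; exact Submodule.zero_mem _

lemma one_gpiece (k : ℕ) :
    coeff k (1 : PowerSeries (AGamma F tl hd rk)) ∈ gpiece F tl hd rk k := by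
  rw [coeff_one]
  split_ifs with h
  · subst h; exact gpiece_one
  · exact Submodule.zero_mem _

lemma path_gpiece (es : List E) (k : ℕ) :
    coeff k ((es.map (QA F tl hd rk)).prod) ∈ gpiece F tl hd rk k := by
  induction es generalizing k with
  | nil => exact one_gpiece k
  | cons e es ih =>
    rw [List.map_cons, List.prod_cons]
    exact K_mul (fun k => (gpiece F tl hd rk k).toAddSubgroup) gpiece_mul (QA_gpiece e) ih k

lemma PA_gpiece (v : V) (k : ℕ) : coeff k (PA F tl hd rk star v) ∈ gpiece F tl hd rk k := by
  rw [PA]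
  split_ifs
  · exact path_gpiece _ _
  · exact one_gpiece k

lemma wordA_gpiece (y : List (V × ℕ)) :
    wordA (PA F tl hd rk star) y ∈ gpiece F tl hd rk (y.map Prod.snd).sum := by
  induction y with
  | nil => exact gpiece_one
  | cons x y ih =>
    rw [List.map_cons, List.sum_cons]
    exact gpiece_mul _ _ _ _ (PA_gpiece x.1 x.2) ih

lemma rho_wordA (hrank : IsRank tl hd rk) (hstar0 : rk star = 0)
    (hmin : ∀ v : V, (∀ e : E, tl e ≠ v) ↔ v = star) (y : List (V × ℕ))
    (hy : Good rk (Reaches tl hd) y) :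
    rho F hrank (wordA (PA F tl hd rk star) y) (Finsupp.single [] 1) = Finsupp.single y 1 := by
  induction y with
  | nil =>
    have : wordA (PA F tl hd rk star) [] = 1 := rfl
    rw [this, map_one]; rfl
  | cons x y ih =>
    have : wordA (PA F tl hd rk star) (x :: y) =
      coeff x.2 (PA F tl hd rk star x.1) * wordA (PA F tl hd rk star) y := rfl
    rw [this, map_mul, Module.End.mul_apply, ih hy.tail]
    have h := congrArg (coeff x.2) (rho_PA (F := F) hrank hstar0 hmin _ x.1 rfl)
    rw [coeff_map] at h
    have h' : rho F hrank (coeff x.2 (PA F tl hd rk star x.1)) =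
      coeff x.2 (Op F rk (Reaches tl hd) x.1) := h
    rw [h', Op_good F rk _ hy]

lemma wordA_indep (hrank : IsRank tl hd rk) (hstar0 : rk star = 0)
    (hmin : ∀ v : V, (∀ e : E, tl e ≠ v) ↔ v = star) (n : ℕ) :
    LinearIndependent F (fun y : {y : List (V × ℕ) // Good rk (Reaches tl hd) y ∧
      (y.map Prod.snd).sum = n} => wordA (PA F tl hd rk star) y.1) := by
  refine LinearIndependent.of_comp
    ((LinearMap.applyₗ (Finsupp.single ([] : List (V × ℕ)) (1 : F))).comp
      (rho F hrank).toLinearMap) ?_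
  have h := (Finsupp.linearIndependent_single_one F (List (V × ℕ))).comp
    (fun y : {y : List (V × ℕ) // Good rk (Reaches tl hd) y ∧
      (y.map Prod.snd).sum = n} => y.1) Subtype.val_injective
  convert h using 1
  funext y
  exact rho_wordA hrank hstar0 hmin y.1 y.2.1

lemma edge_Itw (hrank : IsRank tl hd rk) (hstar0 : rk star = 0)
    (hmin : ∀ v : V, (∀ e : E, tl e ≠ v) ↔ v = star) (e : E) :
    Itw (phi F rk (Reaches tl hd) (PA F tl hd rk star))
      (Op F rk (Reaches tl hd) (tl e) * PI (Op F rk (Reaches tl hd) (hd e)))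
      (QA F tl hd rk e) := by
  have hQ : QA F tl hd rk e = PA F tl hd rk star (tl e) * PI (PA F tl hd rk star (hd e)) := by
    rw [PA_edge hrank hmin, mul_assoc, mul_PI (PA_zero _), mul_one]
  have h : ∀ v, Itw (phi F rk (Reaches tl hd) (PA F tl hd rk star))
    (Op F rk (Reaches tl hd) v) (PA F tl hd rk star v) := fun v =>
    Op_Itw (reaches_rk hrank) reaches_trans _ PA_zero (PA_deg hrank hstar0 hmin)
      (fun v w => PA_rel hrank hmin) _ v rfl
  rw [hQ]
  exact Itw_mul (h _) (Itw_PI (h _))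

lemma gen_mul (hrank : IsRank tl hd rk) (hstar0 : rk star = 0)
    (hmin : ∀ v : V, (∀ e : E, tl e ≠ v) ↔ v = star) (s : ESharp tl hd rk) (n : ℕ)
    (x : AGamma F tl hd rk)
    (hx : x ∈ (Tdeg F n).map (phi F rk (Reaches tl hd) (PA F tl hd rk star))) :
    mkA F tl hd rk (FreeAlgebra.ι F s) * x ∈
      (Tdeg F (n + s.2.1)).map (phi F rk (Reaches tl hd) (PA F tl hd rk star)) := by
  obtain ⟨z, hz, rfl⟩ := hx
  obtain ⟨e, i, hi⟩ := s
  have h1 := edge_Itw (F := F) hrank hstar0 hmin e i z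
  rw [QA_mid F tl hd rk e i hi] at h1
  have hK : coeff i (Op F rk (Reaches tl hd) (tl e) * PI (Op F rk (Reaches tl hd) (hd e))) ∈
      KD F i := by
    have hO := fun v => Op_KD F rk (Reaches tl hd) (reaches_rk hrank) _ v rfl
    exact K_mul _ (KD_mul F) (hO _) (K_PI _ (KD_one F) (KD_mul F) (hO _)) i
  have h2 := hK n z hz
  rcases neg_one_pow_eq_or (AGamma F tl hd rk) i with h3 | h3
  · rw [h3, one_mul] at h1
    exact ⟨_, h2, h1⟩
  · rw [h3, neg_one_mul, neg_mul] at h1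
    exact ⟨_, Submodule.neg_mem _ h2, by rw [map_neg, h1, neg_neg]⟩

lemma gpiece_le (hrank : IsRank tl hd rk) (hstar0 : rk star = 0)
    (hmin : ∀ v : V, (∀ e : E, tl e ≠ v) ↔ v = star) (n : ℕ) :
    gpiece F tl hd rk n ≤
      (Tdeg F n).map (phi F rk (Reaches tl hd) (PA F tl hd rk star)) := by
  rw [gpiece, Submodule.span_le]
  rintro _ ⟨w, rfl, rfl⟩
  induction w with
  | nil =>
    refine ⟨Finsupp.single [] 1, single_mem_Tdeg F _ _, ?_⟩
    rw [phi_good (y := []) _ trivial]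
    simp [wordA]
  | cons s w ih =>
    have := gen_mul hrank hstar0 hmin s _ _ ih
    rw [List.map_cons, List.sum_cons, add_comm, List.map_cons, List.prod_cons, map_mul]
    exact this

lemma gpiece_eq (hrank : IsRank tl hd rk) (hstar0 : rk star = 0)
    (hmin : ∀ v : V, (∀ e : E, tl e ≠ v) ↔ v = star) (n : ℕ) :
    gpiece F tl hd rk n = Submodule.span F (Set.range
      (fun y : {y : List (V × ℕ) // Good rk (Reaches tl hd) y ∧
      (y.map Prod.snd).sum = n} => wordA (PA F tl hd rk star) y.1)) := by
  apply le_antisymm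
  · refine (gpiece_le hrank hstar0 hmin n).trans ?_
    rw [Tdeg, Finsupp.supported_eq_span_single, Submodule.map_span, Submodule.span_le]
    rintro _ ⟨_, ⟨y, hy, rfl⟩, rfl⟩
    by_cases hg : Good rk (Reaches tl hd) y
    · exact Submodule.subset_span ⟨⟨y, hg, hy⟩, (phi_good _ hg).symm⟩
    · have := phi_bad (F := F) (PA F tl hd rk star) hg
      change phi F rk (Reaches tl hd) (PA F tl hd rk star) (Finsupp.single y 1) ∈ _
      rw [this]; exact Submodule.zero_mem _
  · rw [Submodule.span_le]
    rintro _ ⟨⟨y, hg, rfl⟩, rfl⟩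
    exact wordA_gpiece y

lemma finrank_gpiece (hrank : IsRank tl hd rk) (hstar0 : rk star = 0)
    (hmin : ∀ v : V, (∀ e : E, tl e ≠ v) ↔ v = star) (n : ℕ)
    [Finite {y : List (V × ℕ) // Good rk (Reaches tl hd) y ∧ (y.map Prod.snd).sum = n}] :
    Module.finrank F (gpiece F tl hd rk n) =
      Nat.card {y : List (V × ℕ) // Good rk (Reaches tl hd) y ∧ (y.map Prod.snd).sum = n} := by
  have := Fintype.ofFinite {y : List (V × ℕ) // Good rk (Reaches tl hd) y ∧
    (y.map Prod.snd).sum = n}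
  rw [gpiece_eq hrank hstar0 hmin n, finrank_span_eq_card (wordA_indep hrank hstar0 hmin n),
    Nat.card_eq_fintype_card]

end Dim
end GLGP

namespace GLGP

open PowerSeries Finset GLG

section Count
variable {V : Type} [Fintype V] (rk : V → ℕ) (R : V → V → Prop)

lemma fin_words (n : ℕ) : {y : List (V × ℕ) | Good rk R y ∧ (y.map Prod.snd).sum = n}.Finite := by
  induction n using Nat.strong_induction_on with
  | _ n ih =>
    have hf : (({[]} : Set (List (V × ℕ))) ∪ ⋃ (v : V), ⋃ (k : Fin n),
        (fun y => (v, k.1 + 1) :: y) ''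
        {y : List (V × ℕ) | Good rk R y ∧ (y.map Prod.snd).sum = n - (k.1 + 1)}).Finite := by
      refine (Set.finite_singleton _).union (Set.finite_iUnion fun v => Set.finite_iUnion fun k => ?_)
      exact (ih _ (by have := k.2; omega)).image _
    refine hf.subset ?_
    rintro y ⟨hg, hs⟩
    cases y with
    | nil => left; rfl
    | cons x y =>
      right
      have h1 : 1 ≤ x.2 := hg.1
      rw [List.map_cons, List.sum_cons] at hs
      simp only [Set.mem_iUnion]
      refine ⟨x.1, ⟨x.2 - 1, by omega⟩, y, ⟨hg.tail, ?_⟩, ?_⟩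
      · simp only; omega
      · simp only
        rw [Nat.sub_add_cancel h1]

noncomputable def WF (n : ℕ) : Finset (List (V × ℕ)) := (fin_words rk R n).toFinset

lemma mem_WF {n : ℕ} {y : List (V × ℕ)} :
    y ∈ WF rk R n ↔ Good rk R y ∧ (y.map Prod.snd).sum = n := by
  simp [WF]

open Classical in
noncomputable def HF (v : V) (n : ℕ) : Finset (List (V × ℕ)) :=
  (WF rk R n).filter fun y => ∃ r y', y = (v, r) :: y'

lemma mem_HF {v : V} {n : ℕ} {y : List (V × ℕ)} :
    y ∈ HF rk R v n ↔ (Good rk R y ∧ (y.map Prod.snd).sum = n) ∧ ∃ r y', y = (v, r) :: y' := by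
  classical
  simp [HF, mem_WF]

lemma HF_disj {v w : V} (h : v ≠ w) (n : ℕ) : Disjoint (HF rk R v n) (HF rk R w n) := by
  rw [Finset.disjoint_left]
  intro y hy hy'
  rw [mem_HF] at hy hy'
  obtain ⟨-, r, y1, rfl⟩ := hy
  obtain ⟨-, r', y2, h2⟩ := hy'
  simp only [List.cons.injEq, Prod.mk.injEq] at h2
  exact h h2.1.1

lemma card_a (n : ℕ) : (WF rk R n).card = (if n = 0 then 1 else 0) +
    ∑ v : V, (HF rk R v n).card := by
  classical
  have h1 : WF rk R n = (if n = 0 then {[]} else ∅) ∪ univ.biUnion (fun v => HF rk R v n) := by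
    ext y
    rw [Finset.mem_union, Finset.mem_biUnion, mem_WF]
    cases y with
    | nil =>
      have : ∀ v, ¬ ([] : List (V × ℕ)) ∈ HF rk R v n := by
        intro v h; rw [mem_HF] at h; obtain ⟨-, r, y', h⟩ := h; simp at h
      simp only [this, and_false, exists_false, or_false]
      have hg : Good rk R [] := trivial
      by_cases hn : n = 0
      · subst hn; simp [hg]
      · simp [hn, Ne.symm hn]
    | cons x y =>
      have : ¬ (x :: y) ∈ (if n = 0 then {[]} else ∅ : Finset (List (V × ℕ))) := by
        split_ifs <;> simp
      simp only [this, false_or]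
      constructor
      · intro h; exact ⟨x.1, mem_univ _, (mem_HF ..).2 ⟨h, x.2, y, rfl⟩⟩
      · rintro ⟨v, -, h⟩; exact ((mem_HF ..).1 h).1
  rw [h1, Finset.card_union_of_disjoint, Finset.card_biUnion]
  · congr 1
    split_ifs <;> simp
  · intro v _ w _ h; exact HF_disj rk R h n
  · rw [Finset.disjoint_left]
    intro y hy hy'
    rw [Finset.mem_biUnion] at hy'
    obtain ⟨v, -, hv⟩ := hy'
    rw [mem_HF] at hv
    obtain ⟨-, r, y', rfl⟩ := hv
    revert hy
    split_ifs <;> simp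

open Classical in
lemma card_i (v : V) (k m : ℕ) (h1 : 1 ≤ k) (h2 : k ≤ rk v) : (WF rk R m).card =
    ((WF rk R m).filter fun y => Good rk R ((v, k) :: y)).card +
      ∑ w with R v w ∧ k + rk w = rk v, (HF rk R w m).card := by
  rw [← Finset.card_biUnion, ← Finset.card_filter_add_card_filter_not (s := WF rk R m)
    (fun y => Good rk R ((v, k) :: y))]
  · congr 2
    ext y
    simp only [Finset.mem_filter, Finset.mem_biUnion, mem_WF, mem_HF, mem_univ, true_and]
    constructor
    · rintro ⟨⟨hg, hs⟩, hn⟩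
      by_contra hc
      apply hn
      refine ⟨h1, h2, hg, ?_⟩
      rintro u r y' rfl hh
      exact hc ⟨u, hh, ⟨hg, hs⟩, r, y', rfl⟩
    · rintro ⟨w, hw, hh, r, y', rfl⟩
      exact ⟨hh, fun hg => hg.2.2.2 w r y' rfl hw⟩
  · intro u _ w _ h; exact HF_disj rk R h m

open Classical in
lemma card_ii (v : V) (n : ℕ) : (HF rk R v n).card =
    ∑ k ∈ Icc 1 (rk v), if k ≤ n then
      ((WF rk R (n - k)).filter fun y => Good rk R ((v, k) :: y)).card else 0 := by
  rw [← Finset.sum_filter]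
  have hc : ∀ k : ℕ, ((WF rk R (n - k)).filter fun y => Good rk R ((v, k) :: y)).card =
    (((WF rk R (n - k)).filter fun y => Good rk R ((v, k) :: y)).image
      (fun y => (v, k) :: y)).card := by
    intro k
    rw [Finset.card_image_of_injective]
    intro a b h
    simpa using h
  rw [Finset.sum_congr rfl (fun k _ => hc k), ← Finset.card_biUnion]
  · congr 1
    ext y
    simp only [Finset.mem_filter, Finset.mem_biUnion, mem_WF, mem_HF, Finset.mem_image,
      Finset.mem_Icc]
    constructor
    · rintro ⟨⟨hg, hs⟩, k, y', rfl⟩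
      have h1 : 1 ≤ k := hg.1
      have h2 : k ≤ rk v := hg.2.1
      simp only [List.map_cons, List.sum_cons] at hs
      exact ⟨k, ⟨⟨h1, h2⟩, by omega⟩, y', ⟨⟨hg.tail, by omega⟩, hg⟩, rfl⟩
    · rintro ⟨k, ⟨-, hk⟩, y', ⟨⟨-, hs⟩, hg⟩, rfl⟩
      refine ⟨⟨hg, ?_⟩, k, y', rfl⟩
      simp only [List.map_cons, List.sum_cons]
      omega
  · intro k _ l _ h
    rw [Function.onFun, Finset.disjoint_left]
    intro y hy hy'
    rw [Finset.mem_image] at hy hy'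
    obtain ⟨y1, -, rfl⟩ := hy
    obtain ⟨y2, -, h2⟩ := hy'
    simp only [List.cons.injEq, Prod.mk.injEq] at h2
    exact h h2.1.2.symm

open Classical in
lemma card_b (hrk : ∀ v w, R v w → rk w < rk v) (v : V) (n : ℕ) :
    (HF rk R v n).card + ∑ w with R v w,
      (if rk v - rk w ≤ n then (HF rk R w (n - (rk v - rk w))).card else 0) =
    ∑ k ∈ Icc 1 (rk v), if k ≤ n then (WF rk R (n - k)).card else 0 := by
  have h1 : ∀ k ∈ Icc 1 (rk v), (if k ≤ n then (WF rk R (n - k)).card else 0) =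
      (if k ≤ n then
        ((WF rk R (n - k)).filter fun y => Good rk R ((v, k) :: y)).card else 0) +
      ∑ w with R v w, if k = rk v - rk w then
        (if rk v - rk w ≤ n then (HF rk R w (n - (rk v - rk w))).card else 0) else 0 := by
    intro k hk
    rw [Finset.mem_Icc] at hk
    rw [← Finset.sum_filter, Finset.filter_filter]
    by_cases hn : k ≤ n
    · rw [if_pos hn, if_pos hn, card_i rk R v k _ hk.1 hk.2]
      congr 1
      refine Finset.sum_congr ?_ ?_
      · ext w
        simp only [Finset.mem_filter, mem_univ, true_and]
        constructor
        · rintro ⟨a, b⟩; exact ⟨a, by omega⟩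
        · rintro ⟨a, b⟩; have := hrk _ _ a; exact ⟨a, by omega⟩
      · intro w hw
        simp only [Finset.mem_filter, mem_univ, true_and] at hw
        rw [← hw.2, if_pos hn]
    · rw [if_neg hn, if_neg hn, zero_add]
      symm
      refine Finset.sum_eq_zero fun w hw => ?_
      simp only [Finset.mem_filter, mem_univ, true_and] at hw
      rw [← hw.2, if_neg hn]
  rw [Finset.sum_congr rfl h1, Finset.sum_add_distrib, ← card_ii, Finset.sum_comm]
  congr 1
  refine Finset.sum_congr rfl fun w hw => ?_
  simp only [Finset.mem_filter, mem_univ, true_and] at hw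
  have := hrk _ _ hw
  have hm : rk v - rk w ∈ Icc 1 (rk v) := by rw [Finset.mem_Icc]; omega
  rw [Finset.sum_ite_eq']
  exact (if_pos hm).symm

noncomputable def HS : PowerSeries ℤ := PowerSeries.mk fun n => ((WF rk R n).card : ℤ)
noncomputable def HSv (v : V) : PowerSeries ℤ := PowerSeries.mk fun n => ((HF rk R v n).card : ℤ)

lemma HS_a : HS rk R = 1 + ∑ v, HSv rk R v := by
  ext n
  rw [map_add, map_sum, HS, coeff_mk, card_a, coeff_one]
  simp [HSv]

open Classical in
lemma HS_b (hrk : ∀ v w, R v w → rk w < rk v) (v : V) :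
    HSv rk R v + ∑ w with R v w, X ^ (rk v - rk w) * HSv rk R w =
      (∑ k ∈ Icc 1 (rk v), X ^ k) * HS rk R := by
  ext n
  rw [map_add, map_sum, Finset.sum_mul, map_sum]
  simp only [coeff_X_pow_mul', HSv, HS, coeff_mk]
  exact_mod_cast card_b rk R hrk v n

lemma geom (r : ℕ) : (1 - X) * (∑ k ∈ Icc 1 r, (X : PowerSeries ℤ) ^ k) = X * (1 - X ^ r) := by
  induction r with
  | zero => simp
  | succ r ih =>
    rw [Finset.sum_Icc_succ_top (by omega), mul_add, ih]
    ring

open Classical in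
theorem count_main (hrk : ∀ v w, R v w → rk w < rk v) (htr : ∀ u v w, R u v → R v w → R u w)
    (star : V) (h0 : rk star = 0) (hst : ∀ v, v ≠ star → R v star)
    (μ : V → V → ℤ) (hμ0 : ∀ v w, ¬ (v = w ∨ R v w) → μ v w = 0)
    (hμ : ∀ v x, ∑ w with (w = x ∨ R w x), μ v w = if v = x then 1 else 0) :
    HS rk R * (1 - X * ∑ p : V × V, μ p.1 p.2 • (X : PowerSeries ℤ) ^ (rk p.1 - rk p.2)) =
      1 - X := by
  set H := HS rk R with hH
  set h := HSv rk R with hh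
  have hb : ∀ v, (1 - X) * ∑ w with (v = w ∨ R v w), X ^ (rk v - rk w) * h w =
      X * (1 - X ^ rk v) * H := by
    intro v
    rw [← geom, mul_assoc, ← HS_b rk R hrk v]
    congr 1
    have : (Finset.univ.filter fun w => v = w ∨ R v w) =
        insert v (Finset.univ.filter fun w => R v w) := by
      ext w; simp [eq_comm]
    rw [this, Finset.sum_insert]
    · simp [hh]
    · simp only [Finset.mem_filter, mem_univ, true_and]
      intro hv; exact lt_irrefl _ (hrk _ _ hv)
  -- pull back by the Moebius function
  have hc : ∀ u, ∑ v, (μ u v • (X : PowerSeries ℤ) ^ (rk u - rk v)) *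
      ∑ w with (v = w ∨ R v w), X ^ (rk v - rk w) * h w = h u := by
    intro u
    have e1 : ∀ v, (μ u v • (X : PowerSeries ℤ) ^ (rk u - rk v)) *
      ∑ w with (v = w ∨ R v w), X ^ (rk v - rk w) * h w =
      ∑ w, if (v = w ∨ R v w) then μ u v • ((X : PowerSeries ℤ) ^ (rk u - rk w) * h w) else 0 := by
      intro v
      rw [← Finset.sum_filter, Finset.mul_sum]
      refine Finset.sum_congr rfl fun w hw => ?_
      simp only [Finset.mem_filter, mem_univ, true_and] at hw
      by_cases huv : u = v ∨ R u v
      · have a1 : rk v ≤ rk u := by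
          rcases huv with rfl | hx
          · exact le_rfl
          · exact (hrk _ _ hx).le
        have a2 : rk w ≤ rk v := by
          rcases hw with rfl | hx
          · exact le_rfl
          · exact (hrk _ _ hx).le
        rw [smul_mul_assoc, ← mul_assoc, ← pow_add]
        congr 4
        omega
      · rw [hμ0 u v huv, zero_smul, zero_smul, zero_mul]
    rw [Finset.sum_congr rfl (fun v _ => e1 v), Finset.sum_comm]
    have e2 : ∀ w, (∑ v, if (v = w ∨ R v w) then
        μ u v • ((X : PowerSeries ℤ) ^ (rk u - rk w) * h w) else 0) =
        if u = w then h u else 0 := by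
      intro w
      rw [← Finset.sum_filter, ← Finset.sum_smul, hμ u w]
      split_ifs with huw
      · subst huw; simp
      · simp
    rw [Finset.sum_congr rfl (fun w _ => e2 w)]
    simp
  have hd : ∀ u, (1 - X) * h u = X * H * (∑ v, μ u v • (X : PowerSeries ℤ) ^ (rk u - rk v)) -
      X * H * (if u = star then 1 else 0) := by
    intro u
    have e3 : ∑ v, μ u v • (X : PowerSeries ℤ) ^ rk u = if u = star then 1 else 0 := by
      have := hμ u star
      have e4 : (Finset.univ.filter fun w => w = star ∨ R w star) = Finset.univ := by
        ext w
        simp only [Finset.mem_filter, mem_univ, true_and, iff_true]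
        by_cases hw : w = star
        · exact Or.inl hw
        · exact Or.inr (hst w hw)
      rw [e4] at this
      rw [← Finset.sum_smul, this]
      split_ifs with hu
      · subst hu; simp [h0]
      · simp
    rw [← hc u, ← e3, Finset.mul_sum, ← mul_sub, ← Finset.sum_sub_distrib, Finset.mul_sum]
    refine Finset.sum_congr rfl fun v _ => ?_
    rw [mul_left_comm, hb v]
    by_cases huv : u = v ∨ R u v
    · have a1 : rk v ≤ rk u := by
        rcases huv with rfl | hx
        · exact le_rfl
        · exact (hrk _ _ hx).le
      have a2 : (X : PowerSeries ℤ) ^ rk u = X ^ (rk u - rk v) * X ^ rk v := by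
        rw [← pow_add]; congr 1; omega
      rw [a2]
      simp only [zsmul_eq_mul]
      ring
    · rw [hμ0 u v huv]; simp
  have he : (1 - X) * (H - 1) =
      X * H * ((∑ p : V × V, μ p.1 p.2 • (X : PowerSeries ℤ) ^ (rk p.1 - rk p.2)) - 1) := by
    rw [hH, HS_a, add_sub_cancel_left, ← HS_a, ← hH, Finset.mul_sum,
      Finset.sum_congr rfl (fun u _ => hd u), Finset.sum_sub_distrib, ← Finset.mul_sum,
      ← Finset.mul_sum, Fintype.sum_prod_type, ← mul_sub]
    simp
  linear_combination he

end Count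
end GLGP

namespace GLGP

open PowerSeries Finset GLG

section Mob
variable {V : Type} [Fintype V] (R : V → V → Prop)

def CS (v w : V) : Set (List V) :=
  {c : List V | c.IsChain R ∧ c.head? = some v ∧ c.getLast? = some w}

variable {R}

lemma CS_finite (rk : V → ℕ) (hrk : ∀ v w, R v w → rk w < rk v)
    (htr : ∀ u v w, R u v → R v w → R u w) (v w : V) : (CS R v w).Finite := by
  refine (List.finite_length_le V (Fintype.card V)).subset ?_
  rintro c ⟨hc, -, -⟩
  have : IsTrans V R := ⟨htr⟩
  rw [List.isChain_iff_pairwise] at hc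
  refine List.Nodup.length_le_card (hc.imp ?_)
  rintro a b hab rfl
  exact lt_irrefl _ (hrk _ _ hab)

lemma CS_ge (htr : ∀ u v w, R u v → R v w → R u w) (c : List V) : ∀ v w, c ∈ CS R v w →
    v = w ∨ R v w := by
  induction c with
  | nil => rintro v w ⟨-, h, -⟩; simp at h
  | cons x c ih =>
    rintro v w ⟨h1, h2, h3⟩
    simp only [List.head?_cons, Option.some.injEq] at h2
    subst h2
    cases c with
    | nil => left; simpa using h3
    | cons y c =>
      rw [List.isChain_cons_cons] at h1
      right
      rw [List.getLast?_cons_cons] at h3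
      rcases ih y w ⟨h1.2, rfl, h3⟩ with rfl | h
      · exact h1.1
      · exact htr _ _ _ h1.1 h

lemma CS_self (rk : V → ℕ) (hrk : ∀ v w, R v w → rk w < rk v)
    (htr : ∀ u v w, R u v → R v w → R u w) (v : V) : CS R v v = {[v]} := by
  ext c
  rw [Set.mem_singleton_iff]
  constructor
  · rintro ⟨h1, h2, h3⟩
    cases c with
    | nil => simp at h2
    | cons x c =>
      simp only [List.head?_cons, Option.some.injEq] at h2
      subst h2
      cases c with
      | nil => rfl
      | cons y c =>
        exfalso
        rw [List.isChain_cons_cons] at h1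
        rw [List.getLast?_cons_cons] at h3
        have a := hrk _ _ h1.1
        rcases CS_ge htr (y :: c) y x ⟨h1.2, rfl, h3⟩ with rfl | h
        · exact lt_irrefl _ a
        · exact lt_irrefl _ (a.trans (hrk _ _ h))
  · rintro rfl
    exact ⟨List.isChain_singleton v, rfl, rfl⟩

noncomputable def mu (R : V → V → Prop) (v w : V) : ℤ :=
  ∑ᶠ c ∈ CS R v w, (-1 : ℤ) ^ (c.length + 1)

lemma mu_eq (rk : V → ℕ) (hrk : ∀ v w, R v w → rk w < rk v)
    (htr : ∀ u v w, R u v → R v w → R u w) (v w : V) :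
    mu R v w = ∑ c ∈ (CS_finite rk hrk htr v w).toFinset, (-1 : ℤ) ^ (c.length + 1) :=
  finsum_mem_eq_finite_toFinset_sum _ _

lemma mu_zero (htr : ∀ u v w, R u v → R v w → R u w) (v w : V) (h : ¬ (v = w ∨ R v w)) :
    mu R v w = 0 := by
  have : CS R v w = ∅ := by
    rw [Set.eq_empty_iff_forall_notMem]
    intro c hc
    exact h (CS_ge htr c v w hc)
  rw [mu, this, finsum_mem_empty]

lemma mu_self (rk : V → ℕ) (hrk : ∀ v w, R v w → rk w < rk v)
    (htr : ∀ u v w, R u v → R v w → R u w) (v : V) : mu R v v = 1 := by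
  rw [mu, CS_self rk hrk htr, finsum_mem_singleton]
  simp

open Classical in
lemma mu_rec (rk : V → ℕ) (hrk : ∀ v w, R v w → rk w < rk v)
    (htr : ∀ u v w, R u v → R v w → R u w) (v x : V) (hne : v ≠ x) :
    mu R v x = - ∑ w with R w x, mu R v w := by
  have hset : (CS_finite rk hrk htr v x).toFinset =
      (Finset.univ.filter fun w => R w x).biUnion fun w =>
        (CS_finite rk hrk htr v w).toFinset.image (fun c => c ++ [x]) := by
    ext c
    simp only [Set.Finite.mem_toFinset, Finset.mem_biUnion, Finset.mem_filter, mem_univ, true_and,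
      Finset.mem_image]
    constructor
    · rintro ⟨h1, h2, h3⟩
      rcases List.eq_nil_or_concat c with rfl | ⟨c', a, rfl⟩
      · simp at h2
      simp only [List.concat_eq_append] at h1 h2 h3 ⊢
      rw [List.getLast?_concat] at h3
      obtain rfl : a = x := by simpa using h3
      rcases List.eq_nil_or_concat c' with rfl | ⟨c'', b, rfl⟩
      · exfalso
        apply hne
        simpa using h2.symm
      simp only [List.concat_eq_append] at h1 h2 ⊢
      rw [List.isChain_append] at h1
      refine ⟨b, h1.2.2 b (by simp) a (by simp), c'' ++ [b], ⟨h1.1, ?_, by simp⟩, rfl⟩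
      rw [List.head?_append] at h2
      rw [← h2]
      cases c'' <;> simp
    · rintro ⟨w, hw, c', ⟨h1, h2, h3⟩, rfl⟩
      refine ⟨?_, ?_, by simp⟩
      · rw [List.isChain_append]
        refine ⟨h1, List.isChain_singleton x, ?_⟩
        intro a ha b hb
        rw [h3] at ha
        simp at ha hb
        subst ha hb
        exact hw
      · rw [List.head?_append, h2]; rfl
  rw [mu_eq rk hrk htr, hset, Finset.sum_biUnion, ← Finset.sum_neg_distrib]
  · refine Finset.sum_congr rfl fun w _ => ?_
    rw [Finset.sum_image, mu_eq rk hrk htr, ← Finset.sum_neg_distrib]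
    · refine Finset.sum_congr rfl fun c _ => ?_
      rw [List.length_append, List.length_singleton, pow_succ]
      ring
    · intro a _ b _ h
      simpa using h
  · intro w _ w' _ h
    rw [Function.onFun, Finset.disjoint_left]
    intro c hc hc'
    simp only [Finset.mem_image, Set.Finite.mem_toFinset] at hc hc'
    obtain ⟨c1, ⟨-, -, h1⟩, rfl⟩ := hc
    obtain ⟨c2, ⟨-, -, h2⟩, h3⟩ := hc'
    have : c2 = c1 := by simpa using h3
    subst this
    rw [h1] at h2
    exact h (by simpa using h2)

open Classical in
lemma mu_delta (rk : V → ℕ) (hrk : ∀ v w, R v w → rk w < rk v)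
    (htr : ∀ u v w, R u v → R v w → R u w) (v x : V) :
    ∑ w with (w = x ∨ R w x), mu R v w = if v = x then 1 else 0 := by
  have : (Finset.univ.filter fun w => w = x ∨ R w x) =
      insert x (Finset.univ.filter fun w => R w x) := by
    ext w; simp
  rw [this, Finset.sum_insert]
  · split_ifs with h
    · subst h
      rw [mu_self rk hrk htr, Finset.sum_eq_zero, add_zero]
      intro w hw
      simp only [Finset.mem_filter, mem_univ, true_and] at hw
      refine mu_zero htr _ _ ?_
      have a := hrk _ _ hw
      rintro (rfl | h)
      · exact lt_irrefl _ a
      · exact lt_irrefl _ (a.trans (hrk _ _ h))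
    · rw [mu_rec rk hrk htr v x h]; ring
  · simp only [Finset.mem_filter, mem_univ, true_and]
    intro hv; exact lt_irrefl _ (hrk _ _ hv)

end Mob

section Final
variable {V E : Type} [Fintype V]

lemma MGamma_eq (tl hd : E → V) (rk : V → ℕ) : MGamma tl hd rk =
    ∑ p : V × V, mu (Reaches tl hd) p.1 p.2 • (X : PowerSeries ℤ) ^ (rk p.1 - rk p.2) := by
  classical
  rw [MGamma, finsum_mem_eq_finite_toFinset_sum _ (Set.toFinite _)]
  refine Finset.sum_subset (Finset.subset_univ _) ?_
  intro p _ hp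
  have hp' : ¬ (p.1 = p.2 ∨ Reaches tl hd p.1 p.2) := by
    intro h; apply hp; rw [Set.Finite.mem_toFinset]; exact h
  have := mu_zero (R := Reaches tl hd) reaches_trans p.1 p.2 hp'
  change mu (Reaches tl hd) p.1 p.2 • (X : PowerSeries ℤ) ^ (rk p.1 - rk p.2) = 0
  rw [this, zero_smul]

lemma hilb_eq (F : Type) [Field F] {tl hd : E → V} {rk : V → ℕ} (hrank : IsRank tl hd rk)
    {star : V} (hstar0 : rk star = 0)
    (hmin : ∀ v : V, (∀ e : E, tl e ≠ v) ↔ v = star) :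
    hilb F tl hd rk = HS rk (Reaches tl hd) := by
  ext n
  rw [hilb, HS, coeff_mk, coeff_mk]
  have hf := fin_words rk (Reaches tl hd) n
  have : Finite {y : List (V × ℕ) // Good rk (Reaches tl hd) y ∧ (y.map Prod.snd).sum = n} :=
    hf.to_subtype
  rw [finrank_gpiece hrank hstar0 hmin n]
  congr 1
  exact (Nat.card_coe_set_eq _).trans (Set.ncard_eq_toFinset_card _ hf)

end Final
end GLGP

/-- **Corollary 4.2.** Let `Γ` be a finite generalized layered graph with a
unique minimal vertex `*` with `|*| = 0`.  Then, as formal power series over `ℤ`,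
`H(A(Γ),z) · (1 - z·M(Γ)(z)) = 1 - z`. -/
theorem hilbert_series_mobius (F : Type) [Field F] {V E : Type} [Fintype V] [Fintype E]
    (tl hd : E → V) (rk : V → ℕ) (hrank : GLG.IsRank tl hd rk)
    (star : V) (hstar0 : rk star = 0)
    (hmin : ∀ v : V, (∀ e : E, tl e ≠ v) ↔ v = star) :
    GLG.hilb F tl hd rk * (1 - PowerSeries.X * GLG.MGamma tl hd rk) =
      1 - PowerSeries.X := by
  rw [GLGP.hilb_eq F hrank hstar0 hmin, GLGP.MGamma_eq]
  exact GLGP.count_main rk (GLG.Reaches tl hd) (GLGP.reaches_rk hrank) GLGP.reaches_trans star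
    hstar0 (fun v hv => GLGP.reaches_star hrank hmin _ v rfl hv) _
    (GLGP.mu_zero GLGP.reaches_trans)
    (GLGP.mu_delta rk (GLGP.reaches_rk hrank) GLGP.reaches_trans)
end
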